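/- Let Ω ⊆ ℝⁿ, n ≥ 2, be open and bounded, with 0 ∈ Ω. Then the supremum of u*(t) / (N*_{|Ω|}(t) · ‖Δu‖_{L¹(Ω)}), taken over all t with 0 < t ≤ |Ω| and all u ∈ W^{2,1}_{Δ,0}(Ω) with Δu ≠ 0 which are radial (i.e. u(x) depends only on |x|), equals 1/2. The same supremum taken instead over all nonnegative u ∈ W^{2,1}_{Δ,0}(Ω) with Δu ≠ 0 also equals 1/2. -/

import Mathlib

open MeasureTheory Filter Topology
open scoped ENNReal

noncomputable section

/-- Euclidean space ℝⁿ. -/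
abbrev Euc (n : ℕ) := EuclideanSpace ℝ (Fin n)

/-- The (pointwise) Laplacian of a function on ℝⁿ: the trace of the second derivative. -/
def lapl (n : ℕ) (φ : Euc n → ℝ) (x : Euc n) : ℝ :=
  ∑ i : Fin n,
    iteratedFDeriv ℝ 2 φ x ![EuclideanSpace.single i (1 : ℝ), EuclideanSpace.single i (1 : ℝ)]

/-- A test function on Ω: smooth and compactly supported inside Ω. -/
def IsTestFun (n : ℕ) (Ω : Set (Euc n)) (φ : Euc n → ℝ) : Prop :=
  ContDiff ℝ (⊤ : ℕ∞) φ ∧ HasCompactSupport φ ∧ tsupport φ ⊆ Ω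

/-- `u ∈ W₀^{1,1}(Ω)`: `u` is an L¹(Ω) limit of test functions whose gradients converge
in L¹(Ω) (i.e. `u` is in the closure of C_c^∞(Ω) in the W^{1,1} norm). -/
def MemW0_1_1 (n : ℕ) (Ω : Set (Euc n)) (u : Euc n → ℝ) : Prop :=
  IntegrableOn u Ω volume ∧
  ∃ φ : ℕ → Euc n → ℝ, (∀ k, IsTestFun n Ω (φ k)) ∧
    Tendsto (fun k => ∫ x in Ω, |φ k x - u x|) atTop (𝓝 0) ∧
    ∃ g : Euc n → Euc n →L[ℝ] ℝ,
      IntegrableOn (fun x => ‖g x‖) Ω volume ∧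
      Tendsto (fun k => ∫ x in Ω, ‖fderiv ℝ (φ k) x - g x‖) atTop (𝓝 0)

/-- `u ∈ W^{2,1}_Δ(Ω)` with distributional Laplacian `f ∈ L¹(Ω)`. -/
def MemW21Delta (n : ℕ) (Ω : Set (Euc n)) (u f : Euc n → ℝ) : Prop :=
  MemW0_1_1 n Ω u ∧ IntegrableOn f Ω volume ∧
    ∀ ψ : Euc n → ℝ, IsTestFun n Ω ψ →
      ∫ x in Ω, u x * lapl n ψ x = ∫ x in Ω, f x * ψ x

/-- `u ∈ W^{2,1}_{Δ,0}(Ω)` with Laplacian `f`: `u` is an L¹(Ω) limit of test functions `φ k`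
with `Δ(φ k) → f` in L¹(Ω) (closure of C_c^∞(Ω) in the norm ‖Δu‖₁). -/
def MemW21Delta0 (n : ℕ) (Ω : Set (Euc n)) (u f : Euc n → ℝ) : Prop :=
  IntegrableOn u Ω volume ∧ IntegrableOn f Ω volume ∧
  ∃ φ : ℕ → Euc n → ℝ, (∀ k, IsTestFun n Ω (φ k)) ∧
    Tendsto (fun k => ∫ x in Ω, |φ k x - u x|) atTop (𝓝 0) ∧
    Tendsto (fun k => ∫ x in Ω, |lapl n (φ k) x - f x|) atTop (𝓝 0)

/-- The decreasing rearrangement `u*(t)` of `u` on Ω. -/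
def decRearr (n : ℕ) (Ω : Set (Euc n)) (u : Euc n → ℝ) (t : ℝ) : ℝ :=
  sInf {s : ℝ | 0 ≤ s ∧ volume {x ∈ Ω | s < |u x|} ≤ ENNReal.ofReal t}

/-- `‖f‖_{L¹(Ω)}`. -/
def L1norm (n : ℕ) (Ω : Set (Euc n)) (f : Euc n → ℝ) : ℝ := ∫ x in Ω, |f x|

/-- ω_{n-1}: surface measure of the unit sphere in ℝⁿ. -/
def omegaS (n : ℕ) : ℝ := 2 * Real.pi ^ ((n : ℝ) / 2) / Real.Gamma ((n : ℝ) / 2)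

/-- c_n = 1/((n-2) ω_{n-1}). -/
def cConst (n : ℕ) : ℝ := 1 / (((n : ℝ) - 2) * omegaS n)

/-- `N*_V(t)`: the rearrangement of the Green function of the ball of volume V. -/
def NstarV (n : ℕ) (V t : ℝ) : ℝ :=
  if n = 2 then (1 / (4 * Real.pi)) * Real.log (V / t)
  else cConst n * (omegaS n / (n : ℝ)) ^ (((n : ℝ) - 2) / (n : ℝ)) *
    (t ^ (-(((n : ℝ) - 2) / (n : ℝ))) - V ^ (-(((n : ℝ) - 2) / (n : ℝ))))

/-- `N*_∞(t)` (for n ≥ 3). -/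
def NstarInf (n : ℕ) (t : ℝ) : ℝ :=
  cConst n * (omegaS n / (n : ℝ)) ^ (((n : ℝ) - 2) / (n : ℝ)) *
    t ^ (-(((n : ℝ) - 2) / (n : ℝ)))

/-- The maximal function `u**(t) = (1/t) ∫₀ᵗ u*(s) ds`. -/
def maximalFn (n : ℕ) (Ω : Set (Euc n)) (u : Euc n → ℝ) (t : ℝ) : ℝ :=
  (1 / t) * ∫ s in (0:ℝ)..t, decRearr n Ω u s

/-- `u ∈ L_exp(Ω)`. -/
def MemLexp (n : ℕ) (Ω : Set (Euc n)) (u : Euc n → ℝ) : Prop :=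
  ∃ M : ℝ, ∀ t : ℝ, 0 < t → t ≤ (volume Ω).toReal →
    decRearr n Ω u t / (1 + Real.log ((volume Ω).toReal / t)) ≤ M

/-- `u ∈ L_{exp,0}(Ω)`. -/
def MemLexp0 (n : ℕ) (Ω : Set (Euc n)) (u : Euc n → ℝ) : Prop :=
  MemLexp n Ω u ∧
    Tendsto (fun t : ℝ => maximalFn n Ω u t / Real.log (1 / t)) (𝓝[>] 0) (𝓝 0)

/-- `u ∈ L^{n/(n-2),∞}(Ω)`. -/
def MemWeakL (n : ℕ) (Ω : Set (Euc n)) (u : Euc n → ℝ) : Prop :=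
  ∃ M : ℝ, ∀ t : ℝ, 0 < t → t ≤ (volume Ω).toReal →
    t ^ (((n : ℝ) - 2) / (n : ℝ)) * decRearr n Ω u t ≤ M

/-- `u ∈ L₀^{n/(n-2),∞}(Ω)`. -/
def MemWeakL0 (n : ℕ) (Ω : Set (Euc n)) (u : Euc n → ℝ) : Prop :=
  MemWeakL n Ω u ∧
    Tendsto (fun t : ℝ => t ^ (((n : ℝ) - 2) / (n : ℝ)) * maximalFn n Ω u t) (𝓝[>] 0) (𝓝 0)

/-- `Λ_n^0(Ω)`: equals `L_{exp,0}(Ω)` if n = 2 and `L₀^{n/(n-2),∞}(Ω)` if n ≥ 3. -/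
def MemLambda0 (n : ℕ) (Ω : Set (Euc n)) (u : Euc n → ℝ) : Prop :=
  if n = 2 then MemLexp0 n Ω u else MemWeakL0 n Ω u

theorem volume_add_le_of_forall_add_mem {A B C : Set ℝ} (hA : MeasurableSet A)
    (hB : MeasurableSet B) (hAne : A.Nonempty) (hBne : B.Nonempty)
    (hC : ∀ a ∈ A, ∀ b ∈ B, a + b ∈ C) : volume A + volume B ≤ volume C := by
  obtain ⟨a₀, ha₀⟩ := hAne
  obtain ⟨b₀, hb₀⟩ := hBne
  suffices key : ∀ K L : Set ℝ, IsCompact K → IsCompact L → K ⊆ A → L ⊆ B →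
      volume K + volume L ≤ volume C by
    rw [hA.measure_eq_iSup_isCompact, hB.measure_eq_iSup_isCompact]
    simp only [iSup_and']
    refine ENNReal.biSup_add_biSup_le' ⟨∅, by simp⟩ ⟨∅, by simp⟩ ?_
    rintro K ⟨hKA, hK⟩ L ⟨hLB, hL⟩
    exact key K L hK hL hKA hLB
  intro K L hK hL hKA hLB
  have hK' : IsCompact (insert a₀ K) := hK.insert a₀
  have hL' : IsCompact (insert b₀ L) := hL.insert b₀
  obtain ⟨a, haK, hamax⟩ := hK'.exists_isGreatest ⟨a₀, by simp⟩
  obtain ⟨b, hbL, hbmin⟩ := hL'.exists_isLeast ⟨b₀, by simp⟩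
  have hKA' : insert a₀ K ⊆ A := Set.insert_subset ha₀ hKA
  have hLB' : insert b₀ L ⊆ B := Set.insert_subset hb₀ hLB
  set K' := (fun x => x + b) '' K
  set L' := (fun x => a + x) '' L
  have hvK : volume K' = volume K := by
    simp [K', Set.image_add_right]
  have hvL : volume L' = volume L := by
    simp [L', Set.image_add_left]
  have hsub : K' ∪ L' ⊆ C := by
    rintro x (⟨y, hy, rfl⟩ | ⟨y, hy, rfl⟩)
    · exact hC _ (hKA hy) _ (hLB' hbL)
    · exact hC _ (hKA' haK) _ (hLB hy)
  have hinter : volume (K' ∩ L') = 0 := by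
    refine measure_mono_null (t := {a + b}) ?_ (by simp)
    rintro x ⟨⟨y, hy, rfl⟩, ⟨z, hz, hzy⟩⟩
    have h1 : y ≤ a := hamax (Set.mem_insert_of_mem _ hy)
    have h2 : b ≤ z := hbmin (Set.mem_insert_of_mem _ hz)
    simp only [Set.mem_singleton_iff] at hzy ⊢
    linarith
  have hmL : MeasurableSet L' := (hL.image (by fun_prop)).measurableSet
  calc volume K + volume L = volume K' + volume L' := by rw [hvK, hvL]
    _ = volume (K' ∪ L') := by
      rw [← measure_union_add_inter K' hmL, hinter, add_zero]
    _ ≤ volume C := measure_mono hsub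

theorem lintegral_eq_setLIntegral_meas_lt {f : ℝ → ℝ≥0∞} (hf : Measurable f)
    (hf1 : ∀ x, f x ≤ 1) :
    ∫⁻ x, f x = ∫⁻ t in Set.Ioo (0 : ℝ) 1, volume {x | ENNReal.ofReal t < f x} := by
  have hfin : ∀ x, f x ≠ ⊤ := fun x => ((hf1 x).trans_lt ENNReal.one_lt_top).ne
  have h1 : ∫⁻ x, f x = ∫⁻ x, ENNReal.ofReal (f x).toReal :=
    lintegral_congr fun x => (ENNReal.ofReal_toReal (hfin x)).symm
  rw [h1, lintegral_eq_lintegral_meas_lt volume (ae_of_all _ fun x => ENNReal.toReal_nonneg)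
    hf.ennreal_toReal.aemeasurable]
  have h2 : ∀ t ∈ Set.Ioi (0 : ℝ), volume {x | t < (f x).toReal} =
      (Set.Ioo (0 : ℝ) 1).indicator (fun t => volume {x | ENNReal.ofReal t < f x}) t := by
    intro t ht
    have ht0 : (0 : ℝ) < t := ht
    by_cases h : t < 1
    · rw [Set.indicator_of_mem (show t ∈ Set.Ioo (0 : ℝ) 1 from ⟨ht, h⟩)]
      congr 1
      ext x
      exact (ENNReal.ofReal_lt_iff_lt_toReal ht0.le (hfin x)).symm
    · rw [Set.indicator_of_notMem (fun h' => h h'.2)]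
      refine measure_mono_null (t := ∅) ?_ (by simp)
      intro x hx
      have : (f x).toReal ≤ 1 := ENNReal.toReal_le_of_le_ofReal zero_le_one (by simpa using hf1 x)
      exact absurd (lt_of_lt_of_le hx this) h
  rw [setLIntegral_congr_fun measurableSet_Ioi h2, setLIntegral_indicator measurableSet_Ioo]
  congr 2
  ext t
  simp only [Set.mem_inter_iff, Set.mem_Ioo, Set.mem_Ioi]
  tauto

theorem ENNReal_geom_mean_le {l : ℝ} (hl0 : 0 < l) (hl1 : l < 1) (a b : ℝ≥0∞) :
    a ^ (1 - l) * b ^ l ≤ ENNReal.ofReal (1 - l) * a + ENNReal.ofReal l * b := by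
  have h1 : 0 < 1 - l := by linarith
  by_cases ha : a = ⊤
  · rw [ha, ENNReal.mul_top (by simpa using h1)]
    simp
  by_cases hb : b = ⊤
  · rw [hb, ENNReal.mul_top (by simpa using hl0)]
    simp
  lift a to NNReal using ha
  lift b to NNReal using hb
  rw [← ENNReal.coe_rpow_of_nonneg _ h1.le, ← ENNReal.coe_rpow_of_nonneg _ hl0.le]
  have := NNReal.geom_mean_le_arith_mean2_weighted (1 - l).toNNReal l.toNNReal a b
    (by rw [← Real.toNNReal_add h1.le hl0.le]; simp)
  rw [Real.coe_toNNReal _ h1.le, Real.coe_toNNReal _ hl0.le] at this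
  unfold ENNReal.ofReal
  exact_mod_cast this

theorem lt_rpow_mul_rpow {l : ℝ} (hl0 : 0 < l) (hl1 : l < 1) {t a b : ℝ≥0∞} (ht : t ≠ ⊤)
    (ha : t < a) (hb : t < b) : t < a ^ (1 - l) * b ^ l := by
  have h1 : 0 < 1 - l := by linarith
  calc t = t ^ (1 - l) * t ^ l := by
        rcases eq_or_ne t 0 with rfl | h0
        · simp [h1, hl0]
        · rw [← ENNReal.rpow_add _ _ h0 ht]; simp
    _ < a ^ (1 - l) * b ^ l :=
        ENNReal.mul_lt_mul (ENNReal.rpow_lt_rpow ha h1) (ENNReal.rpow_lt_rpow hb hl0)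

theorem prekopa_leindler_real_of_le_one {l : ℝ} (hl0 : 0 < l) (hl1 : l < 1) {f g h : ℝ → ℝ≥0∞}
    (hf : Measurable f) (hg : Measurable g) (hh : Measurable h)
    (hf1 : ∀ x, f x ≤ 1) (hg1 : ∀ x, g x ≤ 1)
    (hfs : ∀ t < 1, ∃ x, t < f x) (hgs : ∀ t < 1, ∃ x, t < g x)
    (H : ∀ x y, f x ^ (1 - l) * g y ^ l ≤ h ((1 - l) * x + l * y)) :
    (∫⁻ x, f x) ^ (1 - l) * (∫⁻ x, g x) ^ l ≤ ∫⁻ x, h x := by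
  have h1 : 0 < 1 - l := by linarith
  refine (ENNReal_geom_mean_le hl0 hl1 _ _).trans ?_
  have hmin : ∫⁻ x, min (h x) 1 ≤ ∫⁻ x, h x := lintegral_mono fun x => min_le_left _ _
  refine le_trans ?_ hmin
  rw [lintegral_eq_setLIntegral_meas_lt hf hf1, lintegral_eq_setLIntegral_meas_lt hg hg1,
    lintegral_eq_setLIntegral_meas_lt (hh.min measurable_const) fun x => min_le_right _ _]
  rw [← lintegral_const_mul' _ _ ENNReal.ofReal_ne_top,
    ← lintegral_const_mul' _ _ ENNReal.ofReal_ne_top]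
  refine (le_lintegral_add _ _).trans ?_
  refine setLIntegral_mono' measurableSet_Ioo fun t ht => ?_
  have ht1 : ENNReal.ofReal t < 1 := by simpa using ht.2
  have hsc : ∀ (c : ℝ) (S : Set ℝ), 0 < c →
      ENNReal.ofReal c * volume S = volume ((fun x => c * x) '' S) := by
    intro c S hc
    have := Measure.addHaar_image_homothety (volume : Measure ℝ) 0 c S
    simp only [Module.finrank_self, pow_one, abs_of_pos hc] at this
    rw [← this]
    congr 1
    ext x
    simp [AffineMap.homothety_apply]
  rw [hsc _ _ h1, hsc _ _ hl0]
  have hm : ∀ (c : ℝ) (S : Set ℝ), 0 < c → MeasurableSet S →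
      MeasurableSet ((fun x => c * x) '' S) := by
    intro c S hc hS
    exact (measurableEmbedding_mulLeft₀ hc.ne').measurableSet_image.2 hS
  refine volume_add_le_of_forall_add_mem
    (hm _ _ h1 (measurableSet_lt measurable_const hf))
    (hm _ _ hl0 (measurableSet_lt measurable_const hg))
    (Set.Nonempty.image _ (hfs _ ht1)) (Set.Nonempty.image _ (hgs _ ht1)) ?_
  rintro _ ⟨x, hx, rfl⟩ _ ⟨y, hy, rfl⟩
  exact lt_min ((lt_rpow_mul_rpow hl0 hl1 ENNReal.ofReal_ne_top hx hy).trans_le (H x y)) ht1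

theorem prekopa_leindler_real_of_bounded {l : ℝ} (hl0 : 0 < l) (hl1 : l < 1) {f g h : ℝ → ℝ≥0∞}
    (hf : Measurable f) (hg : Measurable g) (hh : Measurable h)
    (hfb : ⨆ x, f x ≠ ⊤) (hgb : ⨆ x, g x ≠ ⊤)
    (H : ∀ x y, f x ^ (1 - l) * g y ^ l ≤ h ((1 - l) * x + l * y)) :
    (∫⁻ x, f x) ^ (1 - l) * (∫⁻ x, g x) ^ l ≤ ∫⁻ x, h x := by
  have h1 : 0 < 1 - l := by linarith
  set a := ⨆ x, f x with ha
  set b := ⨆ x, g x with hb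
  rcases eq_or_ne a 0 with ha0 | ha0
  · have : ∀ x, f x = 0 := fun x => by
      have := le_iSup f x
      rw [← ha, ha0] at this
      simpa using this
    simp [this, h1]
  rcases eq_or_ne b 0 with hb0 | hb0
  · have : ∀ x, g x = 0 := fun x => by
      have := le_iSup g x
      rw [← hb, hb0] at this
      simpa using this
    simp [this, hl0]
  have hA : a ^ (1 - l) ≠ 0 := by simp [ENNReal.rpow_eq_zero_iff, ha0, h1.not_gt]
  have hB : b ^ l ≠ 0 := by simp [ENNReal.rpow_eq_zero_iff, hb0, hl0.not_gt]
  have hA' : a ^ (1 - l) ≠ ⊤ := ENNReal.rpow_ne_top_of_nonneg h1.le hfb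
  have hB' : b ^ l ≠ ⊤ := ENNReal.rpow_ne_top_of_nonneg hl0.le hgb
  have hsup : ∀ {F : ℝ → ℝ≥0∞} {c : ℝ≥0∞}, c = ⨆ x, F x → c ≠ 0 → c ≠ ⊤ →
      (∀ x, c⁻¹ * F x ≤ 1) ∧ ∀ t < 1, ∃ x, t < c⁻¹ * F x := by
    intro F c hc hc0 hct
    refine ⟨fun x => ?_, fun t ht => ?_⟩
    · rw [← ENNReal.inv_mul_cancel hc0 hct]
      gcongr
      rw [hc]
      exact le_iSup F x
    · have h2 : t * c < c := by
        calc t * c < 1 * c := ENNReal.mul_lt_mul_left hc0 hct ht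
          _ = c := one_mul c
      rw [hc] at h2
      obtain ⟨x, hx⟩ := lt_iSup_iff.1 h2
      refine ⟨x, ?_⟩
      rw [← hc] at hx
      rw [mul_comm, ← div_eq_mul_inv]
      exact (ENNReal.lt_div_iff_mul_lt (Or.inl hc0) (Or.inl hct)).2 hx
  obtain ⟨f1, fs⟩ := hsup ha ha0 hfb
  obtain ⟨g1, gs⟩ := hsup hb hb0 hgb
  have hinv : ∀ (c : ℝ≥0∞) (p : ℝ), (c⁻¹) ^ p = (c ^ p)⁻¹ := fun c p => ENNReal.inv_rpow c p
  have := prekopa_leindler_real_of_le_one hl0 hl1 (f := fun x => a⁻¹ * f x)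
    (g := fun x => b⁻¹ * g x) (h := fun x => (a ^ (1 - l) * b ^ l)⁻¹ * h x)
    (hf.const_mul _) (hg.const_mul _) (hh.const_mul _) f1 g1 fs gs (fun x y => by
      rw [ENNReal.mul_rpow_of_nonneg _ _ h1.le, ENNReal.mul_rpow_of_nonneg _ _ hl0.le, hinv, hinv,
        ENNReal.mul_inv (Or.inl hA) (Or.inl hA')]
      calc _ = ((a ^ (1 - l))⁻¹ * (b ^ l)⁻¹) * (f x ^ (1 - l) * g y ^ l) := by ring
        _ ≤ _ := by gcongr; exact H x y)
  rw [lintegral_const_mul _ hf, lintegral_const_mul _ hg, lintegral_const_mul _ hh,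
    ENNReal.mul_rpow_of_nonneg _ _ h1.le, ENNReal.mul_rpow_of_nonneg _ _ hl0.le, hinv, hinv] at this
  have hAB : a ^ (1 - l) * b ^ l ≠ 0 := mul_ne_zero hA hB
  have hAB' : a ^ (1 - l) * b ^ l ≠ ⊤ := ENNReal.mul_ne_top hA' hB'
  have h3 : (a ^ (1 - l) * b ^ l)⁻¹ * ((∫⁻ x, f x) ^ (1 - l) * (∫⁻ x, g x) ^ l) ≤
      (a ^ (1 - l) * b ^ l)⁻¹ * ∫⁻ x, h x := by
    refine le_trans (le_of_eq ?_) this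
    rw [ENNReal.mul_inv (Or.inl hA) (Or.inl hA')]
    ring
  exact (ENNReal.mul_le_mul_iff_right (ENNReal.inv_ne_zero.2 hAB') (ENNReal.inv_ne_top.2 hAB)).1 h3

theorem prekopa_leindler_real {l : ℝ} (hl0 : 0 < l) (hl1 : l < 1) {f g h : ℝ → ℝ≥0∞}
    (hf : Measurable f) (hg : Measurable g) (hh : Measurable h)
    (H : ∀ x y, f x ^ (1 - l) * g y ^ l ≤ h ((1 - l) * x + l * y)) :
    (∫⁻ x, f x) ^ (1 - l) * (∫⁻ x, g x) ^ l ≤ ∫⁻ x, h x := by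
  have h1 : 0 < 1 - l := by linarith
  have hlim : ∀ F : ℝ → ℝ≥0∞, Measurable F →
      Tendsto (fun N : ℕ => ∫⁻ x, min (F x) N) atTop (𝓝 (∫⁻ x, F x)) := by
    intro F hF
    refine lintegral_tendsto_of_tendsto_of_monotone (fun N => (hF.min measurable_const).aemeasurable)
      (ae_of_all _ fun x M N hMN => ?_) (ae_of_all _ fun x => ?_)
    · exact min_le_min le_rfl (by exact_mod_cast hMN)
    · have := (tendsto_const_nhds (x := F x)).min ENNReal.tendsto_nat_nhds_top
      simpa using this
  rcases eq_or_ne (∫⁻ x, f x) 0 with hf0 | hf0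
  · simp [hf0, h1]
  rcases eq_or_ne (∫⁻ x, g x) 0 with hg0 | hg0
  · simp [hg0, hl0]
  have hlt := ENNReal.Tendsto.mul
    ((ENNReal.continuous_rpow_const (y := 1 - l)).continuousAt.tendsto.comp (hlim f hf))
    (Or.inl (by simp [ENNReal.rpow_eq_zero_iff, hf0, h1.not_gt]))
    ((ENNReal.continuous_rpow_const (y := l)).continuousAt.tendsto.comp (hlim g hg))
    (Or.inl (by simp [ENNReal.rpow_eq_zero_iff, hg0, hl0.not_gt]))
  refine le_of_tendsto hlt (Eventually.of_forall fun N => ?_)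
  refine prekopa_leindler_real_of_bounded hl0 hl1 (hf.min measurable_const)
    (hg.min measurable_const) hh ?_ ?_ fun x y => ?_
  · exact ((iSup_le fun x => min_le_right _ _).trans_lt (ENNReal.natCast_lt_top N)).ne
  · exact ((iSup_le fun x => min_le_right _ _).trans_lt (ENNReal.natCast_lt_top N)).ne
  · refine le_trans ?_ (H x y)
    gcongr <;> exact min_le_left _ _

theorem prekopa_leindler_pi {l : ℝ} (hl0 : 0 < l) (hl1 : l < 1) (n : ℕ) :
    ∀ {f g h : (Fin n → ℝ) → ℝ≥0∞}, Measurable f → Measurable g → Measurable h →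
    (∀ x y, f x ^ (1 - l) * g y ^ l ≤ h ((1 - l) • x + l • y)) →
    (∫⁻ x, f x) ^ (1 - l) * (∫⁻ x, g x) ^ l ≤ ∫⁻ x, h x := by
  induction n with
  | zero =>
    intro f g h _ _ _ H
    have hv : (volume : Measure (Fin 0 → ℝ)) Set.univ = 1 := by
      rw [volume_pi, Measure.pi_of_empty (fun _ : Fin 0 => (volume : Measure ℝ)) default]
      simp
    simp only [lintegral_unique, hv, mul_one]
    convert! H default default
  | succ n ih =>
    intro f g h hf hg hh H
    let e := (MeasurableEquiv.piFinSuccAbove (fun _ : Fin (n + 1) => ℝ) 0).symm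
    have he : MeasurePreserving e :=
      (volume_preserving_piFinSuccAbove (fun _ : Fin (n + 1) => ℝ) 0).symm _
    have hInt : ∀ F : (Fin (n + 1) → ℝ) → ℝ≥0∞, Measurable F →
        ∫⁻ x, F x = ∫⁻ s, ∫⁻ y, F (e (s, y)) := by
      intro F hF
      rw [← he.lintegral_comp hF, Measure.volume_eq_prod,
        lintegral_prod (fun z => F (e z)) (hF.comp e.measurable).aemeasurable]
    have hm : ∀ F : (Fin (n + 1) → ℝ) → ℝ≥0∞, Measurable F →
        Measurable fun s => ∫⁻ y, F (e (s, y)) := by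
      intro F hF
      exact (hF.comp e.measurable).lintegral_prod_right'
    rw [hInt f hf, hInt g hg, hInt h hh]
    refine prekopa_leindler_real hl0 hl1 (hm f hf) (hm g hg) (hm h hh) fun s t => ?_
    refine ih (hf.comp (e.measurable.comp measurable_prodMk_left))
      (hg.comp (e.measurable.comp measurable_prodMk_left))
      (hh.comp (e.measurable.comp measurable_prodMk_left)) fun x y => ?_
    convert! H (e (s, x)) (e (t, y)) using 2
    funext i
    refine Fin.cases ?_ (fun j => ?_) i <;> simp [e, MeasurableEquiv.piFinSuccAbove]

theorem prekopa_leindler {l : ℝ} (hl0 : 0 < l) (hl1 : l < 1) (n : ℕ)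
    {f g h : Euc n → ℝ≥0∞} (hf : Measurable f) (hg : Measurable g) (hh : Measurable h)
    (H : ∀ x y, f x ^ (1 - l) * g y ^ l ≤ h ((1 - l) • x + l • y)) :
    (∫⁻ x, f x) ^ (1 - l) * (∫⁻ x, g x) ^ l ≤ ∫⁻ x, h x := by
  have he := PiLp.volume_preserving_toLp (Fin n)
  rw [← he.lintegral_comp hf, ← he.lintegral_comp hg, ← he.lintegral_comp hh]
  refine prekopa_leindler_pi hl0 hl1 n (hf.comp he.measurable) (hg.comp he.measurable)
    (hh.comp he.measurable) fun x y => ?_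
  simpa using H (WithLp.toLp 2 x) (WithLp.toLp 2 y)

/-- The volume of the unit ball of ℝⁿ. -/
def unitBallVol (n : ℕ) : ℝ := volume.real (Metric.ball (0 : Euc n) 1)

theorem unitBallVol_pos (n : ℕ) : 0 < unitBallVol n :=
  ENNReal.toReal_pos (Metric.measure_ball_pos _ _ one_pos).ne' measure_ball_lt_top.ne

theorem volume_ball_eq {n : ℕ} {r : ℝ} (hr : 0 < r) (x : Euc n) :
    volume (Metric.ball x r) = ENNReal.ofReal (r ^ n * unitBallVol n) := by
  rw [Measure.addHaar_ball_of_pos _ _ hr, unitBallVol, ENNReal.ofReal_mul (by positivity),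
    finrank_euclideanSpace_fin, ofReal_measureReal measure_ball_lt_top.ne]

theorem brunn_minkowski_ball {n : ℕ} {A : Set (Euc n)} (hA : MeasurableSet A)
    {a : ℝ} (ha : 0 < a) (hAv : volume A = ENNReal.ofReal (a ^ n * unitBallVol n))
    {ε : ℝ} (hε : 0 < ε) :
    ENNReal.ofReal ((a + ε) ^ n * unitBallVol n) ≤ volume (Metric.thickening ε A) := by
  have hk := unitBallVol_pos n
  set l := ε / (a + ε) with hl
  have hs : 0 < a + ε := by positivity
  have hl0 : 0 < l := by positivity
  have hl1 : l < 1 := by rw [hl, div_lt_one hs]; linarith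
  have h1 : 0 < 1 - l := by linarith
  have h1l : 1 - l = a / (a + ε) := by rw [hl]; field_simp; ring
  set A' := (fun x : Euc n => (1 - l) • x) ⁻¹' A
  set B' := (fun x : Euc n => l • x) ⁻¹' Metric.ball (0 : Euc n) ε
  have hA' : MeasurableSet A' := hA.preimage (by fun_prop)
  have hB' : MeasurableSet B' := measurableSet_ball.preimage (by fun_prop)
  have hT : MeasurableSet (Metric.thickening ε A) := Metric.isOpen_thickening.measurableSet
  have key := prekopa_leindler hl0 hl1 n (f := A'.indicator 1) (g := B'.indicator 1)
    (h := (Metric.thickening ε A).indicator 1) (measurable_one.indicator hA')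
    (measurable_one.indicator hB') (measurable_one.indicator hT) (fun x y => by
      by_cases hx : x ∈ A'
      · by_cases hy : y ∈ B'
        · have : (1 - l) • x + l • y ∈ Metric.thickening ε A := by
            refine Metric.mem_thickening_iff.2 ⟨(1 - l) • x, hx, ?_⟩
            have : l • y ∈ Metric.ball (0 : Euc n) ε := hy
            simpa [dist_eq_norm] using this
          simp [hx, hy, this]
        · simp [hy, hl0]
      · simp [hx, h1])
  rw [lintegral_indicator_one hA', lintegral_indicator_one hB', lintegral_indicator_one hT] at key
  refine le_trans (le_of_eq ?_) key
  have hvA : volume A' = ENNReal.ofReal ((a + ε) ^ n * unitBallVol n) := by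
    rw [Measure.addHaar_preimage_smul _ h1.ne', hAv, finrank_euclideanSpace_fin,
      abs_of_pos (by positivity), ← ENNReal.ofReal_mul (by positivity), h1l]
    congr 1
    rw [div_pow]
    field_simp
  have hvB : volume B' = ENNReal.ofReal ((a + ε) ^ n * unitBallVol n) := by
    rw [Measure.addHaar_preimage_smul _ hl0.ne', volume_ball_eq hε, finrank_euclideanSpace_fin,
      abs_of_pos (by positivity), ← ENNReal.ofReal_mul (by positivity), hl]
    congr 1
    rw [div_pow]
    field_simp
  rw [hvA, hvB, ← ENNReal.rpow_add _ _ (by simpa using by positivity) ENNReal.ofReal_ne_top]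
  simp

/-- Linearized Brunn–Minkowski inequality for neighbourhoods of sets of finite volume. -/
theorem measureReal_add_le_thickening {n : ℕ} (hn2 : 2 ≤ n) {A : Set (Euc n)}
    (hA : MeasurableSet A) {ε : ℝ} (hε : 0 < ε) (hfin : volume (Metric.thickening ε A) ≠ ⊤)
    {a : ℝ} (ha : 0 ≤ a) (haA : a ^ n * unitBallVol n ≤ volume.real A) :
    volume.real A + n * unitBallVol n * a ^ (n - 1) * ε ≤ volume.real (Metric.thickening ε A) := by
  have hk := unitBallVol_pos n
  have hn : n ≠ 0 := by omega
  have hAfin : volume A ≠ ⊤ :=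
    ((measure_mono (Metric.self_subset_thickening hε A)).trans_lt hfin.lt_top).ne
  have hmono : volume.real A ≤ volume.real (Metric.thickening ε A) :=
    measureReal_mono (Metric.self_subset_thickening hε A) hfin
  rcases (measureReal_nonneg (μ := volume) (s := A)).eq_or_lt with h0 | h0
  · have : a ^ n = 0 := by
      have h2 : 0 ≤ a ^ n := by positivity
      nlinarith
    rw [pow_eq_zero_iff hn] at this
    simpa [this, show n - 1 ≠ 0 by omega] using hmono
  set b := (volume.real A / unitBallVol n) ^ ((n : ℝ)⁻¹) with hb
  have hb0 : 0 < b := by positivity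
  have hbn : b ^ n * unitBallVol n = volume.real A := by
    rw [hb, Real.rpow_inv_natCast_pow (by positivity) hn]
    field_simp
  have hab : a ≤ b := by
    refine (pow_le_pow_iff_left₀ ha hb0.le hn).1 ?_
    rw [← hbn] at haA
    exact le_of_mul_le_mul_right haA hk
  have hbm := brunn_minkowski_ball hA hb0 (by rw [hbn, ofReal_measureReal hAfin]) hε
  have hbm' := (ENNReal.ofReal_le_iff_le_toReal hfin).1 hbm
  have hbern : b ^ n + n * b ^ (n - 1) * ε ≤ (b + ε) ^ n := by
    have := one_add_mul_le_pow (a := ε / b) (by have : 0 ≤ ε / b := by positivity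
                                                linarith) n
    have h2 : b ^ n = b ^ (n - 1) * b := by rw [← pow_succ, Nat.sub_add_cancel (by omega)]
    calc b ^ n + n * b ^ (n - 1) * ε = b ^ n * (1 + n * (ε / b)) := by
          rw [h2]; field_simp
      _ ≤ b ^ n * (1 + ε / b) ^ n := by gcongr
      _ = (b + ε) ^ n := by rw [← mul_pow]; congr 1; field_simp
  have hpow : a ^ (n - 1) ≤ b ^ (n - 1) := by gcongr
  calc volume.real A + n * unitBallVol n * a ^ (n - 1) * ε
      ≤ b ^ n * unitBallVol n + n * unitBallVol n * b ^ (n - 1) * ε := by rw [hbn]; gcongr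
    _ = (b ^ n + n * b ^ (n - 1) * ε) * unitBallVol n := by ring
    _ ≤ (b + ε) ^ n * unitBallVol n := by gcongr
    _ ≤ _ := hbm'

/-- The `i`-th standard basis vector of ℝⁿ. -/
abbrev stdVec {n : ℕ} (i : Fin n) : Euc n := EuclideanSpace.single i (1 : ℝ)

theorem lapl_eq_sum_fderiv {n : ℕ} {φ : Euc n → ℝ} (hφ : ContDiff ℝ 2 φ) (x : Euc n) :
    lapl n φ x = ∑ i : Fin n, fderiv ℝ (fun y => fderiv ℝ φ y (stdVec i)) x (stdVec i) := by
  unfold lapl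
  refine Finset.sum_congr rfl fun i _ => ?_
  rw [iteratedFDeriv_two_apply]
  have hd : DifferentiableAt ℝ (fderiv ℝ φ) x :=
    (hφ.fderiv_right (m := 1) le_rfl).differentiable one_ne_zero x
  rw [fderiv_clm_apply hd (differentiableAt_const _)]
  simp

theorem contDiff_fderiv_apply {n : ℕ} {φ : Euc n → ℝ} {m k : WithTop ℕ∞} (hφ : ContDiff ℝ m φ)
    (hk : k + 1 ≤ m) (v : Euc n) : ContDiff ℝ k fun y => fderiv ℝ φ y v :=
  (hφ.fderiv_right hk).clm_apply contDiff_const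

theorem continuous_lapl {n : ℕ} {φ : Euc n → ℝ} (hφ : ContDiff ℝ 2 φ) :
    Continuous (lapl n φ) := by
  rw [funext fun x => lapl_eq_sum_fderiv hφ x]
  refine continuous_finsetSum _ fun i _ => ?_
  exact ((contDiff_fderiv_apply hφ (k := 1) le_rfl _).continuous_fderiv one_ne_zero).clm_apply
    continuous_const

theorem hasCompactSupport_lapl {n : ℕ} {φ : Euc n → ℝ} (hc : HasCompactSupport φ) :
    HasCompactSupport (lapl n φ) := by
  refine (hc.iteratedFDeriv (𝕜 := ℝ) 2).mono ?_
  intro x hx h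
  apply hx
  simp [lapl, h]

theorem integrable_lapl {n : ℕ} {φ : Euc n → ℝ} (hφ : ContDiff ℝ 2 φ)
    (hc : HasCompactSupport φ) : Integrable (lapl n φ) :=
  (continuous_lapl hφ).integrable_of_hasCompactSupport (hasCompactSupport_lapl hc)

theorem integral_mul_lapl {n : ℕ} {φ w : Euc n → ℝ} (hφ : ContDiff ℝ 2 φ)
    (hc : HasCompactSupport φ) (hw : ContDiff ℝ 1 w) :
    ∫ x, w x * lapl n φ x =
      -∫ x, ∑ i : Fin n, fderiv ℝ w x (stdVec i) * fderiv ℝ φ x (stdVec i) := by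
  have h1 : ∀ i : Fin n, ContDiff ℝ 1 fun y => fderiv ℝ φ y (stdVec i) := fun i =>
    contDiff_fderiv_apply hφ le_rfl _
  have hc1 : ∀ i : Fin n, HasCompactSupport fun y => fderiv ℝ φ y (stdVec i) := fun i =>
    hc.fderiv_apply (𝕜 := ℝ) _
  have i1 : ∀ i : Fin n, Integrable fun x => fderiv ℝ w x (stdVec i) * fderiv ℝ φ x (stdVec i) :=
    fun i => (((hw.continuous_fderiv one_ne_zero).clm_apply continuous_const).mul
      (h1 i).continuous).integrable_of_hasCompactSupport (hc1 i).mul_left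
  have i2 : ∀ i : Fin n, Integrable fun x =>
      w x * fderiv ℝ (fun y => fderiv ℝ φ y (stdVec i)) x (stdVec i) :=
    fun i => (hw.continuous.mul (((h1 i).continuous_fderiv one_ne_zero).clm_apply
      continuous_const)).integrable_of_hasCompactSupport
        ((hc1 i).fderiv_apply (𝕜 := ℝ) (stdVec i)).mul_left
  have i3 : ∀ i : Fin n, Integrable fun x => w x * fderiv ℝ φ x (stdVec i) :=
    fun i => (hw.continuous.mul (h1 i).continuous).integrable_of_hasCompactSupport (hc1 i).mul_left
  simp only [lapl_eq_sum_fderiv hφ, Finset.mul_sum]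
  rw [integral_finsetSum _ fun i _ => i2 i, integral_finsetSum _ fun i _ => i1 i,
    ← Finset.sum_neg_distrib]
  refine Finset.sum_congr rfl fun i _ => ?_
  exact integral_mul_fderiv_eq_neg_fderiv_mul_of_integrable (i1 i) (i2 i) (i3 i)
    (fun x _ => hw.differentiable one_ne_zero x)
    (fun x _ => (h1 i).differentiable one_ne_zero x)

theorem integral_lapl_eq_zero {n : ℕ} {φ : Euc n → ℝ} (hφ : ContDiff ℝ 2 φ)
    (hc : HasCompactSupport φ) : ∫ x, lapl n φ x = 0 := by
  have := integral_mul_lapl hφ hc (w := fun _ => 1) contDiff_const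
  simpa using this

/-- The pairing of `Δφ` with a function of oscillation at most `c` is at most `c/2 ‖Δφ‖₁`. -/
theorem abs_integral_mul_lapl_le {n : ℕ} {φ w : Euc n → ℝ} (hφ : ContDiff ℝ 2 φ)
    (hc : HasCompactSupport φ) (hw : Continuous w) {c : ℝ} (hw0 : ∀ x, 0 ≤ w x)
    (hwc : ∀ x, w x ≤ c) :
    |∫ x, w x * lapl n φ x| ≤ c * ((∫ x, |lapl n φ x|) / 2) := by
  have hL := integrable_lapl hφ hc
  have hwL : Integrable fun x => w x * lapl n φ x :=
    (hw.mul (continuous_lapl hφ)).integrable_of_hasCompactSupport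
      (hasCompactSupport_lapl hc).mul_left
  have h1 : ∫ x, w x * lapl n φ x = ∫ x, (w x - c / 2) * lapl n φ x := by
    simp only [sub_mul]
    rw [integral_sub hwL (hL.const_mul _), integral_const_mul, integral_lapl_eq_zero hφ hc]
    simp
  rw [h1]
  calc |∫ x, (w x - c / 2) * lapl n φ x| ≤ ∫ x, |(w x - c / 2) * lapl n φ x| :=
        abs_integral_le_integral_abs
    _ ≤ ∫ x, c / 2 * |lapl n φ x| := by
        refine integral_mono_of_nonneg (ae_of_all _ fun x => abs_nonneg _) (hL.abs.const_mul _)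
          (ae_of_all _ fun x => ?_)
        simp only [abs_mul]
        gcongr
        rw [abs_le]
        constructor <;> linarith [hw0 x, hwc x]
    _ = c * ((∫ x, |lapl n φ x|) / 2) := by rw [integral_const_mul]; ring

theorem sum_sq_apply_stdVec {n : ℕ} (L : Euc n →L[ℝ] ℝ) : ∑ i, L (stdVec i) * L (stdVec i) = ‖L‖ ^ 2 := by
  set g := (InnerProductSpace.toDual ℝ (Euc n)).symm L with hg
  have h1 : ‖L‖ = ‖g‖ := by rw [hg, LinearIsometryEquiv.norm_map]
  have h2 : ∀ i, L (stdVec i) = g i := fun i => by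
    rw [← InnerProductSpace.toDual_symm_apply (𝕜 := ℝ) (x := stdVec i) (y := L), ← hg,
      EuclideanSpace.inner_single_right]
    simp
  rw [h1, EuclideanSpace.norm_sq_eq]
  simp [h2, sq]

theorem exists_continuous_plateau {p q η : ℝ} (hη : 0 < η) :
    ∃ b : ℝ → ℝ, Continuous b ∧ (∀ y, 0 ≤ b y) ∧ (∀ y, b y ≤ 1) ∧
      (∀ y ∈ Set.Icc p q, b y = 1) ∧ ∀ y, y ∉ Set.Ioo (p - η) (q + η) → b y = 0 := by
  obtain ⟨f, h0, h1, h2⟩ := exists_continuous_zero_one_of_isClosed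
    (s := (Set.Ioo (p - η) (q + η))ᶜ) (t := Set.Icc p q) isOpen_Ioo.isClosed_compl isClosed_Icc
    (Set.disjoint_left.2 fun x hx hx' => hx ⟨by linarith [hx'.1], by linarith [hx'.2]⟩)
  exact ⟨f, f.continuous, fun y => (h2 y).1, fun y => (h2 y).2, fun y hy => h1 hy,
    fun y hy => h0 hy⟩

theorem primitive_mem_Icc {b : ℝ → ℝ} (hb : Continuous b) (hb0 : ∀ y, 0 ≤ b y)
    (hb1 : ∀ y, b y ≤ 1) {p q : ℝ} (hpq : p ≤ q) (hbz : ∀ y, y ∉ Set.Ioo p q → b y = 0) (y : ℝ) :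
    0 ≤ ∫ z in p..y, b z ∧ ∫ z in p..y, b z ≤ q - p := by
  have hi : ∀ u v : ℝ, IntervalIntegrable b volume u v := fun u v => hb.intervalIntegrable u v
  have hz : ∀ u v : ℝ, (∀ z ∈ Set.uIcc u v, z ∉ Set.Ioo p q) → ∫ z in u..v, b z = 0 := by
    intro u v h
    rw [intervalIntegral.integral_congr (g := fun _ => (0 : ℝ)) fun z hz => hbz z (h z hz)]
    simp
  have hle : ∀ v, p ≤ v → 0 ≤ ∫ z in p..v, b z ∧ ∫ z in p..v, b z ≤ v - p := by
    intro v hv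
    refine ⟨intervalIntegral.integral_nonneg hv fun z _ => hb0 z, ?_⟩
    calc ∫ z in p..v, b z ≤ ∫ z in p..v, (1 : ℝ) :=
          intervalIntegral.integral_mono_on hv (hi _ _) (by simp) fun z _ => hb1 z
      _ = v - p := by simp
  rcases le_total y p with h | h
  · rw [hz p y fun z hz hz' => ?_]
    · exact ⟨le_rfl, by linarith⟩
    · rw [Set.uIcc_of_ge h] at hz
      linarith [hz.2, hz'.1]
  rcases le_total y q with h' | h'
  · exact ⟨(hle y h).1, (hle y h).2.trans (by linarith)⟩
  · rw [← intervalIntegral.integral_add_adjacent_intervals (hi p q) (hi q y),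
      hz q y fun z hz hz' => ?_, add_zero]
    · exact hle q hpq
    · rw [Set.uIcc_of_le h'] at hz
      linarith [hz.1, hz'.2]

theorem contDiff_one_primitive {b : ℝ → ℝ} (hb : Continuous b) (p : ℝ) :
    ContDiff ℝ 1 fun y => ∫ z in p..y, b z := by
  rw [contDiff_one_iff_deriv]
  have : ∀ y, HasDerivAt (fun y => ∫ z in p..y, b z) (b y) y := fun y =>
    hb.integral_hasStrictDerivAt p y |>.hasDerivAt
  exact ⟨fun y => (this y).differentiableAt, by rwa [funext fun y => (this y).deriv]⟩

theorem exists_abs_sub_le_of_contDiff_two {n : ℕ} {φ : Euc n → ℝ} (hφ : ContDiff ℝ 2 φ)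
    (hc : HasCompactSupport φ) :
    ∃ K : ℝ, 0 ≤ K ∧ ∀ ε, ∀ x y, dist y x < ε → φ y ≤ φ x + ε * (‖fderiv ℝ φ x‖ + K * ε) := by
  obtain ⟨K, hK⟩ := ContDiff.lipschitzWith_of_hasCompactSupport (hc.fderiv (𝕜 := ℝ))
    (hφ.fderiv_right (m := 1) le_rfl) one_ne_zero
  refine ⟨K, K.2, fun ε x y hy => ?_⟩
  have hε : 0 < ε := dist_nonneg.trans_lt hy
  have h1 := (convex_ball x ε).norm_image_sub_le_of_norm_fderiv_le' (𝕜 := ℝ) (f := φ)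
    (φ := fderiv ℝ φ x) (C := K * ε) (fun z _ => hφ.differentiable two_ne_zero z) (fun z hz => by
      have := hK.dist_le_mul z x
      rw [dist_eq_norm] at this
      refine this.trans ?_
      have h2 : dist z x < ε := hz
      gcongr) (Metric.mem_ball_self hε) (show y ∈ Metric.ball x ε from hy)
  rw [dist_eq_norm] at hy
  have h2 := le_of_abs_le h1
  have h3 : fderiv ℝ φ x (y - x) ≤ ‖fderiv ℝ φ x‖ * ‖y - x‖ :=
    (le_abs_self _).trans ((fderiv ℝ φ x).le_opNorm _)
  have h4 : ‖fderiv ℝ φ x‖ * ‖y - x‖ ≤ ‖fderiv ℝ φ x‖ * ε := by gcongr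
  have h5 : (K : ℝ) * ε * ‖y - x‖ ≤ K * ε * ε := by gcongr
  nlinarith

theorem volume_superlevel_lt_top {n : ℕ} {φ : Euc n → ℝ}
    (hc : HasCompactSupport φ) {p : ℝ} (hp : 0 < p) : volume {x | p < φ x} < ⊤ := by
  refine (measure_mono ?_).trans_lt hc.measure_lt_top
  intro x hx
  refine subset_tsupport φ ?_
  have : p < φ x := hx
  exact (hp.trans this).ne'

theorem setIntegral_norm_fderiv_sq_le {n : ℕ} {φ : Euc n → ℝ} (hφ : ContDiff ℝ 2 φ)
    (hc : HasCompactSupport φ) {p q : ℝ} (hpq : p ≤ q) :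
    ∫ x in {x | p < φ x ∧ φ x ≤ q}, ‖fderiv ℝ φ x‖ ^ 2 ≤
      (q - p) * ((∫ x, |lapl n φ x|) / 2) := by
  set M := (∫ x, |lapl n φ x|) / 2
  have hcont : Continuous fun x => ‖fderiv ℝ φ x‖ ^ 2 := by
    have := hφ.continuous_fderiv two_ne_zero
    fun_prop
  have hcs : HasCompactSupport fun x => ‖fderiv ℝ φ x‖ ^ 2 :=
    (hc.fderiv (𝕜 := ℝ)).norm.comp_left (g := fun t : ℝ => t ^ 2) (by simp)
  have hmeas : MeasurableSet {x | p < φ x ∧ φ x ≤ q} :=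
    (measurableSet_lt measurable_const hφ.continuous.measurable).inter
      (measurableSet_le hφ.continuous.measurable measurable_const)
  have key : ∀ η : ℝ, 0 < η →
      ∫ x in {x | p < φ x ∧ φ x ≤ q}, ‖fderiv ℝ φ x‖ ^ 2 ≤ (q - p + 2 * η) * M := by
    intro η hη
    obtain ⟨b, hb, hb0, hb1, hbI, hbz⟩ := exists_continuous_plateau (p := p) (q := q) hη
    set T : ℝ → ℝ := fun y => ∫ z in (p - η)..y, b z with hT
    have hTI := primitive_mem_Icc hb hb0 hb1 (p := p - η) (q := q + η) (by linarith) hbz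
    have hTd : ContDiff ℝ 1 T := contDiff_one_primitive hb _
    have hw : ContDiff ℝ 1 fun x => T (φ x) := hTd.comp (hφ.of_le one_le_two)
    have hderiv : ∀ x v, fderiv ℝ (fun x => T (φ x)) x v = b (φ x) * fderiv ℝ φ x v := by
      intro x v
      have h1 : HasDerivAt T (b (φ x)) (φ x) := (hb.integral_hasStrictDerivAt _ _).hasDerivAt
      have h2 := h1.comp_hasFDerivAt x (hφ.differentiable two_ne_zero x).hasFDerivAt
      rw [(show HasFDerivAt (fun x => T (φ x)) _ x from h2).fderiv]
      simp
    have h1 := integral_mul_lapl hφ hc hw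
    have h2 := abs_integral_mul_lapl_le hφ hc hw.continuous (fun x => (hTI (φ x)).1)
      (fun x => (hTI (φ x)).2)
    have h3 : ∀ x, ∑ i : Fin n, fderiv ℝ (fun x => T (φ x)) x (stdVec i) *
        fderiv ℝ φ x (stdVec i) = b (φ x) * ‖fderiv ℝ φ x‖ ^ 2 := by
      intro x
      simp only [hderiv, mul_assoc, ← Finset.mul_sum, sum_sq_apply_stdVec]
    simp only [h3] at h1
    rw [h1, abs_neg] at h2
    have hInt : Integrable fun x => b (φ x) * ‖fderiv ℝ φ x‖ ^ 2 :=
      ((hb.comp hφ.continuous).mul hcont).integrable_of_hasCompactSupport hcs.mul_left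
    have h4 : ∫ x in {x | p < φ x ∧ φ x ≤ q}, ‖fderiv ℝ φ x‖ ^ 2 ≤
        ∫ x, b (φ x) * ‖fderiv ℝ φ x‖ ^ 2 := by
      rw [← integral_indicator hmeas]
      refine integral_mono_of_nonneg
        (ae_of_all _ fun x => Set.indicator_nonneg (fun x _ => by positivity) x) hInt
        (ae_of_all _ fun x => ?_)
      by_cases hx : x ∈ {x | p < φ x ∧ φ x ≤ q}
      · have hx' : p < φ x ∧ φ x ≤ q := hx
        simp only [Set.indicator_of_mem hx]
        rw [hbI _ ⟨hx'.1.le, hx'.2⟩, one_mul]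
      · simp only [Set.indicator_of_notMem hx]
        exact mul_nonneg (hb0 _) (by positivity)
    calc _ ≤ _ := h4
      _ ≤ _ := (le_abs_self _).trans h2
      _ = _ := by ring
  have hlim : Tendsto (fun η : ℝ => (q - p + 2 * η) * M) (𝓝[>] 0) (𝓝 ((q - p + 2 * 0) * M)) := by
    refine Tendsto.mono_left ?_ nhdsWithin_le_nhds
    exact (Continuous.tendsto (by fun_prop) 0)
  have := ge_of_tendsto hlim (eventually_nhdsWithin_of_forall fun η hη => key η hη)
  simpa using this

/-- The functional isoperimetric inequality between two levels of a `C²` function. -/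
theorem mul_isoperimetric_le_setIntegral_norm_fderiv {n : ℕ} (hn : 2 ≤ n) {φ : Euc n → ℝ}
    (hφ : ContDiff ℝ 2 φ) (hc : HasCompactSupport φ) {p q a : ℝ} (hp : 0 < p)
    (ha : 0 ≤ a) (haq : a ^ n * unitBallVol n ≤ volume.real {x | q < φ x}) :
    (q - p) * (n * unitBallVol n * a ^ (n - 1)) ≤
      ∫ x in {x | p < φ x ∧ φ x ≤ q}, ‖fderiv ℝ φ x‖ := by
  set P := n * unitBallVol n * a ^ (n - 1) with hP
  have hk := unitBallVol_pos n
  have hP0 : 0 ≤ P := by positivity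
  set S := {x | p < φ x ∧ φ x ≤ q} with hS
  have hcD : Continuous fun x => ‖fderiv ℝ φ x‖ := (hφ.continuous_fderiv two_ne_zero).norm
  have hmS : MeasurableSet S :=
    (measurableSet_lt measurable_const hφ.continuous.measurable).inter
      (measurableSet_le hφ.continuous.measurable measurable_const)
  have hSfin : volume S < ⊤ :=
    (measure_mono fun x hx => hx.1).trans_lt (volume_superlevel_lt_top hc hp)
  have hiD : Integrable fun x => ‖fderiv ℝ φ x‖ :=
    hcD.integrable_of_hasCompactSupport (hc.fderiv (𝕜 := ℝ)).norm
  obtain ⟨K, hK0, hK⟩ := exists_abs_sub_le_of_contDiff_two hφ hc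
  obtain ⟨G, hG⟩ := (hc.fderiv (𝕜 := ℝ)).exists_bound_of_continuous
    (hφ.continuous_fderiv two_ne_zero)
  have key : ∀ ε ∈ Set.Ioo (0 : ℝ) 1, (q - p - ε * (G + K)) * P ≤
      (∫ x in S, ‖fderiv ℝ φ x‖) + K * ε * volume.real S := by
    intro ε hε
    have hε0 : 0 < ε := hε.1
    set η := ε * (G + K) with hη
    set w : Euc n → ℝ := fun x => φ x + ε * (‖fderiv ℝ φ x‖ + K * ε) with hw
    have hwc : Continuous w := by have := hφ.continuous; fun_prop
    have hG0 : 0 ≤ G := (norm_nonneg _).trans (hG 0)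
    have hη0 : 0 ≤ η := by positivity
    have hwη : ∀ x, w x ≤ φ x + η := by
      intro x
      have h1 : ‖fderiv ℝ φ x‖ + K * ε ≤ G + K :=
        add_le_add (hG x) (mul_le_of_le_one_right hK0 hε.2.le)
      simp only [hw, hη]
      gcongr
    set D : Set (ℝ × Euc n) := {z | φ z.2 ≤ z.1 ∧ z.1 < w z.2} with hD
    have hmD : MeasurableSet D :=
      (measurableSet_le (hφ.continuous.measurable.comp measurable_snd) measurable_fst).inter
        (measurableSet_lt measurable_fst (hwc.measurable.comp measurable_snd))
    have e1 := Measure.prod_apply (μ := volume.restrict (Set.Ioc (p + η) q))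
      (ν := (volume : Measure (Euc n))) hmD
    have e2 := Measure.prod_apply_symm (μ := volume.restrict (Set.Ioc (p + η) q))
      (ν := (volume : Measure (Euc n))) hmD
    rw [e1] at e2
    have lower : ENNReal.ofReal (q - p - η) * ENNReal.ofReal (P * ε) ≤
        ∫⁻ τ in Set.Ioc (p + η) q, volume (Prod.mk τ ⁻¹' D) := by
      have : ∫⁻ τ in Set.Ioc (p + η) q, ENNReal.ofReal (P * ε) =
          ENNReal.ofReal (q - p - η) * ENNReal.ofReal (P * ε) := by
        rw [setLIntegral_const, Real.volume_Ioc, mul_comm]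
        congr 2
        ring
      rw [← this]
      refine setLIntegral_mono' measurableSet_Ioc fun τ hτ => ?_
      have hτ0 : 0 < τ := by linarith [hτ.1]
      set A := {x | τ < φ x} with hA
      have hmA : MeasurableSet A := measurableSet_lt measurable_const hφ.continuous.measurable
      have hAfin := volume_superlevel_lt_top hc hτ0
      have hAb : Bornology.IsBounded A := hc.isCompact.isBounded.subset fun x hx =>
        subset_tsupport φ (hτ0.trans hx).ne'
      have hTfin : volume (Metric.thickening ε A) ≠ ⊤ :=
        (hAb.thickening (δ := ε)).measure_lt_top.ne
      have haA : a ^ n * unitBallVol n ≤ volume.real A :=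
        haq.trans (measureReal_mono (fun x (hx : q < φ x) => hτ.2.trans_lt hx) hAfin.ne)
      have h1 := measureReal_add_le_thickening hn hmA hε0 hTfin ha haA
      have h2 : Metric.thickening ε A \ A ⊆ Prod.mk τ ⁻¹' D := by
        rintro x ⟨hx, hxA⟩
        obtain ⟨y, hy, hxy⟩ := Metric.mem_thickening_iff.1 hx
        refine ⟨not_lt.1 hxA, lt_of_lt_of_le hy (hK ε x y ?_)⟩
        rwa [dist_comm]
      refine le_trans ?_ (measure_mono h2)
      rw [ENNReal.ofReal_le_iff_le_toReal (measure_ne_top_of_subset Set.sdiff_subset hTfin)]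
      have h3 := measureReal_sdiff (μ := volume) (Metric.self_subset_thickening hε0 A) hmA hTfin
      rw [← measureReal_def, h3]
      linarith
    have upper : ∫⁻ x, (volume.restrict (Set.Ioc (p + η) q)) ((fun τ => (τ, x)) ⁻¹' D) ≤
        ENNReal.ofReal (∫ x in S, ε * (‖fderiv ℝ φ x‖ + K * ε)) := by
      have hInt : IntegrableOn (fun x => ε * (‖fderiv ℝ φ x‖ + K * ε)) S :=
        (hiD.integrableOn.add (integrableOn_const hSfin.ne)).const_mul ε
      have hnn : 0 ≤ᵐ[volume.restrict S] fun x => ε * (‖fderiv ℝ φ x‖ + K * ε) :=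
        ae_of_all _ fun x => by positivity
      rw [ofReal_integral_eq_lintegral_ofReal hInt hnn, ← lintegral_indicator hmS]
      refine lintegral_mono fun x => ?_
      rw [Measure.restrict_apply' measurableSet_Ioc]
      by_cases hx : x ∈ S
      · rw [Set.indicator_of_mem hx]
        refine (measure_mono (t := Set.Ico (φ x) (w x)) fun τ hτ => hτ.1).trans ?_
        rw [Real.volume_Ico]
        simp [hw]
      · rw [Set.indicator_of_notMem hx]
        refine (measure_mono_null (t := ∅) ?_ (by simp)).le
        rintro τ ⟨⟨h1, h2⟩, h3, h4⟩
        refine hx ⟨?_, h1.trans h4⟩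
        have h1' : φ x ≤ τ := h1
        have h2' : τ < w x := h2
        linarith [hwη x]
    have h5 := lower.trans (e2.trans_le upper)
    have h6 : ∫ x in S, ε * (‖fderiv ℝ φ x‖ + K * ε) =
        ε * ((∫ x in S, ‖fderiv ℝ φ x‖) + K * ε * volume.real S) := by
      rw [integral_const_mul, integral_add hiD.integrableOn (integrableOn_const hSfin.ne),
        setIntegral_const, smul_eq_mul]
      ring
    rw [h6] at h5
    have hnn : 0 ≤ ∫ x in S, ‖fderiv ℝ φ x‖ := integral_nonneg fun x => norm_nonneg _
    rcases le_or_gt (q - p - η) 0 with h7 | h7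
    · have : (q - p - η) * P ≤ 0 := mul_nonpos_of_nonpos_of_nonneg h7 hP0
      have : 0 ≤ K * ε * volume.real S := by positivity
      linarith
    · rw [← ENNReal.ofReal_mul h7.le, ENNReal.ofReal_le_ofReal_iff (by positivity)] at h5
      refine le_of_mul_le_mul_left ?_ hε0
      linarith
  have hl1 : Tendsto (fun ε : ℝ => (q - p - ε * (G + K)) * P) (𝓝[>] 0)
      (𝓝 ((q - p - 0 * (G + K)) * P)) :=
    Tendsto.mono_left (Continuous.tendsto (by fun_prop) 0) nhdsWithin_le_nhds
  have hl2 : Tendsto (fun ε : ℝ => (∫ x in S, ‖fderiv ℝ φ x‖) + K * ε * volume.real S) (𝓝[>] 0)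
      (𝓝 ((∫ x in S, ‖fderiv ℝ φ x‖) + K * 0 * volume.real S)) :=
    Tendsto.mono_left (Continuous.tendsto (by fun_prop) 0) nhdsWithin_le_nhds
  have := le_of_tendsto_of_tendsto hl1 hl2
    (Filter.mem_of_superset (Ioo_mem_nhdsGT one_pos) key)
  simpa using this


theorem sq_setIntegral_le_measureReal_mul {α : Type*} [MeasurableSpace α] {μ : Measure α}
    {S : Set α} (hS : μ S < ⊤) {f : α → ℝ} (hf : IntegrableOn f S μ)
    (hf2 : IntegrableOn (fun x => f x ^ 2) S μ) :
    (∫ x in S, f x ∂μ) ^ 2 ≤ μ.real S * ∫ x in S, f x ^ 2 ∂μ := by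
  set I := ∫ x in S, f x ∂μ
  set m := μ.real S
  have hm : 0 ≤ m := measureReal_nonneg
  have h1 : ∀ c : ℝ, 0 ≤ (∫ x in S, f x ^ 2 ∂μ) - 2 * c * I + c ^ 2 * m := by
    intro c
    have h2 : ∫ x in S, (f x - c) ^ 2 ∂μ = (∫ x in S, f x ^ 2 ∂μ) - 2 * c * I + c ^ 2 * m := by
      have h3 : ∀ x, (f x - c) ^ 2 = f x ^ 2 - 2 * c * f x + c ^ 2 := fun x => by ring
      simp only [h3]
      have hi1 : IntegrableOn (fun x => 2 * c * f x) S μ := hf.const_mul _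
      have hi2 : IntegrableOn (fun x => f x ^ 2 - 2 * c * f x) S μ := hf2.sub hi1
      rw [integral_add hi2 (integrableOn_const hS.ne),
        integral_sub hf2 hi1, integral_const_mul, setIntegral_const, smul_eq_mul]
      ring
    rw [← h2]
    exact integral_nonneg fun x => sq_nonneg _
  rcases hm.eq_or_lt with h0 | h0
  · have : I = 0 := by
      refine setIntegral_measure_zero f ?_
      exact (measureReal_eq_zero_iff hS.ne).1 h0.symm
    rw [this, ← h0]
    simp
  · have := h1 (I / m)
    have h4 : 2 * (I / m) * I = 2 * (I ^ 2 / m) := by ring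
    have h5 : (I / m) ^ 2 * m = I ^ 2 / m := by field_simp
    rw [h4, h5] at this
    have h6 : I ^ 2 / m ≤ ∫ x in S, f x ^ 2 ∂μ := by linarith
    rwa [div_le_iff₀ h0, mul_comm] at h6

theorem strip_inequality {n : ℕ} (hn : 2 ≤ n) {φ : Euc n → ℝ}
    (hφ : ContDiff ℝ 2 φ) (hc : HasCompactSupport φ) {s δ a : ℝ} (hs : 0 < s) (hδ : 0 < δ)
    (ha : 0 ≤ a) (haq : a ^ n * unitBallVol n ≤ volume.real {x | s + δ < φ x}) :
    δ * (n * unitBallVol n * a ^ (n - 1)) ^ 2 ≤ ((∫ x, |lapl n φ x|) / 2) *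
      (volume.real {x | s < φ x} - volume.real {x | s + δ < φ x}) := by
  have h1 := mul_isoperimetric_le_setIntegral_norm_fderiv hn hφ hc hs ha haq
  have h2 := setIntegral_norm_fderiv_sq_le hφ hc (show s ≤ s + δ by linarith)
  have hcD : Continuous fun x => ‖fderiv ℝ φ x‖ := (hφ.continuous_fderiv two_ne_zero).norm
  have hcs : HasCompactSupport fun x => ‖fderiv ℝ φ x‖ := (hc.fderiv (𝕜 := ℝ)).norm
  have hSfin : volume {x | s < φ x ∧ φ x ≤ s + δ} < ⊤ :=
    (measure_mono fun x hx => hx.1).trans_lt (volume_superlevel_lt_top hc hs)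
  have hi1 : Integrable fun x => ‖fderiv ℝ φ x‖ := hcD.integrable_of_hasCompactSupport hcs
  have hcs2 : HasCompactSupport fun x => ‖fderiv ℝ φ x‖ ^ 2 :=
    hcs.comp_left (g := fun t : ℝ => t ^ 2) (by simp)
  have hi2 : Integrable fun x => ‖fderiv ℝ φ x‖ ^ 2 :=
    (hcD.pow 2).integrable_of_hasCompactSupport hcs2
  have h3 := sq_setIntegral_le_measureReal_mul hSfin hi1.integrableOn hi2.integrableOn
  have h4 : volume.real {x | s < φ x ∧ φ x ≤ s + δ} =
      volume.real {x | s < φ x} - volume.real {x | s + δ < φ x} := by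
    have hsub : {x | s + δ < φ x} ⊆ {x | s < φ x} := fun x (hx : s + δ < φ x) => by
      change s < φ x
      linarith
    rw [← measureReal_sdiff hsub (measurableSet_lt measurable_const hφ.continuous.measurable)
      (volume_superlevel_lt_top hc hs).ne]
    congr 1
    ext x
    simp
  have hD : 0 ≤ volume.real {x | s < φ x} - volume.real {x | s + δ < φ x} := by
    rw [← h4]
    exact measureReal_nonneg
  rw [h4] at h3
  have hP : 0 ≤ n * unitBallVol n * a ^ (n - 1) := by
    have := unitBallVol_pos n
    positivity
  rw [show s + δ - s = δ by ring] at h1 h2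
  generalize volume.real {x | s < φ x} - volume.real {x | s + δ < φ x} = D at *
  generalize n * unitBallVol n * a ^ (n - 1) = P at *
  generalize (∫ x, |lapl n φ x|) / 2 = M at *
  have h6 : (δ * P) ^ 2 ≤ D * (δ * M) :=
    (pow_le_pow_left₀ (by positivity) h1 2).trans
      (h3.trans (mul_le_mul_of_nonneg_left h2 hD))
  refine le_of_mul_le_mul_left ?_ hδ
  linarith

theorem mul_sub_le_of_local_growth {G : ℝ → ℝ} {p q c : ℝ} (hpq : p ≤ q) (hc : 0 ≤ c)
    (hmono : MonotoneOn G (Set.Icc p q))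
    (hloc : ∀ x, p ≤ x → x < q → ∃ y, x < y ∧ y ≤ q ∧ c * (y - x) ≤ G y - G x) :
    c * (q - p) ≤ G q - G p := by
  set S := {x | x ∈ Set.Icc p q ∧ c * (x - p) ≤ G x - G p} with hS
  have hpS : p ∈ S := ⟨⟨le_rfl, hpq⟩, by simp⟩
  have hbdd : BddAbove S := ⟨q, fun x hx => hx.1.2⟩
  set σ := sSup S
  have hpσ : p ≤ σ := le_csSup hbdd hpS
  have hσq : σ ≤ q := csSup_le ⟨p, hpS⟩ fun x hx => hx.1.2
  have hσS : σ ∈ S := by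
    refine ⟨⟨hpσ, hσq⟩, le_of_forall_pos_le_add fun ε hε => ?_⟩
    obtain ⟨x, hx, hxσ⟩ := exists_lt_of_lt_csSup ⟨p, hpS⟩
      (show σ - ε / (c + 1) < σ by have : 0 < ε / (c + 1) := by positivity
                                   linarith)
    have h1 : G x ≤ G σ := hmono hx.1 ⟨hpσ, hσq⟩ (le_csSup hbdd hx)
    have h2 : c * (ε / (c + 1)) ≤ ε := by
      rw [← mul_div_assoc, div_le_iff₀ (by positivity)]
      nlinarith
    have h3 : c * (σ - x) ≤ c * (ε / (c + 1)) := by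
      gcongr
      linarith
    have := hx.2
    nlinarith
  rcases hσq.eq_or_lt with h | h
  · exact h ▸ hσS.2
  · obtain ⟨y, hy, hyq, hG⟩ := hloc σ hpσ h
    have : y ∈ S := ⟨⟨hpσ.trans hy.le, hyq⟩, by have := hσS.2; linarith⟩
    exact absurd (le_csSup hbdd this) hy.not_ge

theorem omegaS_eq {n : ℕ} (hn : 1 ≤ n) : omegaS n = n * unitBallVol n := by
  have hn0 : (n : ℝ) / 2 ≠ 0 := by positivity
  have : Nonempty (Fin n) := ⟨⟨0, hn⟩⟩
  rw [omegaS, unitBallVol, measureReal_def, EuclideanSpace.volume_ball,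
    Fintype.card_fin, Real.Gamma_add_one hn0, ENNReal.ofReal_one, one_pow, one_mul,
    ENNReal.toReal_ofReal]
  · rw [Real.sqrt_eq_rpow, ← Real.rpow_natCast, ← Real.rpow_mul Real.pi_pos.le]
    have : Real.Gamma ((n : ℝ) / 2) ≠ 0 := (Real.Gamma_pos_of_pos (by positivity)).ne'
    have h2 : (1 / 2 : ℝ) * n = n / 2 := by ring
    rw [h2]
    field_simp
  · have : 0 < Real.Gamma ((n : ℝ) / 2) := Real.Gamma_pos_of_pos (by positivity)
    positivity

theorem unitBallVol_two : unitBallVol 2 = Real.pi := by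
  have h := omegaS_eq (n := 2) (by norm_num)
  have h2 : omegaS 2 = 2 * Real.pi := by simp [omegaS]
  rw [h2] at h
  push_cast at h
  linarith

theorem NstarV_two (V t : ℝ) : NstarV 2 V t = 1 / (4 * Real.pi) * Real.log (V / t) := by
  simp [NstarV]

theorem NstarV_of_three_le {n : ℕ} (hn : 3 ≤ n) {V t : ℝ} :
    NstarV n V t = 1 / (((n : ℝ) - 2) * (n * unitBallVol n)) *
      unitBallVol n ^ (((n : ℝ) - 2) / n) *
      (t ^ (-(((n : ℝ) - 2) / n)) - V ^ (-(((n : ℝ) - 2) / n))) := by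
  have h : (n : ℝ) ≠ 0 := by positivity
  rw [NstarV, if_neg (by omega), cConst, omegaS_eq (by omega), mul_div_cancel_left₀ _ h]

theorem NstarV_add_NstarV {n : ℕ} (hn : 2 ≤ n) {V τ t : ℝ} (hV : 0 < V) (hτ : 0 < τ)
    (ht : 0 < t) : NstarV n V τ + NstarV n τ t = NstarV n V t := by
  rcases hn.eq_or_lt with rfl | hn
  · rw [NstarV_two, NstarV_two, NstarV_two, Real.log_div hV.ne' hτ.ne',
      Real.log_div hτ.ne' ht.ne', Real.log_div hV.ne' ht.ne']
    ring
  · rw [NstarV_of_three_le hn, NstarV_of_three_le hn, NstarV_of_three_le hn]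
    ring

theorem sub_le_mul_NstarV {n : ℕ} (hn : 2 ≤ n) {a τ : ℝ} (ha : 0 < a) (hτ : 0 < τ) :
    a ^ n * unitBallVol n - τ ≤
      (n * unitBallVol n * a ^ (n - 1)) ^ 2 * NstarV n (a ^ n * unitBallVol n) τ := by
  have hk := unitBallVol_pos n
  set V := a ^ n * unitBallVol n with hV
  have hV0 : 0 < V := by positivity
  have hlog : 1 - τ / V ≤ Real.log (V / τ) := by
    have h1 := Real.log_le_sub_one_of_pos (show 0 < τ / V by positivity)
    rw [Real.log_div hτ.ne' hV0.ne'] at h1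
    rw [Real.log_div hV0.ne' hτ.ne']
    linarith
  have hsub : V - τ = V * (1 - τ / V) := by field_simp
  rcases hn.eq_or_lt with rfl | hn
  · rw [NstarV_two, hsub]
    have h2 : ((2 : ℕ) * unitBallVol 2 * a ^ (2 - 1)) ^ 2 * (1 / (4 * Real.pi) *
        Real.log (V / τ)) = V * Real.log (V / τ) := by
      rw [hV, unitBallVol_two]
      have := Real.pi_pos
      push_cast
      field_simp
      norm_num
    rw [h2]
    gcongr
  · obtain ⟨k, rfl⟩ : ∃ k, n = k + 3 := ⟨n - 3, by omega⟩
    rw [NstarV_of_three_le hn, hsub]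
    set β : ℝ := (((k + 3 : ℕ) : ℝ) - 2) / (k + 3 : ℕ) with hβ
    have hβ0 : 0 ≤ β := by
      rw [hβ]
      push_cast
      apply div_nonneg <;> linarith [(k.cast_nonneg : (0 : ℝ) ≤ k)]
    have h3 : V ^ (-β) * (1 + β * Real.log (V / τ)) ≤ τ ^ (-β) := by
      have h4 : τ = V * (V / τ)⁻¹ := by field_simp
      have h5 : (V / τ)⁻¹ ^ (-β) = Real.exp (β * Real.log (V / τ)) := by
        rw [Real.rpow_neg (by positivity), Real.inv_rpow (by positivity), inv_inv,
          Real.rpow_def_of_pos (by positivity), mul_comm]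
      conv_rhs => rw [h4, Real.mul_rpow hV0.le (by positivity), h5]
      gcongr
      linarith [Real.add_one_le_exp (β * Real.log (V / τ))]
    have h6 : unitBallVol (k + 3) ^ β * V ^ (-β) = (a ^ (k + 1))⁻¹ := by
      rw [hV, Real.mul_rpow (by positivity) hk.le, mul_comm, mul_assoc,
        ← Real.rpow_add hk, neg_add_cancel, Real.rpow_zero, mul_one,
        ← Real.rpow_natCast, ← Real.rpow_mul ha.le, ← Real.rpow_natCast, ← Real.rpow_neg ha.le]
      congr 1
      rw [hβ]
      push_cast
      field_simp
      ring
    have h7 : V ^ (-β) * (β * (1 - τ / V)) ≤ τ ^ (-β) - V ^ (-β) := by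
      have : V ^ (-β) * (β * (1 - τ / V)) ≤ V ^ (-β) * (β * Real.log (V / τ)) := by gcongr
      linarith
    calc V * (1 - τ / V) = (((k + 3 : ℕ) : ℝ) * unitBallVol (k + 3) * a ^ (k + 3 - 1)) ^ 2 *
        (1 / ((((k + 3 : ℕ) : ℝ) - 2) * ((k + 3 : ℕ) * unitBallVol (k + 3))) *
          unitBallVol (k + 3) ^ β * (V ^ (-β) * (β * (1 - τ / V)))) := by
          have h8 : unitBallVol (k + 3) ^ β * (V ^ (-β) * (β * (1 - τ / V))) =
            (a ^ (k + 1))⁻¹ * (β * (1 - τ / V)) := by rw [← h6]; ring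
          rw [mul_assoc (1 / _), h8]
          have h9 : (k : ℝ) + 3 - 2 ≠ 0 := by
            have := (k.cast_nonneg : (0 : ℝ) ≤ k)
            intro h
            linarith
          have h10 : (k + 3 - 1) = k + 2 := by omega
          rw [h10]
          generalize 1 - τ / V = z
          rw [hV, hβ]
          push_cast
          field_simp
          ring
      _ ≤ _ := by
        have : (0 : ℝ) ≤ ((k + 3 : ℕ) : ℝ) - 2 := by
          push_cast
          linarith [(k.cast_nonneg : (0 : ℝ) ≤ k)]
        gcongr

theorem NstarV_self {n : ℕ} (hn : 2 ≤ n) {V : ℝ} (hV : 0 < V) : NstarV n V V = 0 := by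
  have := NstarV_add_NstarV hn hV hV hV
  linarith

theorem exists_radius (n : ℕ) (hn : 1 ≤ n) {V : ℝ} (hV : 0 < V) :
    ∃ a : ℝ, 0 < a ∧ V = a ^ n * unitBallVol n := by
  have hk := unitBallVol_pos n
  refine ⟨(V / unitBallVol n) ^ (1 / (n : ℝ)), by positivity, ?_⟩
  rw [← Real.rpow_natCast, ← Real.rpow_mul (by positivity), one_div_mul_cancel (by positivity),
    Real.rpow_one]
  field_simp

theorem NstarV_nonneg {n : ℕ} (hn : 2 ≤ n) {V τ : ℝ} (hτ : 0 < τ) (h : τ ≤ V) :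
    0 ≤ NstarV n V τ := by
  have hV := hτ.trans_le h
  have hk := unitBallVol_pos n
  obtain ⟨a, ha, rfl⟩ := exists_radius n (by omega) hV
  have h1 := sub_le_mul_NstarV hn ha hτ
  have h2 : 0 < (n * unitBallVol n * a ^ (n - 1)) ^ 2 := by positivity
  exact (mul_nonneg_iff_of_pos_left h2).1 ((sub_nonneg.2 h).trans h1)

theorem NstarV_pos {n : ℕ} (hn : 2 ≤ n) {V τ : ℝ} (hτ : 0 < τ) (h : τ < V) :
    0 < NstarV n V τ := by
  have hV := hτ.trans h
  have hk := unitBallVol_pos n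
  obtain ⟨a, ha, rfl⟩ := exists_radius n (by omega) hV
  have h1 := sub_le_mul_NstarV hn ha hτ
  have h2 : 0 < (n * unitBallVol n * a ^ (n - 1)) ^ 2 := by positivity
  exact (mul_pos_iff_of_pos_left h2).1 ((sub_pos.2 h).trans_le h1)

theorem NstarV_mono_left {n : ℕ} (hn : 2 ≤ n) {V W τ : ℝ} (hτ : 0 < τ) (hV : 0 < V)
    (h : V ≤ W) : NstarV n V τ ≤ NstarV n W τ := by
  rw [← NstarV_add_NstarV hn (hV.trans_le h) hV hτ]
  linarith [NstarV_nonneg hn hV h]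

/-- Integration of a differential inequality for distribution functions. -/
theorem sub_le_mul_NstarV_of_strip {n : ℕ} (hn : 2 ≤ n) {μ : ℝ → ℝ} {M p q : ℝ} (hM : 0 ≤ M)
    (hpq : p ≤ q) (hanti : AntitoneOn μ (Set.Icc p q)) (hq : 0 < μ q)
    (hright : ∀ x ∈ Set.Ico p q, Tendsto μ (𝓝[>] x) (𝓝 (μ x)))
    (hstrip : ∀ x y a, p ≤ x → x < y → y ≤ q → 0 ≤ a → a ^ n * unitBallVol n ≤ μ y →
      (y - x) * (n * unitBallVol n * a ^ (n - 1)) ^ 2 ≤ M * (μ x - μ y)) :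
    q - p ≤ M * NstarV n (μ p) (μ q) := by
  have hk := unitBallVol_pos n
  have hpos : ∀ x ∈ Set.Icc p q, 0 < μ x := fun x hx =>
    hq.trans_le (hanti hx ⟨hpq, le_rfl⟩ hx.2)
  have hp := hpos p ⟨le_rfl, hpq⟩
  have key : ∀ c ∈ Set.Ioo (0 : ℝ) 1, c * (q - p) ≤ M * NstarV n (μ p) (μ q) := by
    intro c hc
    have h := mul_sub_le_of_local_growth (G := fun x => M * NstarV n (μ p) (μ x)) hpq hc.1.le ?_ ?_
    · simpa [NstarV_self hn hp] using h
    · intro x hx y hy hxy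
      have h1 := NstarV_add_NstarV hn hp (hpos x hx) (hpos y hy)
      have h2 := NstarV_nonneg hn (hpos y hy) (hanti hx hy hxy)
      exact mul_le_mul_of_nonneg_left (by linarith) hM
    · intro x hpx hxq
      have hxm : x ∈ Set.Icc p q := ⟨hpx, hxq.le⟩
      have hx := hpos x hxm
      set η := c ^ (1 / (2 * (n : ℝ))) with hη
      have hη0 : 0 < η := Real.rpow_pos_of_pos hc.1 _
      have hη2 : η ^ (2 * n) = c := by
        rw [hη, ← Real.rpow_natCast, ← Real.rpow_mul hc.1.le]
        push_cast
        rw [one_div_mul_cancel (by positivity), Real.rpow_one]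
      have hη1 : η < 1 := Real.rpow_lt_one hc.1.le hc.2 (by positivity)
      obtain ⟨a, ha, hxa⟩ := exists_radius n (by omega) hx
      have hηx : (η * a) ^ n * unitBallVol n < μ x := by
        rw [hxa, mul_pow]
        have : η ^ n < 1 := pow_lt_one₀ hη0.le hη1 (by omega)
        have : 0 < a ^ n * unitBallVol n := by positivity
        nlinarith
      obtain ⟨y, ⟨hyη, hyq⟩, hxy⟩ := (((hright x ⟨hpx, hxq⟩).eventually (lt_mem_nhds hηx)).and
        (Ioc_mem_nhdsGT hxq)).and self_mem_nhdsWithin |>.exists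
      have hxy : x < y := hxy
      have hym : y ∈ Set.Icc p q := ⟨hpx.trans hxy.le, hyq.2⟩
      refine ⟨y, hxy, hyq.2, ?_⟩
      have h1 := hstrip x y (η * a) hpx hxy hyq.2 (by positivity) hyη.le
      have h2 := sub_le_mul_NstarV hn ha (hpos y hym)
      rw [← hxa] at h2
      have h3 := NstarV_add_NstarV hn hp hx (hpos y hym)
      have h4 : c ≤ (η ^ (n - 1)) ^ 2 := by
        rw [← hη2, ← pow_mul]
        exact pow_le_pow_of_le_one hη0.le hη1.le (by omega)
      have h5 : (n * unitBallVol n * (η * a) ^ (n - 1)) ^ 2 =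
        (η ^ (n - 1)) ^ 2 * (n * unitBallVol n * a ^ (n - 1)) ^ 2 := by rw [mul_pow]; ring
      rw [h5] at h1
      have hP : 0 < (n * unitBallVol n * a ^ (n - 1)) ^ 2 := by positivity
      set P := (n * unitBallVol n * a ^ (n - 1)) ^ 2
      have h6 : P * (c * (y - x)) ≤ P * (M * NstarV n (μ x) (μ y)) := by
        calc P * (c * (y - x)) = (y - x) * (c * P) := by ring
          _ ≤ (y - x) * ((η ^ (n - 1)) ^ 2 * P) := by
            have : 0 ≤ y - x := by linarith
            gcongr
          _ ≤ M * (μ x - μ y) := h1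
          _ ≤ M * (P * NstarV n (μ x) (μ y)) := by gcongr
          _ = _ := by ring
      have h7 := le_of_mul_le_mul_left h6 hP
      simp only [← h3]
      linarith
  have hlim : Tendsto (fun c : ℝ => c * (q - p)) (𝓝[<] 1) (𝓝 (1 * (q - p))) :=
    Tendsto.mono_left (Continuous.tendsto (by fun_prop) 1) nhdsWithin_le_nhds
  have := le_of_tendsto hlim (Filter.mem_of_superset (Ioo_mem_nhdsLT one_pos) key)
  simpa using this

theorem tendsto_measureReal_superlevel {α : Type*} [MeasurableSpace α] {ν : Measure α} {f : α → ℝ}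
    {x : ℝ} (hfin : ν {z | x < f z} < ⊤) :
    Tendsto (fun y => ν.real {z | y < f z}) (𝓝[>] x) (𝓝 (ν.real {z | x < f z})) := by
  have hsub : ∀ y ≥ x, {z | y < f z} ⊆ {z | x < f z} := fun y hy z hz => hy.trans_lt hz
  refine tendsto_order.2 ⟨fun b hb => ?_, fun b hb => ?_⟩
  · have hU : {z | x < f z} = ⋃ k : ℕ, {z | x + 1 / ((k : ℝ) + 1) < f z} := by
      ext z
      simp only [Set.mem_ofPred_eq, Set.mem_iUnion]
      constructor
      · intro h
        obtain ⟨k, hk⟩ := exists_nat_one_div_lt (sub_pos.2 h)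
        exact ⟨k, by linarith⟩
      · rintro ⟨k, hk⟩
        have : (0 : ℝ) < 1 / ((k : ℝ) + 1) := by positivity
        linarith
    have hmono : Monotone fun k : ℕ => {z | x + 1 / ((k : ℝ) + 1) < f z} := by
      intro i j hij z (hz : x + 1 / ((i : ℝ) + 1) < f z)
      have : 1 / ((j : ℝ) + 1) ≤ 1 / ((i : ℝ) + 1) := by gcongr
      change x + 1 / ((j : ℝ) + 1) < f z
      linarith
    have h1 := tendsto_measure_iUnion_atTop (μ := ν) hmono
    rw [← hU] at h1
    have h2 := (ENNReal.tendsto_toReal hfin.ne).comp h1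
    obtain ⟨k, hk⟩ := (h2.eventually (lt_mem_nhds hb)).exists
    have hpos : (0 : ℝ) < 1 / ((k : ℝ) + 1) := by positivity
    filter_upwards [Ioo_mem_nhdsGT (show x < x + 1 / ((k : ℝ) + 1) by linarith)] with y hy
    refine lt_of_lt_of_le hk (measureReal_mono (fun z (hz : _ < _) => hy.2.trans hz) ?_)
    exact (measure_mono (hsub y hy.1.le)).trans_lt hfin |>.ne
  · filter_upwards [self_mem_nhdsWithin] with y (hy : x < y)
    exact (measureReal_mono (hsub y hy.le) hfin.ne).trans_lt hb

theorem sub_le_mul_NstarV_of_strip_bounds {n : ℕ} (hn : 2 ≤ n) {φ : Euc n → ℝ} {M : ℝ}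
    (hM : 0 ≤ M) (hc : HasCompactSupport φ) {p q V t : ℝ} (hp : 0 < p)
    (hpq : p ≤ q) (ht : 0 < t) (hqt : t ≤ volume.real {x | q < φ x})
    (hpV : volume.real {x | p < φ x} ≤ V)
    (hstrip : ∀ x y a, 0 < x → x < y → 0 ≤ a →
      a ^ n * unitBallVol n ≤ volume.real {z | y < φ z} →
      (y - x) * (n * unitBallVol n * a ^ (n - 1)) ^ 2 ≤
        M * (volume.real {z | x < φ z} - volume.real {z | y < φ z})) :
    q - p ≤ M * NstarV n V t := by
  have hanti : AntitoneOn (fun s => volume.real {x | s < φ x}) (Set.Icc p q) := by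
    intro x hx y hy hxy
    exact measureReal_mono (fun z (hz : _ < _) => hxy.trans_lt hz)
      (volume_superlevel_lt_top hc (hp.trans_le hx.1)).ne
  have hq := ht.trans_le hqt
  have h1 := sub_le_mul_NstarV_of_strip hn hM hpq hanti hq
    (fun x hx => tendsto_measureReal_superlevel (volume_superlevel_lt_top hc (hp.trans_le hx.1)))
    (fun x y a hx hxy _ ha hay => hstrip x y a (hp.trans_le hx) hxy ha hay)
  have hpq' := hanti ⟨le_rfl, hpq⟩ ⟨hpq, le_rfl⟩ hpq
  have hp' := hq.trans_le hpq'
  refine h1.trans (mul_le_mul_of_nonneg_left ?_ hM)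
  refine (NstarV_mono_left hn hq hp' hpV).trans ?_
  rw [← NstarV_add_NstarV hn (hp'.trans_le hpV) hq ht]
  linarith [NstarV_nonneg hn ht hqt]

theorem sub_le_integral_lapl_mul_NstarV {n : ℕ} (hn : 2 ≤ n) {φ : Euc n → ℝ}
    (hφ : ContDiff ℝ 2 φ) (hc : HasCompactSupport φ) {p q V t : ℝ} (hp : 0 < p)
    (hpq : p ≤ q) (ht : 0 < t) (hqt : t ≤ volume.real {x | q < φ x})
    (hpV : volume.real {x | p < φ x} ≤ V) :
    q - p ≤ (∫ x, |lapl n φ x|) / 2 * NstarV n V t :=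
  sub_le_mul_NstarV_of_strip_bounds hn
    (div_nonneg (integral_nonneg fun x => abs_nonneg _) (by norm_num)) hc hp hpq ht hqt hpV
    fun x y a hx hxy ha hay => by
      have := strip_inequality hn hφ hc hx (sub_pos.2 hxy) ha
      rw [add_sub_cancel] at this
      exact this hay

theorem IsTestFun.integrable {n : ℕ} {Ω : Set (Euc n)} {φ : Euc n → ℝ} (h : IsTestFun n Ω φ) :
    Integrable φ :=
  h.1.continuous.integrable_of_hasCompactSupport h.2.1

theorem IsTestFun.contDiff_two {n : ℕ} {Ω : Set (Euc n)} {φ : Euc n → ℝ} (h : IsTestFun n Ω φ) :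
    ContDiff ℝ 2 φ :=
  (contDiff_infty.1 h.1) 2

theorem support_lapl_subset {n : ℕ} (φ : Euc n → ℝ) :
    Function.support (lapl n φ) ⊆ tsupport φ := by
  intro x hx
  by_contra hxn
  refine hx ?_
  have h1 : x ∉ tsupport (iteratedFDeriv ℝ 2 φ) := fun h => hxn (tsupport_iteratedFDeriv_subset 2 h)
  simp [lapl, image_eq_zero_of_notMem_tsupport h1]

theorem IsTestFun.setIntegral_abs_lapl {n : ℕ} {Ω : Set (Euc n)} {φ : Euc n → ℝ}
    (h : IsTestFun n Ω φ) : ∫ x in Ω, |lapl n φ x| = ∫ x, |lapl n φ x| := by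
  refine setIntegral_eq_integral_of_forall_compl_eq_zero fun x hx => ?_
  rw [abs_eq_zero]
  by_contra h0
  exact hx (h.2.2 (support_lapl_subset φ h0))

theorem tendsto_integral_abs_of_tendsto {α : Type*} [MeasurableSpace α] {ν : Measure α}
    {g : ℕ → α → ℝ} {f : α → ℝ} (hg : ∀ k, Integrable (g k) ν) (hf : Integrable f ν)
    (h : Tendsto (fun k => ∫ x, |g k x - f x| ∂ν) atTop (𝓝 0)) :
    Tendsto (fun k => ∫ x, |g k x| ∂ν) atTop (𝓝 (∫ x, |f x| ∂ν)) := by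
  rw [tendsto_iff_dist_tendsto_zero]
  refine squeeze_zero (fun k => dist_nonneg) (fun k => ?_) h
  rw [Real.dist_eq, ← integral_sub (hg k).abs hf.abs]
  refine (abs_integral_le_integral_abs).trans ?_
  exact integral_mono ((hg k).abs.sub hf.abs).abs ((hg k).sub hf).abs
    fun x => abs_abs_sub_abs_le _ _

theorem tendsto_measure_abs_ge_of_tendsto {α : Type*} [MeasurableSpace α] {ν : Measure α}
    {g : ℕ → α → ℝ} {f : α → ℝ} (hg : ∀ k, Integrable (g k) ν) (hf : Integrable f ν)
    (h : Tendsto (fun k => ∫ x, |g k x - f x| ∂ν) atTop (𝓝 0)) {η : ℝ} (hη : 0 < η) :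
    Tendsto (fun k => ν {x | η ≤ |g k x - f x|}) atTop (𝓝 0) := by
  have h1 : Tendsto (fun k => ENNReal.ofReal ((∫ x, |g k x - f x| ∂ν) / η)) atTop (𝓝 0) := by
    have := ENNReal.tendsto_ofReal (h.div_const η)
    simpa using this
  refine tendsto_of_tendsto_of_tendsto_of_le_of_le tendsto_const_nhds h1 (fun k => zero_le) fun k => ?_
  have h2 := mul_meas_ge_le_integral_of_nonneg (μ := ν) (f := fun x => |g k x - f x|)
    (ae_of_all _ fun x => abs_nonneg _) ((hg k).sub hf).abs η
  rcases eq_or_ne (ν {x | η ≤ |g k x - f x|}) ⊤ with h3 | h3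
  · have := ((hg k).sub hf).abs.measure_ge_lt_top hη
    exact absurd h3 this.ne
  · rw [ENNReal.le_ofReal_iff_toReal_le h3 (div_nonneg (integral_nonneg fun x => abs_nonneg _) hη.le),
      le_div_iff₀ hη, mul_comm]
    exact h2

/-- Convergence in measure transfers superlevel lower bounds. -/
theorem eventually_lt_measure_superlevel {α : Type*} [MeasurableSpace α] {ν : Measure α}
    {ι : Type*} {l : Filter ι} {g : ι → α → ℝ} {f : α → ℝ} {s η : ℝ} {t : ℝ≥0∞}
    (h : Tendsto (fun k => ν {x | η ≤ |g k x - f x|}) l (𝓝 0))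
    (hs : t < ν {x | s < f x}) : ∀ᶠ k in l, t < ν {x | s - η < g k x} := by
  have h1 : Tendsto (fun k => t + ν {x | η ≤ |g k x - f x|}) l (𝓝 (t + 0)) :=
    tendsto_const_nhds.add h
  rw [add_zero] at h1
  obtain ⟨t', htt', ht's⟩ := exists_between hs
  filter_upwards [h.eventually (gt_mem_nhds (tsub_pos_of_lt htt'))] with k hk
  by_contra! hcon
  have h2 : ν {x | s < f x} ≤ ν {x | s - η < g k x} + ν {x | η ≤ |g k x - f x|} := by
    refine (measure_mono fun x (hx : s < f x) => ?_).trans (measure_union_le _ _)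
    by_cases h3 : η ≤ |g k x - f x|
    · exact Or.inr h3
    · left
      change s - η < g k x
      have := (abs_lt.1 (not_le.1 h3)).1
      linarith
  have h3 : t + (t' - t) = t' := add_tsub_cancel_of_le htt'.le
  have h4 := h2.trans (add_le_add hcon hk.le)
  rw [h3] at h4
  exact absurd (ht's.trans_le h4) (lt_irrefl _)

theorem decRearr_le_of_forall {n : ℕ} {Ω : Set (Euc n)} {u : Euc n → ℝ} {t C : ℝ} (hC : 0 ≤ C)
    (h : ∀ s, 0 ≤ s → ENNReal.ofReal t < volume {x ∈ Ω | s < |u x|} → s ≤ C) :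
    decRearr n Ω u t ≤ C := by
  refine le_of_forall_pos_le_add fun ε hε => csInf_le ⟨0, fun s hs => hs.1⟩ ⟨by positivity, ?_⟩
  by_contra! hcon
  have := h _ (by positivity) hcon
  linarith

theorem L1norm_nonneg (n : ℕ) (Ω : Set (Euc n)) (f : Euc n → ℝ) : 0 ≤ L1norm n Ω f :=
  integral_nonneg fun _ => abs_nonneg _

theorem decRearr_le_of_nonneg {n : ℕ} (hn : 2 ≤ n) {Ω : Set (Euc n)} (hΩo : IsOpen Ω)
    (hΩb : Bornology.IsBounded Ω) {u f : Euc n → ℝ} (hu : MemW21Delta0 n Ω u f)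
    (hu0 : ∀ᵐ x ∂(volume.restrict Ω), 0 ≤ u x) {t : ℝ} (ht : 0 < t)
    (htV : t ≤ (volume Ω).toReal) :
    decRearr n Ω u t ≤ L1norm n Ω f / 2 * NstarV n (volume Ω).toReal t := by
  obtain ⟨hui, hfi, φ, hφ, hφu, hφf⟩ := hu
  have hN := NstarV_nonneg hn ht htV
  have hΩfin : volume Ω < ⊤ := hΩb.measure_lt_top
  refine decRearr_le_of_forall (mul_nonneg (by have := L1norm_nonneg n Ω f; positivity) hN)
    fun s hs hst => ?_
  have hst' : ENNReal.ofReal t < volume.restrict Ω {x | s < u x} := by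
    refine hst.trans_le ?_
    rw [show {x ∈ Ω | s < |u x|} = {x | s < |u x|} ∩ Ω from Set.inter_comm _ _,
      ← Measure.restrict_apply' hΩo.measurableSet]
    refine measure_mono_ae ?_
    filter_upwards [hu0] with x hx hsx
    have hsx : s < |u x| := hsx
    change s < u x
    rwa [abs_of_nonneg hx] at hsx
  have hlim := tendsto_integral_abs_of_tendsto
    (fun k => ((continuous_lapl (hφ k).contDiff_two).integrable_of_hasCompactSupport
      (hasCompactSupport_lapl (hφ k).2.1)).integrableOn) hfi hφf
  have key : ∀ η > 0, s - 2 * η ≤ L1norm n Ω f / 2 * NstarV n (volume Ω).toReal t := by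
    intro η hη
    have h1 := eventually_lt_measure_superlevel
      (tendsto_measure_abs_ge_of_tendsto (fun k => (hφ k).integrable.integrableOn) hui hφu hη) hst'
    refine ge_of_tendsto ((hlim.div_const 2).mul_const _) (h1.mono fun k hk => ?_)
    rw [(hφ k).setIntegral_abs_lapl]
    rcases le_or_gt (s - 2 * η) 0 with h0 | h0
    · refine h0.trans (mul_nonneg (div_nonneg (integral_nonneg fun x => abs_nonneg _) (by norm_num)) hN)
    · have h2 := sub_le_integral_lapl_mul_NstarV hn (hφ k).contDiff_two (hφ k).2.1 (p := η)
        (q := s - η) (V := (volume Ω).toReal) hη (by linarith) ht ?_ ?_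
      · linarith
      · rw [measureReal_def, ← ENNReal.ofReal_le_iff_le_toReal
          (volume_superlevel_lt_top (hφ k).2.1 (by linarith)).ne]
        exact hk.le.trans (Measure.restrict_apply_le _ _)
      · refine ENNReal.toReal_mono hΩfin.ne (measure_mono fun x (hx : η < φ k x) => ?_)
        exact (hφ k).2.2 (subset_tsupport _ (hη.trans hx).ne')
  have hl : Tendsto (fun η : ℝ => s - 2 * η) (𝓝[>] 0) (𝓝 (s - 2 * 0)) :=
    Tendsto.mono_left (Continuous.tendsto (by fun_prop) 0) nhdsWithin_le_nhds
  have := le_of_tendsto hl (eventually_nhdsWithin_of_forall fun η hη => key η hη)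
  simpa using this

theorem integral_comp_norm {n : ℕ} (hn : 1 ≤ n) (F : ℝ → ℝ) :
    ∫ x : Euc n, F ‖x‖ = n * unitBallVol n * ∫ y in Set.Ioi (0 : ℝ), y ^ (n - 1) * F y := by
  have : Nonempty (Fin n) := ⟨⟨0, hn⟩⟩
  rw [integral_fun_norm_addHaar (volume : Measure (Euc n)) F]
  simp [unitBallVol, mul_assoc]

theorem contDiff_primitive_comp_norm {n : ℕ} {β : ℝ → ℝ} (hβ : Continuous β) {r₀ : ℝ}
    (hr₀ : 0 < r₀) (hz : ∀ y ≤ r₀, β y = 0) :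
    ContDiff ℝ 1 fun x : Euc n => ∫ z in (0 : ℝ)..‖x‖, β z := by
  rw [contDiff_iff_contDiffAt]
  intro x
  rcases eq_or_ne x 0 with rfl | hx
  · refine (contDiffAt_const (c := (0 : ℝ))).congr_of_eventuallyEq ?_
    filter_upwards [Metric.ball_mem_nhds (0 : Euc n) hr₀] with y hy
    rw [mem_ball_zero_iff] at hy
    rw [intervalIntegral.integral_congr (g := fun _ => 0), intervalIntegral.integral_zero]
    intro z hz'
    rw [Set.uIcc_of_le (norm_nonneg y)] at hz'
    exact hz z (hz'.2.trans hy.le)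
  · exact (contDiff_one_primitive hβ 0).contDiffAt.comp x (contDiffAt_norm ℝ hx)

theorem integral_primitive_norm_mul_lapl {n : ℕ} (hn : 1 ≤ n) {ψ : Euc n → ℝ}
    (hψ : ContDiff ℝ 2 ψ) (hc : HasCompactSupport ψ) {h : ℝ → ℝ} (hh : Differentiable ℝ h)
    (hψh : ∀ x, ψ x = h ‖x‖) {β : ℝ → ℝ} (hβ : Continuous β) {r₀ : ℝ}
    (hr₀ : 0 < r₀) (hz : ∀ y ≤ r₀, β y = 0) :
    ∫ x, (∫ z in (0 : ℝ)..‖x‖, β z) * lapl n ψ x =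
      -(n * unitBallVol n * ∫ y in Set.Ioi (0 : ℝ), y ^ (n - 1) * (β y * deriv h y)) := by
  have hne : Nonempty (Fin n) := ⟨⟨0, hn⟩⟩
  rw [integral_mul_lapl hψ hc (contDiff_primitive_comp_norm hβ hr₀ hz),
    ← integral_comp_norm hn fun y => β y * deriv h y]
  congr 2
  ext x
  rcases eq_or_ne x 0 with rfl | hx
  · have h1 : fderiv ℝ (fun x : Euc n => ∫ z in (0 : ℝ)..‖x‖, β z) 0 = 0 := by
      refine IsLocalMin.fderiv_eq_zero ?_
      filter_upwards [Metric.ball_mem_nhds (0 : Euc n) hr₀] with y hy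
      rw [mem_ball_zero_iff] at hy
      rw [norm_zero, intervalIntegral.integral_same,
        intervalIntegral.integral_congr (g := fun _ => 0), intervalIntegral.integral_zero]
      intro z hz'
      rw [Set.uIcc_of_le (norm_nonneg y)] at hz'
      exact hz z (hz'.2.trans hy.le)
    simp [h1, hz 0 hr₀.le]
  · have hd : DifferentiableAt ℝ (fun x : Euc n => ‖x‖) x :=
      (contDiffAt_norm (n := 1) ℝ hx).differentiableAt one_ne_zero
    have h1 : HasFDerivAt (fun x : Euc n => ∫ z in (0 : ℝ)..‖x‖, β z)
        (β ‖x‖ • fderiv ℝ (fun x : Euc n => ‖x‖) x) x :=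
      (hβ.integral_hasStrictDerivAt 0 ‖x‖).hasDerivAt.comp_hasFDerivAt x hd.hasFDerivAt
    have h2 : HasFDerivAt ψ (deriv h ‖x‖ • fderiv ℝ (fun x : Euc n => ‖x‖) x) x := by
      have := (hh ‖x‖).hasDerivAt.comp_hasFDerivAt x hd.hasFDerivAt
      rwa [show h ∘ (fun x : Euc n => ‖x‖) = ψ from funext fun x => (hψh x).symm] at this
    rw [h1.fderiv, h2.fderiv]
    have h3 := sum_sq_apply_stdVec (fderiv ℝ (fun x : Euc n => ‖x‖) x)
    rw [norm_fderiv_norm hd] at h3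
    have h4 : ∀ i : Fin n, (β ‖x‖ • fderiv ℝ (fun x : Euc n => ‖x‖) x) (stdVec i) *
        (deriv h ‖x‖ • fderiv ℝ (fun x : Euc n => ‖x‖) x) (stdVec i) =
        β ‖x‖ * deriv h ‖x‖ * (fderiv ℝ (fun x : Euc n => ‖x‖) x (stdVec i) *
          fderiv ℝ (fun x : Euc n => ‖x‖) x (stdVec i)) := fun i => by
      simp only [smul_apply, smul_eq_mul]
      ring
    simp only [h4, ← Finset.mul_sum]
    rw [h3]
    ring

/-- The profile of a radial function. -/
theorem exists_profile {n : ℕ} (hn : 1 ≤ n) {ψ : Euc n → ℝ} (hψ : ContDiff ℝ 2 ψ)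
    (hc : HasCompactSupport ψ) (hrad : ∀ x y : Euc n, ‖x‖ = ‖y‖ → ψ x = ψ y) :
    ∃ h : ℝ → ℝ, ContDiff ℝ 2 h ∧ (∀ x, ψ x = h ‖x‖) ∧ ∃ R > 0, ∀ r ≥ R, h r = 0 := by
  set e : Euc n := stdVec ⟨0, hn⟩
  have he : ‖e‖ = 1 := by simp [e]
  refine ⟨fun r => ψ (r • e), hψ.comp (contDiff_id.smul contDiff_const), fun x => hrad _ _ ?_, ?_⟩
  · rw [norm_smul, he, mul_one, norm_norm]
  · obtain ⟨R, hR⟩ := hc.isCompact.isBounded.subset_ball_lt 0 0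
    refine ⟨R, hR.1, fun r hr => image_eq_zero_of_notMem_tsupport fun hm => ?_⟩
    have := hR.2 hm
    rw [mem_ball_zero_iff, norm_smul, he, mul_one, Real.norm_eq_abs] at this
    exact absurd ((le_abs_self r).trans_lt this) hr.not_gt

theorem strip_inequality_radial_aux {n : ℕ} (hn : 2 ≤ n) {ψ : Euc n → ℝ}
    (hψ : ContDiff ℝ 2 ψ) (hc : HasCompactSupport ψ) {h : ℝ → ℝ} (hh : ContDiff ℝ 2 h)
    (hψh : ∀ x, ψ x = h ‖x‖) {R : ℝ} (hR : ∀ r ≥ R, h r = 0) {s δ r₀ : ℝ} (hs : 0 < s)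
    (hr₀ : 0 < r₀) (hr₀s : s + δ ≤ h r₀) :
    δ * (n * unitBallVol n * r₀ ^ (n - 1)) ^ 2 ≤ ((∫ x, |lapl n ψ x|) / 2) *
      volume.real {x | s < |ψ x| ∧ |ψ x| ≤ s + δ} := by
  have hk := unitBallVol_pos n
  set M := (∫ x, |lapl n ψ x|) / 2 with hM
  have hM0 : 0 ≤ M := div_nonneg (integral_nonneg fun x => abs_nonneg _) (by norm_num)
  set E := {x | s < |ψ x| ∧ |ψ x| ≤ s + δ} with hE
  have hmE : MeasurableSet E :=
    (measurableSet_lt measurable_const hψ.continuous.abs.measurable).inter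
      (measurableSet_le hψ.continuous.abs.measurable measurable_const)
  have hEfin : volume E < ⊤ :=
    (measure_mono fun x hx => hx.1).trans_lt (volume_superlevel_lt_top (φ := fun x => |ψ x|)
      (hc.comp_left (g := fun t => |t|) abs_zero) hs)
  have key : ∀ η, 0 < η → (δ - 2 * η) * (n * unitBallVol n * r₀ ^ (n - 1)) ^ 2 ≤
      M * volume.real E := by
    intro η hη
    rcases lt_or_ge (δ - 2 * η) 0 with hneg | hnn
    · refine (mul_nonpos_of_nonpos_of_nonneg hneg.le (sq_nonneg _)).trans ?_
      positivity
    obtain ⟨b, hb, hb0, hb1, hbI, hbz⟩ :=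
      exists_continuous_plateau (p := s + η) (q := s + δ - η) hη
    have hbz' : ∀ y, y ∉ Set.Ioo s (s + δ) → b y = 0 := fun y hy =>
      hbz y (by simpa using hy)
    set c : ℝ → ℝ := fun ρ => if ρ ≤ r₀ then 0 else b (h ρ) with hcdef
    have hcc : Continuous c :=
      Continuous.if_le continuous_const (hb.comp hh.continuous) continuous_id continuous_const
        fun ρ hρ => by rw [show ρ = r₀ from hρ, hbz' _ fun hm => hm.2.not_ge hr₀s]
    set β : ℝ → ℝ := fun ρ => c ρ * ((max ρ r₀) ^ (n - 1))⁻¹ with hβdef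
    have hmax : ∀ ρ, 0 < max ρ r₀ := fun ρ => lt_max_of_lt_right hr₀
    have hβ : Continuous β := hcc.mul
      (((continuous_id.max continuous_const).pow _).inv₀ fun ρ => (pow_pos (hmax ρ) _).ne')
    have hc0 : ∀ ρ, 0 ≤ c ρ := fun ρ => by
      simp only [hcdef]
      split_ifs
      exacts [le_rfl, hb0 _]
    have hc1 : ∀ ρ, c ρ ≤ 1 := fun ρ => by
      simp only [hcdef]
      split_ifs
      exacts [zero_le_one, hb1 _]
    have hβ0 : ∀ ρ, 0 ≤ β ρ := fun ρ => mul_nonneg (hc0 ρ) (inv_nonneg.2 (pow_pos (hmax ρ) _).le)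
    have hβz : ∀ ρ ≤ r₀, β ρ = 0 := fun ρ hρ => by simp [hβdef, hcdef, hρ]
    have hbzero : b 0 = 0 := hbz' 0 fun hm => absurd hm.1 hs.not_gt
    have hβR : ∀ ρ ≥ R, β ρ = 0 := fun ρ hρ => by
      simp only [hβdef, hcdef]
      split_ifs
      · simp
      · simp [hR ρ hρ, hbzero]
    have hβcs : HasCompactSupport β := by
      refine HasCompactSupport.intro (isCompact_Icc (a := r₀) (b := R)) fun x hx => ?_
      rw [Set.mem_Icc, not_and_or, not_le, not_le] at hx
      rcases hx with hx | hx
      exacts [hβz x hx.le, hβR x hx.le]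
    have hβi : Integrable β := hβ.integrable_of_hasCompactSupport hβcs
    set C := ∫ y in Set.Ioi (0 : ℝ), β y with hC
    have h1 := abs_integral_mul_lapl_le hψ hc
      (contDiff_primitive_comp_norm (n := n) hβ hr₀ hβz).continuous (c := C)
      (fun x => intervalIntegral.integral_nonneg (norm_nonneg x) fun y _ => hβ0 y)
      (fun x => by
        rw [intervalIntegral.integral_of_le (norm_nonneg x)]
        exact setIntegral_mono_set hβi.integrableOn (ae_of_all _ hβ0)
          (Set.Ioc_subset_Ioi_self.eventuallyLE))
    rw [integral_primitive_norm_mul_lapl (by omega) hψ hc (hh.differentiable two_ne_zero) hψh hβ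
      hr₀ hβz, abs_neg] at h1
    have h2 : ∫ y in Set.Ioi (0 : ℝ), y ^ (n - 1) * (β y * deriv h y) =
        ∫ y in Set.Ioi r₀, b (h y) * deriv h y := by
      have e1 : ∫ y in Set.Ioi (0 : ℝ), y ^ (n - 1) * (β y * deriv h y) =
          ∫ y in Set.Ioi r₀, y ^ (n - 1) * (β y * deriv h y) := by
        refine setIntegral_eq_of_subset_of_forall_sdiff_eq_zero measurableSet_Ioi
          (Set.Ioi_subset_Ioi hr₀.le) fun y hy => ?_
        rw [hβz y (not_lt.1 hy.2), zero_mul, mul_zero]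
      rw [e1]
      refine setIntegral_congr_fun measurableSet_Ioi fun y (hy : r₀ < y) => ?_
      have hy0 := pow_pos (hr₀.trans hy) (n - 1)
      have hmx : max y r₀ = y := max_eq_left hy.le
      simp only [hβdef, hcdef, hmx, if_neg hy.not_ge]
      field_simp
    have hBd : ∀ y, HasDerivAt (fun y => ∫ z in s..(h y), b z) (b (h y) * deriv h y) y := fun y =>
      (hb.integral_hasStrictDerivAt s (h y)).hasDerivAt.comp y
        (hh.differentiable two_ne_zero y).hasDerivAt
    have hcd : Continuous fun y => b (h y) * deriv h y :=
      (hb.comp hh.continuous).mul (hh.continuous_deriv one_le_two)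
    have hB0 : ∫ z in s..(0 : ℝ), b z = 0 := by
      rw [intervalIntegral.integral_congr (g := fun _ => 0), intervalIntegral.integral_zero]
      intro z hz'
      rw [Set.uIcc_of_ge hs.le] at hz'
      exact hbz' z fun hm => hm.1.not_ge hz'.2
    have h3 : ∫ y in Set.Ioi r₀, b (h y) * deriv h y = 0 - ∫ z in s..(h r₀), b z := by
      refine integral_Ioi_of_hasDerivAt_of_tendsto' (fun y _ => hBd y) ?_ ?_
      · have hcs : IntegrableOn (fun y => b (h y) * deriv h y) (Set.Icc r₀ R) :=
          hcd.integrableOn_Icc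
        refine hcs.of_forall_sdiff_eq_zero measurableSet_Ioi fun y hy => ?_
        have : R < y := by
          by_contra! hcon
          exact hy.2 ⟨le_of_lt hy.1, hcon⟩
        rw [hR y this.le, hbzero, zero_mul]
      · refine tendsto_const_nhds.congr' ?_
        filter_upwards [eventually_ge_atTop R] with y hy
        rw [hR y hy, hB0]
    have h4 : δ - 2 * η ≤ ∫ z in s..(h r₀), b z := by
      have e1 : ∫ z in (s + η)..(s + δ - η), b z = δ - 2 * η := by
        rw [intervalIntegral.integral_congr (g := fun _ => (1 : ℝ))]
        · simp
          ring
        · intro z hz'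
          rw [Set.uIcc_of_le (by linarith)] at hz'
          exact hbI z hz'
      rw [← e1]
      refine intervalIntegral.integral_mono_interval (by linarith) (by linarith) (by linarith)
        (ae_of_all _ hb0) (hb.intervalIntegrable _ _)
    have h5 : n * unitBallVol n * C ≤ (r₀ ^ (n - 1) * r₀ ^ (n - 1))⁻¹ * volume.real E := by
      have e1 := integral_comp_norm (n := n) (by omega) fun y => β y * (y ^ (n - 1))⁻¹
      have e2 : ∫ y in Set.Ioi (0 : ℝ), y ^ (n - 1) * (β y * (y ^ (n - 1))⁻¹) = C := by
        refine setIntegral_congr_fun measurableSet_Ioi fun y (hy : 0 < y) => ?_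
        have := pow_pos hy (n - 1)
        field_simp
      rw [e2] at e1
      rw [← e1]
      have e3 : ∀ x : Euc n, β ‖x‖ * (‖x‖ ^ (n - 1))⁻¹ ≤
          E.indicator (fun _ => (r₀ ^ (n - 1) * r₀ ^ (n - 1))⁻¹) x := by
        intro x
        by_cases hx : ‖x‖ ≤ r₀
        · rw [hβz _ hx, zero_mul]
          exact Set.indicator_nonneg (fun _ _ => by positivity) x
        · rw [not_le] at hx
          by_cases hxE : x ∈ E
          · rw [Set.indicator_of_mem hxE, mul_inv]
            simp only [hβdef]
            have hmx : max ‖x‖ r₀ = ‖x‖ := max_eq_left hx.le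
            rw [hmx]
            have : (‖x‖ ^ (n - 1))⁻¹ ≤ (r₀ ^ (n - 1))⁻¹ := by gcongr
            have hpos : 0 < (‖x‖ ^ (n - 1))⁻¹ := by
              have := hr₀.trans hx
              positivity
            gcongr
            exact mul_le_of_le_one_left hpos.le (hc1 _) |>.trans this
          · rw [Set.indicator_of_notMem hxE]
            have : b (h ‖x‖) = 0 := hbz' _ fun hm => hxE (by
              have hp : 0 < ψ x := by rw [hψh]; exact hs.trans hm.1
              rw [← hψh] at hm
              change s < |ψ x| ∧ |ψ x| ≤ s + δ
              rw [abs_of_pos hp]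
              exact ⟨hm.1, hm.2.le⟩)
            simp [hβdef, hcdef, hx.not_ge, this]
      have e4 : ∫ x, E.indicator (fun _ => (r₀ ^ (n - 1) * r₀ ^ (n - 1))⁻¹) x =
          (r₀ ^ (n - 1) * r₀ ^ (n - 1))⁻¹ * volume.real E := by
        rw [integral_indicator hmE, setIntegral_const, smul_eq_mul, mul_comm]
      rw [← e4]
      refine integral_mono_of_nonneg (ae_of_all _ fun x => ?_)
        ((integrable_indicator_iff hmE).2 (integrableOn_const hEfin.ne)) (ae_of_all _ e3)
      exact mul_nonneg (hβ0 _) (by positivity)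
    rw [h2, h3, zero_sub, mul_neg, abs_neg, abs_of_nonneg (by
      have := hnn.trans h4
      positivity)] at h1
    set P := n * unitBallVol n with hP
    have hP0 : 0 < P := by positivity
    have hr : 0 < r₀ ^ (n - 1) := by positivity
    have h6 : P * (δ - 2 * η) ≤ C * M := (mul_le_mul_of_nonneg_left h4 hP0.le).trans h1
    set r := r₀ ^ (n - 1)
    have h7 : P * C * (r * r) ≤ volume.real E := by
      have := mul_le_mul_of_nonneg_right h5 (by positivity : 0 ≤ r * r)
      rwa [mul_assoc (r * r)⁻¹, mul_comm (volume.real E), inv_mul_cancel_left₀ (by positivity)] at this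
    calc (δ - 2 * η) * (P * r) ^ 2 = P * (δ - 2 * η) * (P * (r * r)) := by ring
      _ ≤ C * M * (P * (r * r)) := by gcongr
      _ = M * (P * C * (r * r)) := by ring
      _ ≤ _ := by gcongr
  have hl : Tendsto (fun η : ℝ => (δ - 2 * η) * (n * unitBallVol n * r₀ ^ (n - 1)) ^ 2) (𝓝[>] 0)
      (𝓝 ((δ - 2 * 0) * (n * unitBallVol n * r₀ ^ (n - 1)) ^ 2)) :=
    Tendsto.mono_left (Continuous.tendsto (by fun_prop) 0) nhdsWithin_le_nhds
  have := le_of_tendsto hl (eventually_nhdsWithin_of_forall fun η hη => key η hη)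
  simpa using this

theorem strip_inequality_radial {n : ℕ} (hn : 2 ≤ n) {ψ : Euc n → ℝ}
    (hψ : ContDiff ℝ 2 ψ) (hc : HasCompactSupport ψ)
    (hrad : ∀ x y : Euc n, ‖x‖ = ‖y‖ → ψ x = ψ y) {s δ a : ℝ} (hs : 0 < s) (hδ : 0 < δ)
    (ha : 0 ≤ a) (haq : a ^ n * unitBallVol n ≤ volume.real {x | s + δ < |ψ x|}) :
    δ * (n * unitBallVol n * a ^ (n - 1)) ^ 2 ≤ ((∫ x, |lapl n ψ x|) / 2) *
      (volume.real {x | s < |ψ x|} - volume.real {x | s + δ < |ψ x|}) := by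
  have hk := unitBallVol_pos n
  have hn1 : 1 ≤ n := by omega
  have hca : HasCompactSupport fun x => |ψ x| := hc.comp_left (g := fun t => |t|) abs_zero
  have hfin : volume {x | s < |ψ x|} < ⊤ := volume_superlevel_lt_top hca hs
  have hsub : {x | s + δ < |ψ x|} ⊆ {x | s < |ψ x|} := fun x (hx : s + δ < |ψ x|) => by
    change s < |ψ x|
    linarith
  have hD : volume.real {x | s < |ψ x| ∧ |ψ x| ≤ s + δ} =
      volume.real {x | s < |ψ x|} - volume.real {x | s + δ < |ψ x|} := by
    rw [← measureReal_sdiff hsub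
      (measurableSet_lt measurable_const hψ.continuous.abs.measurable) hfin.ne]
    congr 1
    ext x
    simp
  rw [← hD]
  have hM0 : 0 ≤ (∫ x, |lapl n ψ x|) / 2 :=
    div_nonneg (integral_nonneg fun x => abs_nonneg _) (by norm_num)
  rcases ha.eq_or_lt with rfl | ha
  · rw [zero_pow (by omega), mul_zero, zero_pow two_ne_zero, mul_zero]
    exact mul_nonneg hM0 measureReal_nonneg
  obtain ⟨h, hh, hψh, R, hR0, hR⟩ := exists_profile hn1 hψ hc hrad
  have hpos : 0 < volume.real {x | s + δ < |ψ x|} := (by positivity : 0 < a ^ n * _).trans_le haq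
  have hne : {x | s + δ < |ψ x|}.Nonempty := by
    by_contra! hcon
    simp [hcon] at hpos
  set K := {r | s + δ ≤ |h r|} ∩ Set.Icc 0 R with hK
  have hKc : IsCompact K := isCompact_Icc.inter_left
    (isClosed_le continuous_const hh.continuous.abs)
  have hmemK : ∀ x, s + δ < |ψ x| → ‖x‖ ∈ K := by
    intro x hx
    rw [hψh] at hx
    refine ⟨hx.le, norm_nonneg x, ?_⟩
    by_contra! hcon
    rw [hR _ hcon.le, abs_zero] at hx
    linarith
  obtain ⟨x₁, hx₁⟩ := hne
  obtain ⟨r₀, hr₀K, hr₀max⟩ := hKc.exists_isGreatest ⟨_, hmemK x₁ hx₁⟩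
  have hincl : {x | s + δ < |ψ x|} ⊆ Metric.closedBall 0 r₀ := fun x hx => by
    rw [mem_closedBall_zero_iff]
    exact hr₀max (hmemK x hx)
  have har : a ≤ r₀ := by
    have h1 : a ^ n * unitBallVol n ≤ r₀ ^ n * unitBallVol n := by
      refine haq.trans ((measureReal_mono hincl measure_closedBall_lt_top.ne).trans ?_)
      have : Nonempty (Fin n) := ⟨⟨0, hn1⟩⟩
      rcases hr₀K.2.1.eq_or_lt with h0 | h0
      · rw [← h0]
        simp [measureReal_def, zero_pow (show n ≠ 0 by omega)]
      · rw [measureReal_def, Measure.addHaar_closedBall_eq_addHaar_ball, volume_ball_eq h0,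
          ENNReal.toReal_ofReal (by positivity)]
    exact le_of_pow_le_pow_left₀ (by omega) hr₀K.2.1 (le_of_mul_le_mul_right h1 hk)
  have hr₀ : 0 < r₀ := ha.trans_le har
  have main : δ * (n * unitBallVol n * r₀ ^ (n - 1)) ^ 2 ≤ ((∫ x, |lapl n ψ x|) / 2) *
      volume.real {x | s < |ψ x| ∧ |ψ x| ≤ s + δ} := by
    rcases le_abs'.1 (show s + δ ≤ |h r₀| from hr₀K.1) with h1 | h1
    · have hneg : ∀ x, lapl n (fun x => -ψ x) x = -lapl n ψ x := by
        intro x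
        have := iteratedFDeriv_neg_apply (𝕜 := ℝ) (i := 2) (f := ψ) (x := x)
        simp only [lapl, ← Finset.sum_neg_distrib]
        refine Finset.sum_congr rfl fun i _ => ?_
        rw [show (fun x => -ψ x) = -ψ from rfl, this]
        rfl
      have := strip_inequality_radial_aux hn (ψ := fun x => -ψ x) hψ.neg
        (hc.comp_left (g := fun t => -t) neg_zero) (h := fun r => -h r) hh.neg
        (fun x => by rw [hψh]) (R := R) (fun r hr => by rw [hR r hr, neg_zero]) (δ := δ) hs hr₀
        (by linarith)
      simpa only [hneg, abs_neg] using this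
    · exact strip_inequality_radial_aux hn hψ hc hh hψh hR hs hr₀ h1
  refine le_trans ?_ main
  gcongr

theorem sub_le_integral_lapl_mul_NstarV_radial {n : ℕ} (hn : 2 ≤ n) {φ : Euc n → ℝ}
    (hφ : ContDiff ℝ 2 φ) (hc : HasCompactSupport φ)
    (hrad : ∀ x y : Euc n, ‖x‖ = ‖y‖ → φ x = φ y) {p q V t : ℝ} (hp : 0 < p)
    (hpq : p ≤ q) (ht : 0 < t) (hqt : t ≤ volume.real {x | q < |φ x|})
    (hpV : volume.real {x | p < |φ x|} ≤ V) :
    q - p ≤ (∫ x, |lapl n φ x|) / 2 * NstarV n V t := by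
  have hca : HasCompactSupport fun x => |φ x| := hc.comp_left (g := fun t => |t|) abs_zero
  exact sub_le_mul_NstarV_of_strip_bounds hn
    (div_nonneg (integral_nonneg fun x => abs_nonneg _) (by norm_num)) hca hp hpq ht hqt hpV
    fun x y a hx hxy ha hay => by
      have := strip_inequality_radial hn hφ hc hrad hx (sub_pos.2 hxy) ha
      rw [add_sub_cancel] at this
      exact this hay

theorem NstarV_eq_integral {n : ℕ} (hn : 2 ≤ n) {a b : ℝ} (ha : 0 < a) (hb : 0 < b) :
    NstarV n (b ^ n * unitBallVol n) (a ^ n * unitBallVol n) =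
      ∫ q in (a ^ 2)..(b ^ 2), q ^ (-((n : ℝ) / 2)) / (2 * (n * unitBallVol n)) := by
  have hk := unitBallVol_pos n
  have h0 : (0 : ℝ) ∉ Set.uIcc (a ^ 2) (b ^ 2) := by
    intro h
    rcases Set.mem_uIcc.1 h with h | h
    · exact absurd h.1 (not_le.2 (by positivity))
    · exact absurd h.1 (not_le.2 (by positivity))
  rw [intervalIntegral.integral_div]
  rcases hn.eq_or_lt with rfl | hn
  · have e1 : ∫ q in (a ^ 2)..(b ^ 2), q ^ (-(((2 : ℕ) : ℝ) / 2)) = Real.log (b ^ 2 / a ^ 2) := by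
      rw [← integral_inv h0]
      refine intervalIntegral.integral_congr fun q _ => ?_
      simp [Real.rpow_neg_one]
    rw [e1, NstarV_two, unitBallVol_two, mul_div_mul_right _ _ Real.pi_pos.ne']
    push_cast
    ring
  · obtain ⟨k, rfl⟩ : ∃ k, n = k + 3 := ⟨n - 3, by omega⟩
    have hk0 := (k.cast_nonneg : (0 : ℝ) ≤ k)
    have hne : -(((k + 3 : ℕ) : ℝ) / 2) ≠ -1 := by
      push_cast
      intro h
      linarith
    rw [integral_rpow (Or.inr ⟨hne, h0⟩), NstarV_of_three_le hn]
    set β : ℝ := (((k + 3 : ℕ) : ℝ) - 2) / (k + 3 : ℕ) with hβ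
    have h1 : ∀ c : ℝ, 0 < c → unitBallVol (k + 3) ^ β * (c ^ (k + 3) * unitBallVol (k + 3)) ^ (-β) =
        (c ^ 2) ^ (-(((k + 3 : ℕ) : ℝ) / 2) + 1) := by
      intro c hc
      rw [Real.mul_rpow (by positivity) hk.le, mul_comm, mul_assoc,
        ← Real.rpow_add hk, neg_add_cancel, Real.rpow_zero, mul_one,
        ← Real.rpow_natCast, ← Real.rpow_mul hc.le, ← Real.rpow_natCast c 2, ← Real.rpow_mul hc.le]
      congr 1
      rw [hβ]
      push_cast
      field_simp
      ring
    rw [← h1 a ha, ← h1 b hb]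
    generalize unitBallVol (k + 3) ^ β = A
    generalize (a ^ (k + 3) * unitBallVol (k + 3)) ^ (-β) = X
    generalize (b ^ (k + 3) * unitBallVol (k + 3)) ^ (-β) = Y
    push_cast
    rw [show -(((k : ℝ) + 3) / 2) + 1 = -((k + 1) / 2) by ring,
      show (k : ℝ) + 3 - 2 = k + 1 by ring]
    field_simp
    ring

theorem le_decRearr {n : ℕ} {Ω : Set (Euc n)} {u : Euc n → ℝ} {t m B : ℝ}
    (hB : ∀ x, |u x| ≤ B) (h : ENNReal.ofReal t < volume {x ∈ Ω | m ≤ |u x|}) :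
    m ≤ decRearr n Ω u t := by
  refine le_csInf ⟨B, (abs_nonneg _).trans (hB 0), ?_⟩ fun s hs => ?_
  · rw [show {x ∈ Ω | B < |u x|} = ∅ from ?_, measure_empty]
    · exact zero_le
    · ext x
      simp [hB x]
  · by_contra! hcon
    refine absurd (h.trans_le ((measure_mono fun x hx => ?_).trans hs.2)) (lt_irrefl _)
    exact ⟨hx.1, hcon.trans_le hx.2⟩

theorem lapl_comp_norm_sq {n : ℕ} {U : ℝ → ℝ} (hU : ContDiff ℝ 2 U) (x : Euc n) :
    lapl n (fun x => U (‖x‖ ^ 2)) x =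
      4 * ‖x‖ ^ 2 * deriv (deriv U) (‖x‖ ^ 2) + 2 * n * deriv U (‖x‖ ^ 2) := by
  have hφ : ContDiff ℝ 2 fun x : Euc n => U (‖x‖ ^ 2) := hU.comp (contDiff_norm_sq ℝ)
  have hU' : ContDiff ℝ 1 (deriv U) := by
    rw [← one_add_one_eq_two, contDiff_succ_iff_deriv] at hU
    exact hU.2.2
  have hsq : ∀ y : Euc n, HasFDerivAt (fun x : Euc n => ‖x‖ ^ 2) (2 • innerSL ℝ y) y := fun y =>
    (hasStrictFDerivAt_norm_sq y).hasFDerivAt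
  have h1 : ∀ (i : Fin n) (y : Euc n), fderiv ℝ (fun x : Euc n => U (‖x‖ ^ 2)) y (stdVec i) =
      deriv U (‖y‖ ^ 2) * (2 * y i) := by
    intro i y
    have := (hU.differentiable two_ne_zero (‖y‖ ^ 2)).hasDerivAt.comp_hasFDerivAt y (hsq y)
    rw [(show HasFDerivAt (fun x : Euc n => U (‖x‖ ^ 2)) _ y from this).fderiv]
    simp [EuclideanSpace.inner_single_right, two_mul]
  rw [lapl_eq_sum_fderiv hφ]
  have h2 : ∀ i : Fin n, fderiv ℝ (fun y => fderiv ℝ (fun x : Euc n => U (‖x‖ ^ 2)) y (stdVec i)) x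
      (stdVec i) = deriv (deriv U) (‖x‖ ^ 2) * 4 * (x i) ^ 2 + 2 * deriv U (‖x‖ ^ 2) := by
    intro i
    simp only [h1]
    have e1 : HasFDerivAt (fun x : Euc n => deriv U (‖x‖ ^ 2))
        (deriv (deriv U) (‖x‖ ^ 2) • 2 • innerSL ℝ x) x := by
      have := (hU'.differentiable one_ne_zero (‖x‖ ^ 2)).hasDerivAt.comp_hasFDerivAt x (hsq x)
      exact this
    have e2 : HasFDerivAt (fun y : Euc n => 2 * y i)
        ((2 : ℝ) • (EuclideanSpace.proj i : Euc n →L[ℝ] ℝ)) x :=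
      (EuclideanSpace.proj i : Euc n →L[ℝ] ℝ).hasFDerivAt.const_mul 2
    rw [(show HasFDerivAt (fun y : Euc n => deriv U (‖y‖ ^ 2) * (2 * y i)) _ x from
      e1.mul e2).fderiv]
    simp [EuclideanSpace.inner_single_right, two_mul]
    ring
  rw [Finset.sum_congr rfl fun i _ => h2 i, Finset.sum_add_distrib, ← Finset.mul_sum,
    EuclideanSpace.norm_sq_eq, Finset.sum_const, Finset.card_univ, Fintype.card_fin]
  simp only [Real.norm_eq_abs, sq_abs, nsmul_eq_mul]
  ring

theorem contDiff_mul_rpow_of_eq_zero {F : ℝ → ℝ} (hF : ContDiff ℝ (⊤ : ℕ∞) F) {δ : ℝ}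
    (hδ : 0 < δ) (h0 : ∀ q ≤ δ, F q = 0) (p : ℝ) :
    ContDiff ℝ (⊤ : ℕ∞) fun q => F q * q ^ p := by
  refine contDiff_iff_contDiffAt.2 fun q => ?_
  rcases lt_or_ge q δ with hq | hq
  · refine (contDiffAt_const (c := (0 : ℝ))).congr_of_eventuallyEq ?_
    filter_upwards [eventually_lt_nhds hq] with y hy
    rw [h0 y hy.le, zero_mul]
  · exact hF.contDiffAt.mul (Real.contDiffAt_rpow_const_of_ne (hδ.trans_le hq).ne')

theorem contDiff_top_of_hasDerivAt {U H : ℝ → ℝ} (hU : ∀ q, HasDerivAt U (H q) q)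
    (hH : ContDiff ℝ (⊤ : ℕ∞) H) : ContDiff ℝ (⊤ : ℕ∞) U := by
  rw [contDiff_infty_iff_deriv]
  refine ⟨fun q => (hU q).differentiableAt, ?_⟩
  rwa [funext fun q => (hU q).deriv]

theorem integral_abs_lapl_comp_norm_sq_le {n : ℕ} (hn : 1 ≤ n) {U S₁ S₂ : ℝ → ℝ}
    (hU : ContDiff ℝ 2 U) (hS₁ : ContDiff ℝ (⊤ : ℕ∞) S₁) (hS₂ : ContDiff ℝ (⊤ : ℕ∞) S₂)
    (m₁ : Monotone S₁) (m₂ : Monotone S₂) (z₁ : S₁ 0 = 0) (z₂ : S₂ 0 = 0)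
    (l₁ : Tendsto S₁ atTop (𝓝 1)) (l₂ : Tendsto S₂ atTop (𝓝 1))
    (hd : ∀ q, deriv U q = -((S₁ q - S₂ q) * q ^ (-((n : ℝ) / 2)) / (2 * (n * unitBallVol n)))) :
    ∫ x, |lapl n (fun x => U (‖x‖ ^ 2)) x| ≤ 2 := by
  have hk := unitBallVol_pos n
  have hn0 : (0 : ℝ) < n := by exact_mod_cast hn
  have d₁ := hS₁.differentiable (by simp)
  have d₂ := hS₂.differentiable (by simp)
  have p₁ : ∀ q, 0 ≤ deriv S₁ q := fun q => m₁.deriv_nonneg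
  have p₂ : ∀ q, 0 ≤ deriv S₂ q := fun q => m₂.deriv_nonneg
  set G : ℝ → ℝ := fun r => S₁ (r ^ 2) + S₂ (r ^ 2) with hG
  set G' : ℝ → ℝ := fun r => 2 * r * (deriv S₁ (r ^ 2) + deriv S₂ (r ^ 2)) with hG'
  have hGd : ∀ r : ℝ, HasDerivAt G (G' r) r := by
    intro r
    have e : HasDerivAt (fun r : ℝ => r ^ 2) (2 * r) r := by simpa using hasDerivAt_pow 2 r
    have e₁ := (d₁ (r ^ 2)).hasDerivAt.comp r e
    have e₂ := (d₂ (r ^ 2)).hasDerivAt.comp r e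
    refine (e₁.add e₂).congr_deriv ?_
    rw [hG']
    ring
  have hG'0 : ∀ r ∈ Set.Ioi (0 : ℝ), 0 ≤ G' r := fun r hr =>
    mul_nonneg (mul_nonneg two_pos.le (le_of_lt hr)) (add_nonneg (p₁ _) (p₂ _))
  have hlim : Tendsto G atTop (𝓝 2) := by
    have e : Tendsto (fun r : ℝ => r ^ 2) atTop atTop := tendsto_pow_atTop two_ne_zero
    have := (l₁.comp e).add (l₂.comp e)
    rwa [one_add_one_eq_two] at this
  have hInt := integrableOn_Ioi_deriv_of_nonneg' (fun r _ => hGd r) hG'0 hlim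
  have hval := integral_Ioi_of_hasDerivAt_of_nonneg' (fun r _ => hGd r) hG'0 hlim
  have hder2 : ∀ q, 0 < q → deriv (deriv U) q =
      -(((deriv S₁ q - deriv S₂ q) * q ^ (-((n : ℝ) / 2)) +
        (S₁ q - S₂ q) * (-((n : ℝ) / 2) * q ^ (-((n : ℝ) / 2) - 1))) /
          (2 * (n * unitBallVol n))) := by
    intro q hq
    rw [funext hd]
    exact ((((d₁ q).hasDerivAt.sub (d₂ q).hasDerivAt).mul
      (Real.hasDerivAt_rpow_const (Or.inl hq.ne'))).div_const _).neg.deriv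
  have hlap : ∀ x : Euc n, lapl n (fun x => U (‖x‖ ^ 2)) x =
      4 * ‖x‖ ^ 2 * deriv (deriv U) (‖x‖ ^ 2) + 2 * n * deriv U (‖x‖ ^ 2) :=
    lapl_comp_norm_sq hU
  simp only [hlap]
  rw [integral_comp_norm hn fun r =>
    |4 * r ^ 2 * deriv (deriv U) (r ^ 2) + 2 * n * deriv U (r ^ 2)|, ← integral_const_mul]
  have hval' : ∫ r in Set.Ioi (0 : ℝ), G' r = 2 := by
    rw [hval, hG]
    simp [z₁, z₂]
  refine le_trans ?_ hval'.le
  have hpt : ∀ r ∈ Set.Ioi (0 : ℝ), n * unitBallVol n * (r ^ (n - 1) *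
      |4 * r ^ 2 * deriv (deriv U) (r ^ 2) + 2 * n * deriv U (r ^ 2)|) =
      2 * r * |deriv S₁ (r ^ 2) - deriv S₂ (r ^ 2)| := by
    intro r hr
    have hr : 0 < r := hr
    have hr2 : 0 < r ^ 2 := by positivity
    have e1 : (r ^ 2) ^ (-((n : ℝ) / 2)) = (r ^ n)⁻¹ := by
      rw [← Real.rpow_natCast r 2, ← Real.rpow_mul hr.le, ← Real.rpow_natCast, ← Real.rpow_neg hr.le]
      congr 1
      push_cast
      ring
    have e2 : 4 * r ^ 2 * deriv (deriv U) (r ^ 2) + 2 * n * deriv U (r ^ 2) =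
        -(2 * r ^ 2 * (r ^ n)⁻¹ / (n * unitBallVol n) *
          (deriv S₁ (r ^ 2) - deriv S₂ (r ^ 2))) := by
      rw [hder2 _ hr2, hd, Real.rpow_sub_one hr2.ne', e1]
      field_simp
      ring
    rw [e2, abs_neg, abs_mul, abs_of_pos (by positivity : 0 < 2 * r ^ 2 * (r ^ n)⁻¹ / (n * unitBallVol n))]
    obtain ⟨m, rfl⟩ : ∃ m, n = m + 1 := ⟨n - 1, by omega⟩
    rw [Nat.add_sub_cancel]
    field_simp
    rw [pow_succ r m]
  refine integral_mono_of_nonneg ?_ hInt ?_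
  · filter_upwards [ae_restrict_mem measurableSet_Ioi] with r hr
    have : (0 : ℝ) < r := hr
    positivity
  · filter_upwards [ae_restrict_mem measurableSet_Ioi] with r hr
    have hr0 : (0 : ℝ) < r := hr
    rw [hpt r hr, hG']
    refine mul_le_mul_of_nonneg_left ?_ (by positivity)
    have := p₁ (r ^ 2)
    have := p₂ (r ^ 2)
    rw [abs_le]
    constructor <;> linarith

theorem exists_extremal {n : ℕ} (hn : 2 ≤ n) {r₁ ρ₁ ρ₂ : ℝ} (hr₁ : 0 < r₁) (h1 : r₁ < ρ₁)
    (h2 : ρ₁ < ρ₂) :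
    ∃ u : Euc n → ℝ, ContDiff ℝ (⊤ : ℕ∞) u ∧ tsupport u ⊆ Metric.closedBall 0 ρ₂ ∧
      (∃ g : ℝ → ℝ, ∀ x, u x = g ‖x‖) ∧ (∀ x, 0 ≤ u x) ∧ ∫ x, |lapl n u x| ≤ 2 ∧
      ∀ r₂, r₁ ≤ r₂ → r₂ ≤ ρ₁ → ∀ x, ‖x‖ ≤ r₂ →
        NstarV n (ρ₁ ^ n * unitBallVol n) (r₂ ^ n * unitBallVol n) ≤ u x := by
  have hk := unitBallVol_pos n
  have hn0 : (0 : ℝ) < n := by exact_mod_cast (by omega : 0 < n)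
  have hρ₁ : 0 < ρ₁ := hr₁.trans h1
  have hρ₂ : 0 < ρ₂ := hρ₁.trans h2
  have hsq1 : r₁ ^ 2 < ρ₁ ^ 2 := by gcongr
  have hsq2 : ρ₁ ^ 2 < ρ₂ ^ 2 := by gcongr
  have hr₁2 : 0 < r₁ ^ 2 := by positivity
  set S₁ : ℝ → ℝ := fun q => Real.smoothTransition ((q - r₁ ^ 2 / 2) / (r₁ ^ 2 / 2)) with hS₁
  set S₂ : ℝ → ℝ := fun q => Real.smoothTransition ((q - ρ₁ ^ 2) / (ρ₂ ^ 2 - ρ₁ ^ 2)) with hS₂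
  have c₁ : ContDiff ℝ (⊤ : ℕ∞) S₁ :=
    Real.smoothTransition.contDiff.comp ((contDiff_id.sub contDiff_const).div_const _)
  have c₂ : ContDiff ℝ (⊤ : ℕ∞) S₂ :=
    Real.smoothTransition.contDiff.comp ((contDiff_id.sub contDiff_const).div_const _)
  have m₁ : Monotone S₁ := fun a b h => Real.smoothTransition.monotone (by gcongr)
  have hpos : 0 < ρ₂ ^ 2 - ρ₁ ^ 2 := sub_pos.2 hsq2
  have m₂ : Monotone S₂ := fun a b h => Real.smoothTransition.monotone (by gcongr)
  have z₁ : ∀ q ≤ r₁ ^ 2 / 2, S₁ q = 0 := fun q hq =>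
    Real.smoothTransition.zero_of_nonpos (div_nonpos_of_nonpos_of_nonneg (by linarith) (by linarith))
  have o₁ : ∀ q, r₁ ^ 2 ≤ q → S₁ q = 1 := fun q hq =>
    Real.smoothTransition.one_of_one_le (by rw [le_div_iff₀ (by positivity)]; linarith)
  have z₂ : ∀ q ≤ ρ₁ ^ 2, S₂ q = 0 := fun q hq =>
    Real.smoothTransition.zero_of_nonpos (div_nonpos_of_nonpos_of_nonneg (by linarith) (by linarith))
  have o₂ : ∀ q, ρ₂ ^ 2 ≤ q → S₂ q = 1 := fun q hq =>
    Real.smoothTransition.one_of_one_le (by rw [le_div_iff₀ hpos]; linarith)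
  set H : ℝ → ℝ := fun q => (S₁ q - S₂ q) * q ^ (-((n : ℝ) / 2)) / (2 * (n * unitBallVol n)) with hH
  have hHc : ContDiff ℝ (⊤ : ℕ∞) H :=
    (contDiff_mul_rpow_of_eq_zero (c₁.sub c₂) (half_pos hr₁2)
      (fun q hq => by rw [z₁ q hq, z₂ q (by linarith), sub_zero]) _).div_const _
  have hH0 : ∀ q, ρ₂ ^ 2 ≤ q → H q = 0 := by
    intro q hq
    simp [hH, o₁ q (by linarith), o₂ q hq]
  have hHn : ∀ q, 0 ≤ H q := by
    intro q
    rcases le_or_gt q (r₁ ^ 2 / 2) with hq | hq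
    · simp [hH, z₁ q hq, z₂ q (by linarith)]
    · have hq0 : 0 < q := by linarith
      have : S₂ q ≤ S₁ q := by
        rcases le_total q (ρ₁ ^ 2) with h | h
        · rw [z₂ q h]
          exact Real.smoothTransition.nonneg _
        · rw [o₁ q (by linarith)]
          exact Real.smoothTransition.le_one _
      have := sub_nonneg.2 this
      positivity
  have hHI : ∀ a b, IntervalIntegrable H volume a b := fun a b =>
    hHc.continuous.intervalIntegrable a b
  set U : ℝ → ℝ := fun q => ∫ s in q..(ρ₂ ^ 2), H s with hU
  have hUd : ∀ q, HasDerivAt U (-H q) q := fun q =>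
    intervalIntegral.integral_hasDerivAt_left (hHI _ _)
      (hHc.continuous.stronglyMeasurableAtFilter _ _) hHc.continuous.continuousAt
  have hUc : ContDiff ℝ (⊤ : ℕ∞) U := contDiff_top_of_hasDerivAt hUd hHc.neg
  have hU0 : ∀ q, ρ₂ ^ 2 ≤ q → U q = 0 := by
    intro q hq
    rw [hU]
    refine (intervalIntegral.integral_congr fun s hs => ?_).trans intervalIntegral.integral_zero
    rw [Set.uIcc_of_ge hq] at hs
    exact hH0 s hs.1
  have hUn : ∀ q, 0 ≤ U q := by
    intro q
    rcases le_total (ρ₂ ^ 2) q with hq | hq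
    · rw [hU0 q hq]
    · exact intervalIntegral.integral_nonneg hq fun s _ => hHn s
  refine ⟨fun x => U (‖x‖ ^ 2), hUc.comp (contDiff_norm_sq ℝ), ?_, ⟨fun r => U (r ^ 2), fun _ => rfl⟩,
    fun x => hUn _, ?_, ?_⟩
  · refine closure_minimal (fun x hx => ?_) Metric.isClosed_closedBall
    rw [mem_closedBall_zero_iff]
    by_contra! hcon
    exact hx (hU0 _ (by gcongr))
  · have l₁ : Tendsto S₁ atTop (𝓝 1) :=
      tendsto_const_nhds.congr' ((eventually_ge_atTop _).mono fun q hq => (o₁ q hq).symm)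
    have l₂ : Tendsto S₂ atTop (𝓝 1) :=
      tendsto_const_nhds.congr' ((eventually_ge_atTop _).mono fun q hq => (o₂ q hq).symm)
    exact integral_abs_lapl_comp_norm_sq_le (by omega) ((contDiff_infty.1 hUc) 2) c₁ c₂ m₁ m₂
      (z₁ 0 (by positivity)) (z₂ 0 (by positivity)) l₁ l₂ fun q => (hUd q).deriv
  · intro r₂ h12 h2ρ x hx
    have hr₂ : 0 < r₂ := hr₁.trans_le h12
    rw [NstarV_eq_integral hn hr₂ hρ₁]
    have hxr : ‖x‖ ^ 2 ≤ r₂ ^ 2 := by gcongr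
    have hrr : r₂ ^ 2 ≤ ρ₁ ^ 2 := by gcongr
    have e1 : ∫ q in (r₂ ^ 2)..(ρ₁ ^ 2), q ^ (-((n : ℝ) / 2)) / (2 * (n * unitBallVol n)) =
        ∫ q in (r₂ ^ 2)..(ρ₁ ^ 2), H q := by
      refine intervalIntegral.integral_congr fun s hs => ?_
      rw [Set.uIcc_of_le hrr] at hs
      have : r₁ ^ 2 ≤ r₂ ^ 2 := by gcongr
      simp [hH, o₁ s (this.trans hs.1), z₂ s hs.2]
    rw [e1]
    have e2 := intervalIntegral.integral_add_adjacent_intervals (hHI (‖x‖ ^ 2) (r₂ ^ 2))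
      (hHI (r₂ ^ 2) (ρ₁ ^ 2))
    have e3 := intervalIntegral.integral_add_adjacent_intervals (hHI (‖x‖ ^ 2) (ρ₁ ^ 2))
      (hHI (ρ₁ ^ 2) (ρ₂ ^ 2))
    have e4 : 0 ≤ ∫ q in (‖x‖ ^ 2)..(r₂ ^ 2), H q :=
      intervalIntegral.integral_nonneg hxr fun s _ => hHn s
    have e5 : 0 ≤ ∫ q in (ρ₁ ^ 2)..(ρ₂ ^ 2), H q :=
      intervalIntegral.integral_nonneg hsq2.le fun s _ => hHn s
    change _ ≤ ∫ q in (‖x‖ ^ 2)..(ρ₂ ^ 2), H q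
    linarith

theorem continuousAt_NstarV_left {n : ℕ} (hn : 2 ≤ n) {V t : ℝ} (hV : 0 < V) (ht : 0 < t) :
    ContinuousAt (fun W => NstarV n W t) V := by
  rcases hn.eq_or_lt with rfl | hn
  · simp only [NstarV_two]
    exact ((continuousAt_id.div_const t).log (div_pos hV ht).ne').const_mul _
  · simp only [NstarV_of_three_le hn]
    exact (continuousAt_const.sub (Real.continuousAt_rpow_const _ _ (Or.inl hV.ne'))).const_mul _

theorem continuousAt_NstarV_right {n : ℕ} (hn : 2 ≤ n) {V t : ℝ} (hV : 0 < V) (ht : 0 < t) :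
    ContinuousAt (NstarV n V) t := by
  rcases hn.eq_or_lt with rfl | hn
  · rw [funext (NstarV_two V)]
    exact ((continuousAt_const.div continuousAt_id ht.ne').log (div_pos hV ht).ne').const_mul _
  · rw [funext fun t => NstarV_of_three_le hn (V := V) (t := t)]
    exact ((Real.continuousAt_rpow_const _ _ (Or.inl ht.ne')).sub continuousAt_const).const_mul _

theorem tendsto_NstarV_atTop {n : ℕ} (hn : 2 ≤ n) {V : ℝ} (hV : 0 < V) :
    Tendsto (NstarV n V) (𝓝[>] 0) atTop := by
  have hk := unitBallVol_pos n
  rcases hn.eq_or_lt with rfl | hn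
  · rw [funext (NstarV_two V)]
    refine Tendsto.const_mul_atTop (by have := Real.pi_pos; positivity) ?_
    exact Real.tendsto_log_atTop.comp (tendsto_inv_nhdsGT_zero.const_mul_atTop hV)
  · rw [funext fun t => NstarV_of_three_le hn (V := V) (t := t)]
    have hn2 : (0 : ℝ) < (n : ℝ) - 2 := by
      have : (3 : ℝ) ≤ n := by exact_mod_cast hn
      linarith
    have hn0 : (0 : ℝ) < n := by linarith
    refine Tendsto.const_mul_atTop (by positivity) (tendsto_atTop_add_const_right _ _ ?_)
    exact tendsto_rpow_neg_nhdsGT_zero (neg_lt_zero.2 (div_pos hn2 hn0))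

theorem exists_lt_ratio {n : ℕ} (hn : 2 ≤ n) {Ω : Set (Euc n)} (hΩo : IsOpen Ω)
    (hΩb : Bornology.IsBounded Ω) (h0 : (0 : Euc n) ∈ Ω) {w : ℝ} (hw : w < 1 / 2) :
    ∃ u f : Euc n → ℝ, ∃ t : ℝ, MemW21Delta0 n Ω u f ∧ (∃ g : ℝ → ℝ, ∀ x, u x = g ‖x‖) ∧
      (∀ x, 0 ≤ u x) ∧ L1norm n Ω f ≠ 0 ∧ 0 < t ∧ t ≤ (volume Ω).toReal ∧
      w < decRearr n Ω u t / (NstarV n (volume Ω).toReal t * L1norm n Ω f) := by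
  have hk := unitBallVol_pos n
  have hn1 : 1 ≤ n := by omega
  obtain ⟨ρ, hρ, hρΩ⟩ := Metric.nhds_basis_closedBall.mem_iff.1 (hΩo.mem_nhds h0)
  have hball : Metric.ball (0 : Euc n) ρ ⊆ Ω := Metric.ball_subset_closedBall.trans hρΩ
  set V := (volume Ω).toReal with hVdef
  have hvol : ∀ r, 0 < r → (volume (Metric.ball (0 : Euc n) r)).toReal = r ^ n * unitBallVol n := by
    intro r hr
    rw [volume_ball_eq hr, ENNReal.toReal_ofReal (by positivity)]
  have hVρ : ρ ^ n * unitBallVol n ≤ V := by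
    rw [← hvol ρ hρ]
    exact ENNReal.toReal_mono hΩb.measure_lt_top.ne (measure_mono hball)
  have hV : 0 < V := lt_of_lt_of_le (by positivity) hVρ
  set V₁ := (ρ / 2) ^ n * unitBallVol n with hV₁
  have hV₁0 : 0 < V₁ := by positivity
  have hV₁V : V₁ ≤ V := by
    refine le_trans ?_ hVρ
    rw [hV₁]
    gcongr
    linarith
  set C := NstarV n V V₁ with hC
  have hC0 : 0 ≤ C := NstarV_nonneg hn hV₁0 hV₁V
  have htend : Tendsto (fun r : ℝ => r ^ n * unitBallVol n) (𝓝[>] 0) (𝓝[>] 0) := by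
    refine tendsto_nhdsWithin_iff.2 ⟨?_, ?_⟩
    · have : Continuous fun r : ℝ => r ^ n * unitBallVol n := by fun_prop
      exact (tendsto_nhdsWithin_of_tendsto_nhds (this.tendsto' 0 0 (by simp; omega)))
    · filter_upwards [self_mem_nhdsWithin] with r hr
      have hr : 0 < r := hr
      exact mul_pos (by positivity) hk
  obtain ⟨M₀, hM₀, hM₀w⟩ : ∃ M₀ : ℝ, 0 < M₀ ∧ ∀ M, M₀ ≤ M → w < M / ((M + C + 1) * 2) := by
    have hw' : 0 < 1 - 2 * w := by linarith
    refine ⟨(2 * |w| * (C + 1) + 1) / (1 - 2 * w), by positivity, fun M hM => ?_⟩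
    have hM0 : 0 < M := lt_of_lt_of_le (by positivity) hM
    rw [div_le_iff₀ hw'] at hM
    rw [lt_div_iff₀ (by positivity)]
    have := mul_le_mul_of_nonneg_right (le_abs_self w) (by linarith : 0 ≤ C + 1)
    nlinarith
  obtain ⟨r₂, ⟨hr₂M, hr₂ρ⟩, hr₂⟩ := ((((tendsto_NstarV_atTop hn hV₁0).comp htend).eventually_ge_atTop
    M₀).and (mem_nhdsWithin_of_mem_nhds (Iio_mem_nhds (half_pos hρ)))).and
      self_mem_nhdsWithin |>.exists
  have hr₂ : 0 < r₂ := hr₂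
  have hr₂ρ : r₂ < ρ / 2 := hr₂ρ
  set τ₂ := r₂ ^ n * unitBallVol n with hτ₂
  have hτ₂0 : 0 < τ₂ := by positivity
  have hcont : Tendsto (fun r : ℝ => NstarV n V (r ^ n * unitBallVol n)) (𝓝[<] r₂)
      (𝓝 (NstarV n V τ₂)) := by
    have e : ContinuousAt (fun r : ℝ => r ^ n * unitBallVol n) r₂ := by fun_prop
    exact tendsto_nhdsWithin_of_tendsto_nhds
      (ContinuousAt.comp (f := fun r : ℝ => r ^ n * unitBallVol n)
        (continuousAt_NstarV_right hn hV hτ₂0) e)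
  obtain ⟨r₁, ⟨hr₁N, hr₁⟩, hr₁₂⟩ := ((hcont.eventually_lt_const (lt_add_one _)).and
    (mem_nhdsWithin_of_mem_nhds (Ioi_mem_nhds hr₂))).and self_mem_nhdsWithin |>.exists
  have hr₁ : 0 < r₁ := hr₁
  have hr₁₂ : r₁ < r₂ := hr₁₂
  set t := r₁ ^ n * unitBallVol n with ht
  have ht0 : 0 < t := by positivity
  have htτ : t < τ₂ := by
    rw [ht, hτ₂]
    gcongr
  have hτV : τ₂ < V₁ := by
    rw [hV₁, hτ₂]
    gcongr
  have htV : t < V := (htτ.trans hτV).trans_le hV₁V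
  obtain ⟨u, huc, hus, hur, hu0, huL, huN⟩ := exists_extremal hn hr₁ (hr₁₂.trans hr₂ρ) (half_lt_self hρ)
  have htest : IsTestFun n Ω u := ⟨huc,
    (isCompact_closedBall _ _).of_isClosed_subset (isClosed_tsupport u) hus, hus.trans hρΩ⟩
  have hmem : MemW21Delta0 n Ω u (lapl n u) := by
    refine ⟨htest.integrable.integrableOn, ?_, fun _ => u, fun _ => htest, by simp, by simp⟩
    exact ((continuous_lapl htest.contDiff_two).integrable_of_hasCompactSupport
      (hasCompactSupport_lapl htest.2.1)).integrableOn
  obtain ⟨B, hB⟩ := htest.2.1.exists_bound_of_continuous huc.continuous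
  have hM := huN r₂ hr₁₂.le hr₂ρ.le
  set M := NstarV n V₁ τ₂ with hMdef
  have hMM : M₀ ≤ M := hr₂M
  have hM0 : 0 < M := hM₀.trans_le hMM
  have hdec : M ≤ decRearr n Ω u t := by
    refine le_decRearr hB ?_
    refine lt_of_lt_of_le ?_ (measure_mono (s := Metric.ball 0 r₂) fun x hx => ?_)
    · rw [volume_ball_eq hr₂]
      exact (ENNReal.ofReal_lt_ofReal_iff hτ₂0).2 htτ
    · have hx' : ‖x‖ < r₂ := mem_ball_zero_iff.1 hx
      exact ⟨hball (Metric.ball_subset_ball (by linarith) hx),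
        (hM x hx'.le).trans (le_abs_self _)⟩
  have hL2 : L1norm n Ω (lapl n u) ≤ 2 := by
    rw [L1norm, htest.setIntegral_abs_lapl]
    exact huL
  have hLne : L1norm n Ω (lapl n u) ≠ 0 := by
    intro h
    have := decRearr_le_of_nonneg hn hΩo hΩb hmem (Eventually.of_forall hu0) ht0 htV.le
    rw [h, zero_div, zero_mul] at this
    linarith
  have hL0 := (L1norm_nonneg n Ω (lapl n u)).lt_of_ne' hLne
  refine ⟨u, lapl n u, t, hmem, hur, hu0, hLne, ht0, htV.le, ?_⟩
  have hNV : NstarV n V t ≤ M + C + 1 := by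
    have := NstarV_add_NstarV hn hV hV₁0 hτ₂0
    linarith
  have hN0 : 0 < NstarV n V t := NstarV_pos hn ht0 htV
  refine (hM₀w M hMM).trans_le ?_
  have := hM0.le.trans hdec
  gcongr

/-- The rotation by the angle `θ` in the plane spanned by the orthonormal vectors `a` and `b`. -/
def planeRot {n : ℕ} (a b : Euc n) (θ : ℝ) : Euc n →ₗ[ℝ] Euc n where
  toFun x := x + ((Real.cos θ - 1) * inner ℝ a x - Real.sin θ * inner ℝ b x) • a +
    ((Real.cos θ - 1) * inner ℝ b x + Real.sin θ * inner ℝ a x) • b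
  map_add' x y := by
    simp only [inner_add_right]
    module
  map_smul' c x := by
    simp only [inner_smul_right, RingHom.id_apply]
    module

theorem planeRot_apply {n : ℕ} (a b : Euc n) (θ : ℝ) (x : Euc n) :
    planeRot a b θ x = x + ((Real.cos θ - 1) * inner ℝ a x - Real.sin θ * inner ℝ b x) • a +
      ((Real.cos θ - 1) * inner ℝ b x + Real.sin θ * inner ℝ a x) • b := rfl

/-- The infinitesimal generator of `planeRot a b`. -/
def planeGen {n : ℕ} (a b : Euc n) : Euc n →L[ℝ] Euc n :=
  (innerSL ℝ a).smulRight b - (innerSL ℝ b).smulRight a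

section

variable {n : ℕ} {a b : Euc n}

theorem inner_left_planeRot (ha : inner ℝ a a = (1 : ℝ)) (hab : inner ℝ a b = (0 : ℝ))
    (θ : ℝ) (x : Euc n) :
    inner ℝ a (planeRot a b θ x) = Real.cos θ * inner ℝ a x - Real.sin θ * inner ℝ b x := by
  rw [planeRot_apply, inner_add_right, inner_add_right, inner_smul_right, inner_smul_right, ha, hab]
  ring

theorem inner_right_planeRot (hb : inner ℝ b b = (1 : ℝ)) (hab : inner ℝ a b = (0 : ℝ))
    (θ : ℝ) (x : Euc n) :
    inner ℝ b (planeRot a b θ x) = Real.cos θ * inner ℝ b x + Real.sin θ * inner ℝ a x := by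
  rw [planeRot_apply, inner_add_right, inner_add_right, inner_smul_right, inner_smul_right, hb,
    real_inner_comm a b, hab]
  ring

theorem planeRot_add (ha : inner ℝ a a = (1 : ℝ)) (hb : inner ℝ b b = (1 : ℝ))
    (hab : inner ℝ a b = (0 : ℝ)) (s t : ℝ) (x : Euc n) :
    planeRot a b (s + t) x = planeRot a b s (planeRot a b t x) := by
  rw [planeRot_apply a b s, inner_left_planeRot ha hab, inner_right_planeRot hb hab,
    planeRot_apply, planeRot_apply, Real.cos_add, Real.sin_add]
  module

theorem norm_planeRot (ha : inner ℝ a a = (1 : ℝ)) (hb : inner ℝ b b = (1 : ℝ))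
    (hab : inner ℝ a b = (0 : ℝ)) (θ : ℝ) (x : Euc n) : ‖planeRot a b θ x‖ = ‖x‖ := by
  rw [← sq_eq_sq₀ (norm_nonneg _) (norm_nonneg _), ← real_inner_self_eq_norm_sq,
    ← real_inner_self_eq_norm_sq]
  nth_rewrite 2 [planeRot_apply]
  rw [inner_add_right, inner_add_right, inner_smul_right, inner_smul_right,
    real_inner_comm a, inner_left_planeRot ha hab, real_inner_comm b, inner_right_planeRot hb hab,
    real_inner_comm, planeRot_apply, inner_add_right, inner_add_right, inner_smul_right,
    inner_smul_right, real_inner_comm a x, real_inner_comm b x]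
  linear_combination (inner ℝ a x ^ 2 + inner ℝ b x ^ 2) * Real.sin_sq_add_cos_sq θ

theorem hasDerivAt_planeRot (ha : inner ℝ a a = (1 : ℝ)) (hb : inner ℝ b b = (1 : ℝ))
    (hab : inner ℝ a b = (0 : ℝ)) (θ : ℝ) (x : Euc n) :
    HasDerivAt (fun s => planeRot a b s x) (planeGen a b (planeRot a b θ x)) θ := by
  have h : planeGen a b (planeRot a b θ x) =
      (-Real.sin θ * inner ℝ a x - Real.cos θ * inner ℝ b x) • a +
        (-Real.sin θ * inner ℝ b x + Real.cos θ * inner ℝ a x) • b := by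
    change inner ℝ a (planeRot a b θ x) • b - inner ℝ b (planeRot a b θ x) • a = _
    rw [inner_left_planeRot ha hab, inner_right_planeRot hb hab]
    module
  rw [h]
  have hc := ((Real.hasDerivAt_cos θ).sub_const 1)
  have hs := Real.hasDerivAt_sin θ
  exact ((((hc.mul_const _).sub (hs.mul_const _)).smul_const a).const_add x).add
    (((hc.mul_const _).add (hs.mul_const _)).smul_const b)

theorem continuous_planeRot (a b : Euc n) :
    Continuous fun p : ℝ × Euc n => planeRot a b p.1 p.2 := by
  simp only [planeRot_apply]
  fun_prop

theorem measurePreserving_planeRot (ha : inner ℝ a a = (1 : ℝ)) (hb : inner ℝ b b = (1 : ℝ))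
    (hab : inner ℝ a b = (0 : ℝ)) (θ : ℝ) : MeasurePreserving (planeRot a b θ) :=
  LinearIsometryEquiv.measurePreserving
    (LinearIsometry.toLinearIsometryEquiv ⟨planeRot a b θ, norm_planeRot ha hb hab θ⟩ rfl)

theorem planeRot_zero (x : Euc n) : planeRot a b 0 x = x := by
  simp [planeRot_apply]

end

theorem exists_unit_orthogonal {n : ℕ} (hn : 2 ≤ n) (a : Euc n) :
    ∃ b : Euc n, ‖b‖ = 1 ∧ inner ℝ a b = (0 : ℝ) := by
  have h1 : Module.finrank ℝ (ℝ ∙ a) ≤ 1 :=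
    (finrank_span_le_card ({a} : Set (Euc n))).trans (by simp)
  have h2 := (ℝ ∙ a).finrank_add_finrank_orthogonal
  rw [finrank_euclideanSpace_fin] at h2
  have : Nontrivial (ℝ ∙ a)ᗮ := Module.nontrivial_of_finrank_pos (R := ℝ) (by omega)
  obtain ⟨⟨z, hz⟩, hz0⟩ := exists_ne (0 : (ℝ ∙ a)ᗮ)
  have hz0 : z ≠ 0 := fun h => hz0 (Subtype.ext h)
  refine ⟨‖z‖⁻¹ • z, norm_smul_inv_norm hz0, ?_⟩
  rw [inner_smul_right, Submodule.mem_orthogonal_singleton_iff_inner_right.1 hz, mul_zero]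

theorem exists_unit_orthogonal_decomposition {n : ℕ} (hn : 2 ≤ n) {a : Euc n} (ha : ‖a‖ = 1)
    (y : Euc n) : ∃ b : Euc n, ‖b‖ = 1 ∧ inner ℝ a b = (0 : ℝ) ∧ ∃ c s : ℝ, y = c • a + s • b := by
  set z := y - inner ℝ a y • a with hz
  have haz : inner ℝ a z = (0 : ℝ) := by
    rw [hz, inner_sub_right, inner_smul_right, real_inner_self_eq_norm_sq, ha]
    ring
  by_cases hz0 : z = 0
  · obtain ⟨b, hb, hab⟩ := exists_unit_orthogonal hn a
    refine ⟨b, hb, hab, inner ℝ a y, 0, ?_⟩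
    rw [zero_smul, add_zero]
    exact sub_eq_zero.1 hz0
  · refine ⟨‖z‖⁻¹ • z, norm_smul_inv_norm hz0, ?_, inner ℝ a y, ‖z‖, ?_⟩
    · rw [inner_smul_right, haz, mul_zero]
    · rw [smul_inv_smul₀ (norm_ne_zero_iff.2 hz0), hz]
      module

theorem exists_planeRot_eq {n : ℕ} (hn : 2 ≤ n) {x y : Euc n} (h : ‖x‖ = ‖y‖) :
    ∃ a b : Euc n, inner ℝ a a = (1 : ℝ) ∧ inner ℝ b b = (1 : ℝ) ∧ inner ℝ a b = (0 : ℝ) ∧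
      ∃ θ, 0 < θ ∧ planeRot a b θ x = y := by
  have key : ∃ a : Euc n, ‖a‖ = 1 ∧ x = ‖x‖ • a := by
    by_cases hx : x = 0
    · obtain ⟨a, ha, -⟩ := exists_unit_orthogonal hn 0
      exact ⟨a, ha, by simp [hx]⟩
    · exact ⟨‖x‖⁻¹ • x, norm_smul_inv_norm hx, (smul_inv_smul₀ (norm_ne_zero_iff.2 hx) x).symm⟩
  obtain ⟨a, ha, hxa⟩ := key
  obtain ⟨b, hb, hab, c, s, hy⟩ := exists_unit_orthogonal_decomposition hn ha y
  have ha' : inner ℝ a a = (1 : ℝ) := by rw [real_inner_self_eq_norm_sq, ha, one_pow]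
  have hb' : inner ℝ b b = (1 : ℝ) := by rw [real_inner_self_eq_norm_sq, hb, one_pow]
  refine ⟨a, b, ha', hb', hab, ?_⟩
  set r := ‖x‖ with hr
  have hcs : c ^ 2 + s ^ 2 = r ^ 2 := by
    rw [h, ← real_inner_self_eq_norm_sq, hy, inner_add_left, inner_add_right, inner_add_right]
    simp only [inner_smul_left, inner_smul_right, ha', hb', hab, real_inner_comm a b]
    simp
    ring
  obtain ⟨θ, hθ, hc, hs⟩ : ∃ θ, 0 < θ ∧ c = r * Real.cos θ ∧ s = r * Real.sin θ := by
    by_cases hr0 : r = 0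
    · refine ⟨1, one_pos, ?_, ?_⟩ <;> rw [hr0, zero_mul] <;> nlinarith
    · have hz : ‖(⟨c, s⟩ : ℂ)‖ = r := by
        rw [← sq_eq_sq₀ (norm_nonneg _) (norm_nonneg _), ← Complex.normSq_eq_norm_sq,
          Complex.normSq_mk, ← hcs]
        ring
      have hz0 : (⟨c, s⟩ : ℂ) ≠ 0 := fun h0 => hr0 (by rw [← hz, h0, norm_zero])
      refine ⟨Complex.arg ⟨c, s⟩ + 2 * Real.pi, ?_, ?_, ?_⟩
      · have := Complex.neg_pi_lt_arg ⟨c, s⟩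
        have := Real.pi_pos
        linarith
      · rw [Real.cos_add_two_pi, Complex.cos_arg hz0, hz, mul_div_cancel₀ _ hr0]
      · rw [Real.sin_add_two_pi, Complex.sin_arg, hz, mul_div_cancel₀ _ hr0]
  refine ⟨θ, hθ, ?_⟩
  have e1 : inner ℝ a x = r := by rw [hxa, inner_smul_right, ha', mul_one]
  have e2 : inner ℝ b x = (0 : ℝ) := by
    rw [hxa, inner_smul_right, real_inner_comm a b, hab, mul_zero]
  rw [planeRot_apply, e1, e2, hy, hc, hs]
  nth_rewrite 1 [hxa]
  module

theorem integral_sq_fderiv_arctan_le {n : ℕ} {φ : Euc n → ℝ} (hφ : ContDiff ℝ 2 φ)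
    (hc : HasCompactSupport φ) {R : ℝ} (hR : tsupport φ ⊆ Metric.closedBall 0 R)
    (J : Euc n →L[ℝ] Euc n) :
    ∫ x, (fderiv ℝ (fun y => Real.arctan (φ y)) x (J x)) ^ 2 ≤
      (‖J‖ * R) ^ 2 * (2 * ∫ x, |lapl n φ x|) := by
  have hd := hφ.differentiable two_ne_zero
  have hfd : ∀ x, HasFDerivAt (fun y => Real.arctan (φ y))
      ((1 / (1 + φ x ^ 2)) • fderiv ℝ φ x) x := fun x => (hd x).hasFDerivAt.arctan
  have hw : ContDiff ℝ 1 fun y => Real.arctan (φ y) :=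
    Real.contDiff_arctan.comp (hφ.of_le one_le_two)
  have hf : ∀ x e, fderiv ℝ (fun y => Real.arctan (φ y)) x e = 1 / (1 + φ x ^ 2) * fderiv ℝ φ x e := by
    intro x e
    rw [(hfd x).fderiv]
    rfl
  set G : Euc n → ℝ := fun x => ∑ i : Fin n, fderiv ℝ (fun y => Real.arctan (φ y)) x (stdVec i) *
    fderiv ℝ φ x (stdVec i) with hG
  have hGeq : ∀ x, G x = 1 / (1 + φ x ^ 2) * ‖fderiv ℝ φ x‖ ^ 2 := by
    intro x
    rw [hG, ← sum_sq_apply_stdVec, Finset.mul_sum]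
    refine Finset.sum_congr rfl fun i _ => ?_
    rw [hf]
    ring
  have hGc : Continuous G := by
    refine continuous_finsetSum _ fun i _ => ?_
    exact ((hw.continuous_fderiv one_ne_zero).clm_apply continuous_const).mul
      ((hφ.continuous_fderiv two_ne_zero).clm_apply continuous_const)
  have hGs : HasCompactSupport G := by
    refine (hc.fderiv (𝕜 := ℝ)).mono fun x hx => ?_
    intro h0
    refine hx ?_
    rw [hGeq, h0]
    simp
  have hGi : Integrable G := hGc.integrable_of_hasCompactSupport hGs
  have hGint : ∫ x, G x ≤ 2 * ∫ x, |lapl n φ x| := by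
    have h1 := integral_mul_lapl hφ hc hw
    have h2 : ∫ x, G x = -∫ x, Real.arctan (φ x) * lapl n φ x := by rw [h1, neg_neg]
    rw [h2, ← integral_neg, ← integral_const_mul]
    refine integral_mono ?_ ((integrable_lapl hφ hc).abs.const_mul 2) fun x => ?_
    · refine Integrable.neg (Continuous.integrable_of_hasCompactSupport
        (hw.continuous.mul (continuous_lapl hφ)) (hasCompactSupport_lapl hc).mul_left)
    · have h3 : |Real.arctan (φ x)| ≤ 2 := by
        have := Real.arctan_lt_pi_div_two (φ x)
        have := Real.neg_pi_div_two_lt_arctan (φ x)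
        have := Real.pi_le_four
        rw [abs_le]
        constructor <;> linarith
      refine (neg_le_abs _).trans ?_
      rw [abs_mul]
      exact mul_le_mul_of_nonneg_right h3 (abs_nonneg _)
  refine le_trans ?_ (mul_le_mul_of_nonneg_left hGint (sq_nonneg _))
  rw [← integral_const_mul]
  refine integral_mono_of_nonneg (ae_of_all _ fun x => sq_nonneg _) (hGi.const_mul _)
    (ae_of_all _ fun x => ?_)
  have hG0 : 0 ≤ G x := by rw [hGeq]; positivity
  by_cases hx : x ∈ tsupport φ
  · have hxR : ‖x‖ ≤ R := mem_closedBall_zero_iff.1 (hR hx)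
    have hR0 : 0 ≤ R := (norm_nonneg x).trans hxR
    have h1 : |fderiv ℝ φ x (J x)| ≤ ‖fderiv ℝ φ x‖ * (‖J‖ * R) :=
      ((fderiv ℝ φ x).le_opNorm _).trans (mul_le_mul_of_nonneg_left
        ((J.le_opNorm x).trans (mul_le_mul_of_nonneg_left hxR (norm_nonneg _))) (norm_nonneg _))
    have h2 : fderiv ℝ φ x (J x) ^ 2 ≤ ‖fderiv ℝ φ x‖ ^ 2 * (‖J‖ * R) ^ 2 := by
      rw [← sq_abs, ← mul_pow]
      exact pow_le_pow_left₀ (abs_nonneg _) h1 2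
    have h3 : 1 / (1 + φ x ^ 2) ≤ 1 := by
      rw [div_le_one (by positivity)]
      nlinarith [sq_nonneg (φ x)]
    have h4 : 0 ≤ 1 / (1 + φ x ^ 2) := by positivity
    change fderiv ℝ (fun y => Real.arctan (φ y)) x (J x) ^ 2 ≤ (‖J‖ * R) ^ 2 * G x
    rw [hf, hGeq, mul_pow]
    calc (1 / (1 + φ x ^ 2)) ^ 2 * fderiv ℝ φ x (J x) ^ 2
        ≤ (1 / (1 + φ x ^ 2) * 1) * (‖fderiv ℝ φ x‖ ^ 2 * (‖J‖ * R) ^ 2) := by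
          rw [sq (1 / (1 + φ x ^ 2))]
          gcongr
      _ = _ := by ring
  · have : fderiv ℝ φ x = 0 := by
      by_contra h
      exact hx (support_fderiv_subset ℝ h)
    change fderiv ℝ (fun y => Real.arctan (φ y)) x (J x) ^ 2 ≤ (‖J‖ * R) ^ 2 * G x
    rw [hf, this]
    simpa using mul_nonneg (sq_nonneg _) hG0

theorem measurableEmbedding_planeRot {n : ℕ} {a b : Euc n} (ha : inner ℝ a a = (1 : ℝ))
    (hb : inner ℝ b b = (1 : ℝ)) (hab : inner ℝ a b = (0 : ℝ)) (θ : ℝ) :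
    MeasurableEmbedding (planeRot a b θ) :=
  (LinearIsometry.toLinearIsometryEquiv ⟨planeRot a b θ, norm_planeRot ha hb hab θ⟩
    rfl).toHomeomorph.measurableEmbedding

theorem sq_intervalIntegral_le {h : ℝ → ℝ} (hh : Continuous h) {θ : ℝ} (hθ : 0 < θ) :
    (∫ s in (0 : ℝ)..θ, h s) ^ 2 ≤ θ * ∫ s in (0 : ℝ)..θ, h s ^ 2 := by
  set I := ∫ s in (0 : ℝ)..θ, h s with hI
  have h0 : 0 ≤ ∫ s in (0 : ℝ)..θ, (h s - I / θ) ^ 2 :=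
    intervalIntegral.integral_nonneg hθ.le fun s _ => sq_nonneg _
  have h1 : ∫ s in (0 : ℝ)..θ, (h s - I / θ) ^ 2 =
      ∫ s in (0 : ℝ)..θ, (h s ^ 2 - 2 * (I / θ) * h s + (I / θ) ^ 2) := by
    congr 1
    ext s
    ring
  rw [h1, intervalIntegral.integral_add, intervalIntegral.integral_sub,
    intervalIntegral.integral_const_mul, ← hI, intervalIntegral.integral_const] at h0
  · have h2 : (∫ s in (0 : ℝ)..θ, h s ^ 2) - 2 * (I / θ) * I + (θ - 0) • (I / θ) ^ 2 =
        (∫ s in (0 : ℝ)..θ, h s ^ 2) - I ^ 2 / θ := by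
      rw [smul_eq_mul]
      field_simp
      ring
    rw [h2, sub_nonneg, div_le_iff₀ hθ] at h0
    linarith
  all_goals exact Continuous.intervalIntegrable (by fun_prop) _ _

theorem integral_sq_comp_planeRot_sub_le {n : ℕ} {a b : Euc n} (ha : inner ℝ a a = (1 : ℝ))
    (hb : inner ℝ b b = (1 : ℝ)) (hab : inner ℝ a b = (0 : ℝ)) {v : Euc n → ℝ}
    (hv : ContDiff ℝ 1 v) (hc : HasCompactSupport v) {θ : ℝ} (hθ : 0 < θ) :
    ∫ x, (v (planeRot a b θ x) - v x) ^ 2 ≤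
      θ ^ 2 * ∫ x, (fderiv ℝ v x (planeGen a b x)) ^ 2 := by
  set D : Euc n → ℝ := fun x => fderiv ℝ v x (planeGen a b x) with hD
  have hDc : Continuous D :=
    (hv.continuous_fderiv one_ne_zero).clm_apply (planeGen a b).continuous
  obtain ⟨R, hR⟩ := hc.isCompact.isBounded.subset_closedBall (0 : Euc n)
  have hD0 : ∀ x, x ∉ Metric.closedBall (0 : Euc n) R → D x = 0 := by
    intro x hx
    have : fderiv ℝ v x = 0 := by
      by_contra h
      exact hx (hR (support_fderiv_subset ℝ h))
    simp [hD, this]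
  have hAc := continuous_planeRot a b
  have hcs : ∀ x, Continuous fun s => planeRot a b s x := fun x =>
    continuous_iff_continuousAt.2 fun s => (hasDerivAt_planeRot ha hb hab s x).continuousAt
  have hftc : ∀ x, v (planeRot a b θ x) - v x = ∫ s in (0 : ℝ)..θ, D (planeRot a b s x) := by
    intro x
    have h1 : ∀ s ∈ Set.uIcc 0 θ, HasDerivAt (fun s => v (planeRot a b s x))
        (D (planeRot a b s x)) s := fun s _ =>
      (hv.differentiable one_ne_zero _).hasFDerivAt.comp_hasDerivAt s
        (hasDerivAt_planeRot ha hb hab s x)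
    rw [intervalIntegral.integral_eq_sub_of_hasDerivAt h1
      ((hDc.comp (hcs x)).intervalIntegrable _ _), planeRot_zero]
  set ν : Measure ℝ := volume.restrict (Set.Ioc 0 θ) with hν
  set K : ℝ → Euc n → ℝ := fun s x => D (planeRot a b s x) ^ 2 with hK
  have hKc : Continuous (Function.uncurry K) := (hDc.comp hAc).pow 2
  have hKi : Integrable (Function.uncurry K) (ν.prod volume) := by
    have e : ν.prod volume = ((volume : Measure ℝ).prod (volume : Measure (Euc n))).restrict
        (Set.Ioc 0 θ ×ˢ Set.univ) := by
      rw [← Measure.prod_restrict, Measure.restrict_univ]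
    rw [e]
    have h1 : IntegrableOn (Function.uncurry K) (Set.Icc 0 θ ×ˢ Metric.closedBall 0 R)
        ((volume : Measure ℝ).prod (volume : Measure (Euc n))) :=
      hKc.continuousOn.integrableOn_compact (isCompact_Icc.prod (isCompact_closedBall _ _))
    refine IntegrableOn.of_forall_sdiff_eq_zero
      (h1.mono_set (Set.prod_mono Set.Ioc_subset_Icc_self subset_rfl))
      (measurableSet_Ioc.prod MeasurableSet.univ) ?_
    rintro ⟨s, x⟩ ⟨⟨hs, -⟩, hx⟩
    have hx : x ∉ Metric.closedBall (0 : Euc n) R := fun h => hx ⟨hs, h⟩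
    have : D (planeRot a b s x) = 0 := hD0 _ (by
      rwa [mem_closedBall_zero_iff, norm_planeRot ha hb hab, ← mem_closedBall_zero_iff])
    simp [hK, this]
  have hle : ∀ x, (v (planeRot a b θ x) - v x) ^ 2 ≤ θ * ∫ s, K s x ∂ν := by
    intro x
    rw [hftc, hν, ← intervalIntegral.integral_of_le hθ.le]
    exact sq_intervalIntegral_le (hDc.comp (hcs x)) hθ
  calc ∫ x, (v (planeRot a b θ x) - v x) ^ 2 ≤ ∫ x, θ * ∫ s, K s x ∂ν :=
        integral_mono_of_nonneg (ae_of_all _ fun x => sq_nonneg _)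
          (hKi.swap.integral_prod_left.const_mul θ) (ae_of_all _ hle)
    _ = θ * ∫ s, (∫ x, K s x) ∂ν := by rw [integral_const_mul, integral_integral_swap hKi]
    _ = θ * ∫ s, (∫ x, D x ^ 2) ∂ν := by
        congr 2
        ext s
        exact (measurePreserving_planeRot ha hb hab s).integral_comp
          (measurableEmbedding_planeRot ha hb hab s) fun x => D x ^ 2
    _ = θ ^ 2 * ∫ x, D x ^ 2 := by
        rw [integral_const, hν, measureReal_restrict_apply_univ, Real.volume_real_Ioc_of_le hθ.le,
          smul_eq_mul]
        ring

theorem abs_arctan_sub_arctan_le (x y : ℝ) : |Real.arctan x - Real.arctan y| ≤ |x - y| := by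
  have h : ∀ z : ℝ, ‖deriv Real.arctan z‖₊ ≤ 1 := by
    intro z
    rw [Real.deriv_arctan, ← NNReal.coe_le_coe, coe_nnnorm, Real.norm_eq_abs,
      abs_of_nonneg (by positivity), NNReal.coe_one, div_le_one (by positivity)]
    nlinarith [sq_nonneg z]
  have := (lipschitzWith_of_nnnorm_deriv_le Real.differentiable_arctan h).dist_le_mul x y
  simpa [Real.dist_eq] using this

section

variable {n : ℕ} {a b : Euc n} {Ω : Set (Euc n)}

theorem tendsto_measureReal_symmDiff_planeRot (ha : inner ℝ a a = (1 : ℝ))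
    (hb : inner ℝ b b = (1 : ℝ)) (hab : inner ℝ a b = (0 : ℝ)) (hΩo : IsOpen Ω)
    (hΩf : volume Ω ≠ ⊤) {s : ℕ → ℝ} (hs : Tendsto s atTop (𝓝 0)) :
    Tendsto (fun k => volume.real (symmDiff Ω (planeRot a b (s k) ⁻¹' Ω))) atTop (𝓝 0) := by
  have hm : ∀ θ, MeasurableSet (planeRot a b θ ⁻¹' Ω) := fun θ =>
    (measurePreserving_planeRot ha hb hab θ).measurable hΩo.measurableSet
  have hv : ∀ θ, volume (planeRot a b θ ⁻¹' Ω) = volume Ω := fun θ =>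
    (measurePreserving_planeRot ha hb hab θ).measure_preimage hΩo.measurableSet.nullMeasurableSet
  have hv' : ∀ θ, volume.real (planeRot a b θ ⁻¹' Ω) = volume.real Ω := fun θ => by
    rw [Measure.real, hv, Measure.real]
  have h1 : Tendsto (fun k => volume (Ω \ planeRot a b (s k) ⁻¹' Ω)) atTop (𝓝 0) := by
    rw [← measure_empty (μ := (volume : Measure (Euc n)))]
    refine tendsto_measure_of_tendsto_indicator atTop
      (fun k => hΩo.measurableSet.diff (hm _)) hΩo.measurableSet hΩf
      (Eventually.of_forall fun k => Set.sdiff_subset) fun x => ?_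
    by_cases hx : x ∈ Ω
    · have e : Tendsto (fun k => planeRot a b (s k) x) atTop (𝓝 x) := by
        have := (hasDerivAt_planeRot ha hb hab 0 x).continuousAt.tendsto.comp hs
        rwa [planeRot_zero] at this
      filter_upwards [e.eventually (hΩo.mem_nhds hx)] with k hk
      simp only [Set.mem_empty_iff_false, iff_false]
      exact fun h => h.2 hk
    · exact Eventually.of_forall fun k => by simp [hx]
  have h2 : Tendsto (fun k => volume.real (Ω \ planeRot a b (s k) ⁻¹' Ω)) atTop (𝓝 0) := by
    have := (ENNReal.tendsto_toReal ENNReal.zero_ne_top).comp h1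
    rw [ENNReal.toReal_zero] at this
    exact this
  have h3 : ∀ θ, volume.real (symmDiff Ω (planeRot a b θ ⁻¹' Ω)) ≤
      2 * volume.real (Ω \ planeRot a b θ ⁻¹' Ω) := by
    intro θ
    have e1 := measureReal_inter_add_sdiff (μ := volume) (s := Ω) (hm θ) hΩf
    have e2 := measureReal_inter_add_sdiff (μ := volume) (s := planeRot a b θ ⁻¹' Ω)
      hΩo.measurableSet (by rw [hv]; exact hΩf)
    rw [Set.inter_comm, hv'] at e2
    have e3 := measureReal_union_le (μ := volume) (Ω \ planeRot a b θ ⁻¹' Ω)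
      (planeRot a b θ ⁻¹' Ω \ Ω)
    rw [Set.symmDiff_def]
    linarith
  refine squeeze_zero (fun k => measureReal_nonneg) (fun k => h3 _) ?_
  simpa using h2.const_mul 2

theorem integral_abs_comp_planeRot_nat_mul_le (ha : inner ℝ a a = (1 : ℝ))
    (hb : inner ℝ b b = (1 : ℝ)) (hab : inner ℝ a b = (0 : ℝ)) {v : Euc n → ℝ}
    (hv : Integrable v) (θ : ℝ) (N : ℕ) :
    ∫ x, |v (planeRot a b (N * θ) x) - v x| ≤ N * ∫ x, |v (planeRot a b θ x) - v x| := by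
  have hi : ∀ s, Integrable fun x => |v (planeRot a b s x) - v x| := fun s =>
    (((measurePreserving_planeRot ha hb hab s).integrable_comp_of_integrable hv).sub hv).abs
  induction N with
  | zero => simp [planeRot_zero]
  | succ N ih =>
    have h1 : ∫ x, |v (planeRot a b (N * θ) (planeRot a b θ x)) - v (planeRot a b θ x)| =
        ∫ x, |v (planeRot a b (N * θ) x) - v x| :=
      (measurePreserving_planeRot ha hb hab θ).integral_comp
        (measurableEmbedding_planeRot ha hb hab θ) fun x => |v (planeRot a b (N * θ) x) - v x|
    have h1i : Integrable fun x =>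
        |v (planeRot a b (N * θ) (planeRot a b θ x)) - v (planeRot a b θ x)| :=
      (measurePreserving_planeRot ha hb hab θ).integrable_comp_of_integrable (hi (N * θ))
    calc ∫ x, |v (planeRot a b ((N + 1 : ℕ) * θ) x) - v x|
        ≤ ∫ x, (|v (planeRot a b (N * θ) (planeRot a b θ x)) - v (planeRot a b θ x)| +
            |v (planeRot a b θ x) - v x|) := by
          refine integral_mono (hi _) (h1i.add (hi θ)) fun x => ?_
          rw [Nat.cast_succ, add_mul, one_mul, planeRot_add ha hb hab]
          exact abs_sub_le _ _ _
      _ = (∫ x, |v (planeRot a b (N * θ) x) - v x|) + ∫ x, |v (planeRot a b θ x) - v x| := by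
          rw [integral_add h1i (hi θ), h1]
      _ ≤ _ := by
          push_cast
          linarith

end

section

variable {n : ℕ} {a b : Euc n}

theorem integral_abs_arctan_comp_planeRot_sub_le (ha : inner ℝ a a = (1 : ℝ))
    (hb : inner ℝ b b = (1 : ℝ)) (hab : inner ℝ a b = (0 : ℝ)) {U : Euc n → ℝ}
    (hU : Integrable U) {φ : ℕ → Euc n → ℝ} (hφ : ∀ k, ContDiff ℝ 2 (φ k))
    (hc : ∀ k, HasCompactSupport (φ k)) {R : ℝ}
    (hR : ∀ k, tsupport (φ k) ⊆ Metric.closedBall 0 R) {M : ℝ}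
    (hM : ∀ k, ∫ x, |lapl n (φ k) x| ≤ M)
    (hlim : Tendsto (fun k => ∫ x, |φ k x - U x|) atTop (𝓝 0)) {D : Set (Euc n)}
    (hDm : MeasurableSet D) (hDf : volume D ≠ ⊤) {θ μ : ℝ} (hθ : 0 < θ) (hμ : 0 < μ)
    (hD : ∀ x ∉ D, U (planeRot a b θ x) = U x) :
    ∫ x, |Real.arctan (U (planeRot a b θ x)) - Real.arctan (U x)| ≤
      θ / 2 * (μ * volume.real D + (‖planeGen a b‖ * R) ^ 2 * (2 * M) / μ) := by
  have hmp := measurePreserving_planeRot ha hb hab θ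
  set A := planeRot a b θ with hA
  set C0 := (‖planeGen a b‖ * R) ^ 2 * (2 * M) with hC0
  have hφi : ∀ k, Integrable (φ k) := fun k =>
    (hφ k).continuous.integrable_of_hasCompactSupport (hc k)
  have hvc : ∀ k, Continuous fun x => Real.arctan (φ k x) := fun k =>
    Real.continuous_arctan.comp (hφ k).continuous
  have hvs : ∀ k, HasCompactSupport fun x => Real.arctan (φ k x) := fun k =>
    (hc k).comp_left Real.arctan_zero
  have hd : ∀ k, Integrable fun x => |φ k x - U x| := fun k => ((hφi k).sub hU).abs
  have hdA : ∀ k, Integrable fun x => |φ k (A x) - U (A x)| := fun k =>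
    hmp.integrable_comp_of_integrable (hd k)
  have hdAe : ∀ k, ∫ x, |φ k (A x) - U (A x)| = ∫ x, |φ k x - U x| := fun k =>
    hmp.integral_comp (measurableEmbedding_planeRot ha hb hab θ) fun x => |φ k x - U x|
  have hsq : ∀ k, Integrable fun x => (Real.arctan (φ k (A x)) - Real.arctan (φ k x)) ^ 2 := by
    intro k
    have h2 : MemLp (fun x => Real.arctan (φ k x)) 2 volume :=
      (hvc k).memLp_of_hasCompactSupport (hvs k)
    exact ((h2.comp_measurePreserving hmp).sub h2).integrable_sq
  have hsqle : ∀ k, ∫ x, (Real.arctan (φ k (A x)) - Real.arctan (φ k x)) ^ 2 ≤ θ ^ 2 * C0 := by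
    intro k
    refine (integral_sq_comp_planeRot_sub_le ha hb hab
      (v := fun x => Real.arctan (φ k x)) ?_ (hvs k) hθ).trans ?_
    · exact (Real.contDiff_arctan.comp (hφ k)).of_le one_le_two
    · refine mul_le_mul_of_nonneg_left ?_ (sq_nonneg _)
      refine (integral_sq_fderiv_arctan_le (hφ k) (hc k) (hR k) (planeGen a b)).trans ?_
      refine mul_le_mul_of_nonneg_left ?_ (sq_nonneg _)
      linarith [hM k]
  have hind : Integrable (D.indicator fun _ : Euc n => θ * μ / 2) :=
    (integrable_indicator_iff hDm).2 (integrableOn_const hDf)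
  have hk : ∀ k, ∫ x, |Real.arctan (U (A x)) - Real.arctan (U x)| ≤
      (volume.real D * (θ * μ / 2) + θ ^ 2 * C0 / (2 * θ * μ)) +
        (∫ x, |φ k x - U x|) + ∫ x, |φ k x - U x| := by
    intro k
    have hi0 : Integrable fun x =>
        (Real.arctan (φ k (A x)) - Real.arctan (φ k x)) ^ 2 / (2 * θ * μ) := (hsq k).div_const _
    have hi1 : Integrable fun x => D.indicator (fun _ => θ * μ / 2) x +
        (Real.arctan (φ k (A x)) - Real.arctan (φ k x)) ^ 2 / (2 * θ * μ) := hind.add hi0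
    have hi2 : Integrable fun x => (D.indicator (fun _ => θ * μ / 2) x +
        (Real.arctan (φ k (A x)) - Real.arctan (φ k x)) ^ 2 / (2 * θ * μ)) +
        |φ k (A x) - U (A x)| := hi1.add (hdA k)
    calc ∫ x, |Real.arctan (U (A x)) - Real.arctan (U x)|
        ≤ ∫ x, (((D.indicator (fun _ => θ * μ / 2) x +
          (Real.arctan (φ k (A x)) - Real.arctan (φ k x)) ^ 2 / (2 * θ * μ)) +
          |φ k (A x) - U (A x)|) + |φ k x - U x|) := by
          refine integral_mono_of_nonneg (Eventually.of_forall fun x => abs_nonneg _)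
            (hi2.add (hd k))
            (Eventually.of_forall fun x => ?_)
          change |Real.arctan (U (A x)) - Real.arctan (U x)| ≤ _
          beta_reduce
          by_cases hx : x ∈ D
          · rw [Set.indicator_of_mem hx]
            set d := Real.arctan (φ k (A x)) - Real.arctan (φ k x) with hdd
            have h1 := abs_arctan_sub_arctan_le (φ k (A x)) (U (A x))
            have h2 := abs_arctan_sub_arctan_le (φ k x) (U x)
            have h3 : |d| ≤ θ * μ / 2 + d ^ 2 / (2 * θ * μ) := by
              have h4 : 0 ≤ (θ * μ - |d|) ^ 2 / (2 * θ * μ) := by positivity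
              have h5 : (θ * μ - |d|) ^ 2 / (2 * θ * μ) =
                  θ * μ / 2 + d ^ 2 / (2 * θ * μ) - |d| := by
                rw [← sq_abs d]
                field_simp
                ring
              linarith
            have h6 : |Real.arctan (U (A x)) - Real.arctan (U x)| ≤
                |d| + |Real.arctan (φ k (A x)) - Real.arctan (U (A x))| +
                |Real.arctan (φ k x) - Real.arctan (U x)| := by
              rw [abs_le]
              have e1 := abs_le.1 (le_refl |d|)
              have e2 := abs_le.1 (le_refl |Real.arctan (φ k (A x)) - Real.arctan (U (A x))|)
              have e3 := abs_le.1 (le_refl |Real.arctan (φ k x) - Real.arctan (U x)|)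
              constructor <;> linarith [e1.1, e1.2, e2.1, e2.2, e3.1, e3.2]
            linarith
          · rw [hD x hx, sub_self, abs_zero, Set.indicator_of_notMem hx]
            positivity
      _ = ((∫ x, D.indicator (fun _ => θ * μ / 2) x) +
          (∫ x, (Real.arctan (φ k (A x)) - Real.arctan (φ k x)) ^ 2) / (2 * θ * μ)) +
          (∫ x, |φ k (A x) - U (A x)|) + ∫ x, |φ k x - U x| := by
          rw [integral_add hi2 (hd k), integral_add hi1 (hdA k), integral_add hind hi0, integral_div]
      _ ≤ _ := by
          rw [hdAe, integral_indicator_const _ hDm, smul_eq_mul]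
          gcongr
          exact hsqle k
  have hl := (tendsto_const_nhds (x := volume.real D * (θ * μ / 2) + θ ^ 2 * C0 / (2 * θ * μ))
    |>.add hlim).add hlim
  have := ge_of_tendsto' hl hk
  refine this.trans (le_of_eq ?_)
  field_simp
  ring

end

section

variable {n : ℕ} {Ω : Set (Euc n)}

theorem IsTestFun.integral_abs_sub_indicator (hΩo : IsOpen Ω) {φ : Euc n → ℝ}
    (hφ : IsTestFun n Ω φ) (u : Euc n → ℝ) :
    ∫ x, |φ x - Ω.indicator u x| = ∫ x in Ω, |φ x - u x| := by
  rw [← integral_indicator hΩo.measurableSet]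
  congr 1
  ext x
  by_cases hx : x ∈ Ω
  · simp [hx]
  · simp [hx, image_eq_zero_of_notMem_tsupport fun h => hx (hφ.2.2 h)]

theorem IsTestFun.integral_abs_lapl_sub_indicator (hΩo : IsOpen Ω) {φ : Euc n → ℝ}
    (hφ : IsTestFun n Ω φ) (f : Euc n → ℝ) :
    ∫ x, |lapl n φ x - Ω.indicator f x| = ∫ x in Ω, |lapl n φ x - f x| := by
  rw [← integral_indicator hΩo.measurableSet]
  congr 1
  ext x
  by_cases hx : x ∈ Ω
  · simp [hx]
  · have : lapl n φ x = 0 := by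
      by_contra h0
      exact hx (hφ.2.2 (support_lapl_subset φ h0))
    simp [hx, this]

/-- Radial elements of `W^{2,1}_{Δ,0}(Ω)`, extended by zero outside `Ω`, are invariant under
rotations. -/
theorem ae_indicator_comp_planeRot_eq (hΩo : IsOpen Ω) (hΩb : Bornology.IsBounded Ω)
    {u f : Euc n → ℝ} (hu : MemW21Delta0 n Ω u f) {g : ℝ → ℝ} (hg : ∀ x, u x = g ‖x‖)
    {a b : Euc n} (ha : inner ℝ a a = (1 : ℝ)) (hb : inner ℝ b b = (1 : ℝ))
    (hab : inner ℝ a b = (0 : ℝ)) {θ : ℝ} (hθ : 0 < θ) :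
    ∀ᵐ x, Ω.indicator u (planeRot a b θ x) = Ω.indicator u x := by
  obtain ⟨hui, hfi, φ, hφ, hφu, hφf⟩ := hu
  set U := Ω.indicator u with hUdef
  have hU : Integrable U := (integrable_indicator_iff hΩo.measurableSet).2 hui
  have hΩf : volume Ω ≠ ⊤ := hΩb.measure_lt_top.ne
  obtain ⟨R, hR⟩ := hΩb.subset_closedBall 0
  obtain ⟨M, hM⟩ : ∃ M, ∀ k, ∫ x, |lapl n (φ k) x| ≤ M := by
    have hlim := tendsto_integral_abs_of_tendsto
      (fun k => (integrable_lapl (hφ k).contDiff_two (hφ k).2.1).integrableOn) hfi hφf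
    obtain ⟨M, hM⟩ := hlim.bddAbove_range
    refine ⟨M, fun k => ?_⟩
    rw [← (hφ k).setIntegral_abs_lapl]
    exact hM ⟨k, rfl⟩
  have hlim : Tendsto (fun k => ∫ x, |φ k x - U x|) atTop (𝓝 0) := by
    simpa only [hUdef, (hφ _).integral_abs_sub_indicator hΩo] using hφu
  set v : Euc n → ℝ := fun x => Real.arctan (U x) with hv
  have hvi : Integrable v := by
    refine hU.mono (Real.continuous_arctan.comp_aestronglyMeasurable hU.1)
      (Eventually.of_forall fun x => ?_)
    have := abs_arctan_sub_arctan_le (U x) 0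
    simpa using this
  set C0 := (‖planeGen a b‖ * R) ^ 2 * (2 * M) with hC0
  set s : ℕ → ℝ := fun k => θ / (k + 1) with hs
  have hs0 : Tendsto s atTop (𝓝 0) := by
    have := (tendsto_one_div_add_atTop_nhds_zero_nat (𝕜 := ℝ)).const_mul θ
    simpa [hs, div_eq_mul_inv] using this
  have hm : ∀ θ, MeasurableSet (planeRot a b θ ⁻¹' Ω) := fun θ =>
    (measurePreserving_planeRot ha hb hab θ).measurable hΩo.measurableSet
  have hmf : ∀ θ, volume (planeRot a b θ ⁻¹' Ω) ≠ ⊤ := fun θ => by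
    rw [(measurePreserving_planeRot ha hb hab θ).measure_preimage
      hΩo.measurableSet.nullMeasurableSet]
    exact hΩf
  have hw : ∀ μ, 0 < μ → ∫ x, |v (planeRot a b θ x) - v x| ≤ θ / 2 * (C0 / μ) := by
    intro μ hμ
    have hk : ∀ k : ℕ, ∫ x, |v (planeRot a b θ x) - v x| ≤
        θ / 2 * (μ * volume.real (symmDiff Ω (planeRot a b (s k) ⁻¹' Ω)) + C0 / μ) := by
      intro k
      have hk1 : (0 : ℝ) < k + 1 := by positivity
      have e : ((k + 1 : ℕ) : ℝ) * s k = θ := by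
        simp only [hs]
        push_cast
        field_simp
      have h1 := integral_abs_comp_planeRot_nat_mul_le ha hb hab hvi (s k) (k + 1)
      rw [e] at h1
      have h2 := integral_abs_arctan_comp_planeRot_sub_le ha hb hab hU
        (fun k => (hφ k).contDiff_two) (fun k => (hφ k).2.1)
        (fun k => (hφ k).2.2.trans hR) hM hlim
        (D := symmDiff Ω (planeRot a b (s k) ⁻¹' Ω)) (θ := s k) (μ := μ)
        (hΩo.measurableSet.symmDiff (hm _)) ?_ (by positivity) hμ ?_
      · refine h1.trans ((mul_le_mul_of_nonneg_left h2 (by positivity)).trans (le_of_eq ?_))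
        rw [← e]
        push_cast
        ring
      · refine ne_top_of_le_ne_top (ENNReal.add_ne_top.2 ⟨hΩf, hmf (s k)⟩)
          ((measure_mono ?_).trans (measure_union_le _ _))
        exact symmDiff_le_sup
      · intro x hx
        rw [Set.mem_symmDiff, not_or, not_and_not_right, not_and_not_right] at hx
        simp only [hUdef]
        by_cases hxΩ : x ∈ Ω
        · have h3 : planeRot a b (s k) x ∈ Ω := hx.1 hxΩ
          rw [Set.indicator_of_mem hxΩ, Set.indicator_of_mem h3, hg, hg,
            norm_planeRot ha hb hab]
        · have h3 : planeRot a b (s k) x ∉ Ω := fun h => hxΩ (hx.2 h)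
          rw [Set.indicator_of_notMem hxΩ, Set.indicator_of_notMem h3]
    have hl := (((tendsto_measureReal_symmDiff_planeRot ha hb hab hΩo hΩf hs0).const_mul μ).add_const
      (C0 / μ)).const_mul (θ / 2)
    simpa using ge_of_tendsto' hl hk
  have h0 : ∫ x, |v (planeRot a b θ x) - v x| ≤ 0 := by
    have hl : Tendsto (fun μ : ℝ => θ / 2 * (C0 / μ)) atTop (𝓝 (θ / 2 * 0)) :=
      (tendsto_const_nhds.div_atTop tendsto_id).const_mul _
    rw [mul_zero] at hl
    exact ge_of_tendsto hl ((eventually_gt_atTop 0).mono hw)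
  have hi : Integrable fun x => |v (planeRot a b θ x) - v x| :=
    (((measurePreserving_planeRot ha hb hab θ).integrable_comp_of_integrable hvi).sub hvi).abs
  have h1 := (integral_eq_zero_iff_of_nonneg (fun x => abs_nonneg _) hi).1
    (le_antisymm h0 (integral_nonneg fun x => abs_nonneg _))
  filter_upwards [h1] with x hx
  exact Real.arctan_injective (sub_eq_zero.1 (abs_eq_zero.1 hx))

end

section

variable {n : ℕ}

/-- The convolution of two real functions on ℝⁿ. -/
def conv (f g : Euc n → ℝ) : Euc n → ℝ :=
  MeasureTheory.convolution f g (ContinuousLinearMap.mul ℝ ℝ) volume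

theorem conv_apply (f g : Euc n → ℝ) (x : Euc n) : conv f g x = ∫ y, f y * g (x - y) := rfl

theorem conv_comm (f g : Euc n → ℝ) : conv f g = conv g f := by
  ext x
  rw [conv, convolution_mul_swap, conv_apply]
  simp only [mul_comm]

theorem integrable_conv_integrand {f g : Euc n → ℝ} (hf : Integrable f) (hg : Continuous g)
    (hgc : HasCompactSupport g) (x : Euc n) : Integrable fun y => f y * g (x - y) := by
  obtain ⟨C, hC⟩ := hgc.exists_bound_of_continuous hg
  exact hf.mul_bdd (c := C) (hg.comp (continuous_const.sub continuous_id)).aestronglyMeasurable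
    (Eventually.of_forall fun y => hC _)

theorem fderiv_conv_apply {f g : Euc n → ℝ} (hf : Integrable f) (hg : ContDiff ℝ 1 g)
    (hgc : HasCompactSupport g) (x v : Euc n) :
    fderiv ℝ (conv f g) x v = conv f (fun y => fderiv ℝ g y v) x := by
  have h := hgc.hasFDerivAt_convolution_right (ContinuousLinearMap.mul ℝ ℝ)
    hf.locallyIntegrable hg x
  rw [conv, h.fderiv, convolution_precompR_apply _ hf.locallyIntegrable (hgc.fderiv ℝ)
    (hg.continuous_fderiv one_ne_zero)]
  rfl

theorem contDiff_conv {f g : Euc n → ℝ} (hf : Integrable f) {m : ℕ∞} (hg : ContDiff ℝ m g)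
    (hgc : HasCompactSupport g) : ContDiff ℝ m (conv f g) :=
  hgc.contDiff_convolution_right _ hf.locallyIntegrable hg

theorem lapl_conv {f g : Euc n → ℝ} (hf : Integrable f) (hg : ContDiff ℝ 2 g)
    (hgc : HasCompactSupport g) (x : Euc n) : lapl n (conv f g) x = conv f (lapl n g) x := by
  have h1 : ∀ i : Fin n, ContDiff ℝ 1 fun y => fderiv ℝ g y (stdVec i) := fun i =>
    contDiff_fderiv_apply hg le_rfl _
  have hc1 : ∀ i : Fin n, HasCompactSupport fun y => fderiv ℝ g y (stdVec i) := fun i =>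
    hgc.fderiv_apply (𝕜 := ℝ) _
  have h2 : ContDiff ℝ 2 (conv f g) := contDiff_conv hf (m := 2) hg hgc
  have h3 : ∀ i : Fin n, (fun y => fderiv ℝ (conv f g) y (stdVec i)) =
      conv f (fun y => fderiv ℝ g y (stdVec i)) := fun i => by
    ext y
    exact fderiv_conv_apply hf (hg.of_le one_le_two) hgc y _
  rw [lapl_eq_sum_fderiv h2]
  simp only [h3, fderiv_conv_apply hf (h1 _) (hc1 _)]
  simp only [conv_apply, lapl_eq_sum_fderiv hg, Finset.mul_sum]
  rw [integral_finsetSum]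
  intro i _
  exact integrable_conv_integrand hf
    (((h1 i).continuous_fderiv one_ne_zero).clm_apply continuous_const)
    ((hc1 i).fderiv_apply (𝕜 := ℝ) _) x

theorem tendsto_conv {F : ℕ → Euc n → ℝ} {f g : Euc n → ℝ} (hF : ∀ k, Integrable (F k))
    (hf : Integrable f) (h : Tendsto (fun k => ∫ x, |F k x - f x|) atTop (𝓝 0))
    (hg : Continuous g) (hgc : HasCompactSupport g) (x : Euc n) :
    Tendsto (fun k => conv (F k) g x) atTop (𝓝 (conv f g x)) := by
  obtain ⟨C, hC⟩ := hgc.exists_bound_of_continuous hg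
  rw [tendsto_iff_dist_tendsto_zero]
  have hb : Tendsto (fun k => (∫ x, |F k x - f x|) * C) atTop (𝓝 0) := by
    simpa using h.mul_const C
  refine squeeze_zero (fun k => dist_nonneg) (fun k => ?_) hb
  rw [Real.dist_eq, conv_apply, conv_apply, ← integral_sub
    (integrable_conv_integrand (hF k) hg hgc x) (integrable_conv_integrand hf hg hgc x),
    ← integral_mul_const]
  refine abs_integral_le_integral_abs.trans (integral_mono_of_nonneg
    (Eventually.of_forall fun y => abs_nonneg _) (((hF k).sub hf).abs.mul_const C)
    (Eventually.of_forall fun y => ?_))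
  beta_reduce
  rw [← sub_mul, abs_mul]
  exact mul_le_mul_of_nonneg_left (hC _) (abs_nonneg _)

/-- If `φ k → u` and `Δ(φ k) → f` in `L¹`, then `Δ(u * g) = f * g` for test functions `g`. -/
theorem lapl_conv_of_tendsto {φ : ℕ → Euc n → ℝ} {u f g : Euc n → ℝ}
    (hφ : ∀ k, ContDiff ℝ 2 (φ k)) (hc : ∀ k, HasCompactSupport (φ k)) (hu : Integrable u)
    (hf : Integrable f) (hφu : Tendsto (fun k => ∫ x, |φ k x - u x|) atTop (𝓝 0))
    (hφf : Tendsto (fun k => ∫ x, |lapl n (φ k) x - f x|) atTop (𝓝 0))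
    (hg : ContDiff ℝ 2 g) (hgc : HasCompactSupport g) (x : Euc n) :
    lapl n (conv u g) x = conv f g x := by
  have hφi : ∀ k, Integrable (φ k) := fun k =>
    (hφ k).continuous.integrable_of_hasCompactSupport (hc k)
  have h1 := tendsto_conv hφi hu hφu (continuous_lapl hg) (hasCompactSupport_lapl hgc) x
  have h2 := tendsto_conv (fun k => integrable_lapl (hφ k) (hc k)) hf hφf hg.continuous hgc x
  rw [lapl_conv hu hg hgc]
  refine tendsto_nhds_unique h1 (h2.congr fun k => ?_)
  rw [← lapl_conv (hφi k) hg hgc, conv_comm (φ k) g,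
    lapl_conv (hg.continuous.integrable_of_hasCompactSupport hgc) (hφ k) (hc k),
    conv_comm g]

theorem integral_abs_conv_le {f g : Euc n → ℝ} (hf : Integrable f) (hg : Continuous g)
    (hgc : HasCompactSupport g) (hg0 : ∀ x, 0 ≤ g x) (hg1 : ∫ x, g x = 1) :
    ∫ x, |conv f g x| ≤ ∫ x, |f x| := by
  have hgi := hg.integrable_of_hasCompactSupport hgc (μ := volume)
  have h : ∫ x, conv (fun y => |f y|) g x = ∫ x, |f x| := by
    have := integral_convolution (ContinuousLinearMap.mul ℝ ℝ) (hf.abs) hgi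
    rw [hg1] at this
    simpa [conv] using this
  rw [← h]
  refine integral_mono_of_nonneg (Eventually.of_forall fun x => abs_nonneg _)
    (hf.abs.integrable_convolution _ hgi) (Eventually.of_forall fun x => ?_)
  beta_reduce
  rw [conv_apply, conv_apply]
  refine abs_integral_le_integral_abs.trans (le_of_eq ?_)
  congr 1
  ext y
  rw [abs_mul, abs_of_nonneg (hg0 _)]

theorem integrable_conv {f g : Euc n → ℝ} (hf : Integrable f) (hg : Integrable g) :
    Integrable (conv f g) :=
  hf.integrable_convolution _ hg

theorem exists_radial_mollifier (n : ℕ) {ε : ℝ} (hε : 0 < ε) :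
    ∃ ρ : Euc n → ℝ, ContDiff ℝ 2 ρ ∧ HasCompactSupport ρ ∧
      Function.support ρ ⊆ Metric.ball 0 ε ∧ (∀ x y, ‖x‖ = ‖y‖ → ρ x = ρ y) ∧
      (∀ x, 0 ≤ ρ x) ∧ ∫ x, ρ x = 1 := by
  set k : Euc n → ℝ := fun x => Real.smoothTransition (1 - ‖x‖ ^ 2 / ε ^ 2) with hk
  have hkd : ContDiff ℝ 2 k := Real.smoothTransition.contDiff.comp
    (contDiff_const.sub ((contDiff_norm_sq ℝ).div_const _))
  have hks : Function.support k ⊆ Metric.ball 0 ε := by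
    intro x hx
    rw [mem_ball_zero_iff]
    by_contra! h
    refine hx (Real.smoothTransition.zero_of_nonpos ?_)
    rw [sub_nonpos, one_le_div (by positivity)]
    gcongr
  have hkc : HasCompactSupport k := HasCompactSupport.of_support_subset_isCompact
    (isCompact_closedBall 0 ε) (hks.trans Metric.ball_subset_closedBall)
  have hk0 : ∀ x, 0 ≤ k x := fun x => Real.smoothTransition.nonneg _
  have hI : 0 < ∫ x, k x :=
    hkd.continuous.integral_pos_of_hasCompactSupport_nonneg_nonzero hkc hk0 (x := 0) (by simp [hk])
  refine ⟨fun x => k x / ∫ x, k x, hkd.div_const _, ?_, ?_, ?_, ?_, ?_⟩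
  · exact hkc.comp_left (g := fun z => z / ∫ x, k x) (zero_div _)
  · intro x hx
    refine hks fun h => hx ?_
    simp only [h, zero_div]
  · intro x y h
    simp only [hk, h]
  · exact fun x => div_nonneg (hk0 x) hI.le
  · rw [integral_div, div_self hI.ne']

theorem integral_abs_conv_sub_le {φ : Euc n → ℝ} (hφ : Continuous φ)
    (hc : HasCompactSupport φ) {δ : ℝ} (hδ : 0 < δ) :
    ∃ ε > 0, ∀ ρ : Euc n → ℝ, Continuous ρ → Function.support ρ ⊆ Metric.ball 0 ε →
      (∀ x, 0 ≤ ρ x) → ∫ x, ρ x = 1 → ∫ x, |conv φ ρ x - φ x| ≤ δ := by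
  obtain ⟨R, hR⟩ := hc.isCompact.isBounded.subset_closedBall 0
  set K : Set (Euc n) := Metric.closedBall 0 (R + 1) with hK
  have hKf : volume K ≠ ⊤ := (isCompact_closedBall 0 (R + 1)).measure_lt_top.ne
  set η := δ / (volume.real K + 1) with hη
  have hη0 : 0 < η := by positivity
  obtain ⟨ε, hε, h⟩ := Metric.uniformContinuous_iff.1
    (hc.uniformContinuous_of_continuous hφ) η hη0
  refine ⟨min ε 1, by positivity, fun ρ hρ hs h0 h1 => ?_⟩
  have key : ∀ x, |conv φ ρ x - φ x| ≤ K.indicator (fun _ => η) x := by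
    intro x
    have hd : ∀ c e, 0 ≤ e → (∀ y ∈ Metric.ball x (min ε 1), dist (φ y) c ≤ e) →
        dist (conv φ ρ x) c ≤ e := by
      intro c e he hy
      rw [conv_comm]
      exact dist_convolution_le he hs h0 h1 hφ.aestronglyMeasurable hy
    by_cases hx : x ∈ K
    · rw [Set.indicator_of_mem hx, ← Real.dist_eq]
      refine hd _ _ hη0.le fun y hy => (h ?_).le
      exact (Metric.mem_ball.1 hy).trans_le (min_le_left _ _)
    · rw [Set.indicator_of_notMem hx, ← Real.dist_eq]
      have hz : ∀ y ∈ Metric.ball x (min ε 1), φ y = 0 := by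
        intro y hy
        by_contra hne
        refine hx ?_
        have e1 := mem_closedBall_zero_iff.1 (hR (subset_tsupport _ hne))
        have e2 : dist y x < 1 := (Metric.mem_ball.1 hy).trans_le (min_le_right _ _)
        rw [hK, mem_closedBall_zero_iff]
        rw [dist_eq_norm] at e2
        have e3 := norm_sub_norm_le x y
        rw [norm_sub_rev] at e3
        linarith
      rw [hz x (Metric.mem_ball_self (by positivity))]
      exact hd 0 0 le_rfl fun y hy => by rw [hz y hy, dist_self]
  calc ∫ x, |conv φ ρ x - φ x| ≤ ∫ x, K.indicator (fun _ => η) x :=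
        integral_mono_of_nonneg (Eventually.of_forall fun x => abs_nonneg _)
          ((integrable_indicator_iff measurableSet_closedBall).2 (integrableOn_const hKf))
          (Eventually.of_forall key)
    _ = volume.real K * η := by
        rw [integral_indicator_const _ measurableSet_closedBall, smul_eq_mul]
    _ ≤ δ := by
        rw [hη, mul_div_assoc', div_le_iff₀ (by positivity)]
        nlinarith [measureReal_nonneg (μ := (volume : Measure (Euc n))) (s := K)]

end

section

variable {n : ℕ} {Ω : Set (Euc n)}

theorem conv_eq_of_norm_eq (hn : 2 ≤ n) {U ρ : Euc n → ℝ}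
    (hU : ∀ a b : Euc n, inner ℝ a a = (1 : ℝ) → inner ℝ b b = (1 : ℝ) → inner ℝ a b = (0 : ℝ) →
      ∀ θ : ℝ, 0 < θ → ∀ᵐ x, U (planeRot a b θ x) = U x)
    (hρ : ∀ x y, ‖x‖ = ‖y‖ → ρ x = ρ y) {x y : Euc n} (h : ‖x‖ = ‖y‖) :
    conv U ρ x = conv U ρ y := by
  obtain ⟨a, b, ha, hb, hab, θ, hθ, rfl⟩ := exists_planeRot_eq hn h
  rw [conv_apply, conv_apply, ← (measurePreserving_planeRot ha hb hab θ).integral_comp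
    (measurableEmbedding_planeRot ha hb hab θ)
    fun y => U y * ρ (planeRot a b θ x - y)]
  refine integral_congr_ae ?_
  filter_upwards [hU a b ha hb hab θ hθ] with z hz
  rw [hz, ← map_sub]
  congr 1
  exact hρ _ _ (norm_planeRot ha hb hab θ _).symm

theorem exists_radial_approx (hn : 2 ≤ n) {φ : ℕ → Euc n → ℝ} {U F : Euc n → ℝ}
    (hφ : ∀ k, ContDiff ℝ 2 (φ k)) (hc : ∀ k, HasCompactSupport (φ k)) (hUi : Integrable U)
    (hUc : HasCompactSupport U) (hF : Integrable F)
    (hφu : Tendsto (fun k => ∫ x, |φ k x - U x|) atTop (𝓝 0))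
    (hφf : Tendsto (fun k => ∫ x, |lapl n (φ k) x - F x|) atTop (𝓝 0))
    (hU : ∀ a b : Euc n, inner ℝ a a = (1 : ℝ) → inner ℝ b b = (1 : ℝ) → inner ℝ a b = (0 : ℝ) →
      ∀ θ : ℝ, 0 < θ → ∀ᵐ x, U (planeRot a b θ x) = U x) {δ : ℝ} (hδ : 0 < δ) :
    ∃ ψ : Euc n → ℝ, ContDiff ℝ 2 ψ ∧ HasCompactSupport ψ ∧
      (∀ x y, ‖x‖ = ‖y‖ → ψ x = ψ y) ∧ ∫ x, |ψ x - U x| ≤ δ ∧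
      ∫ x, |lapl n ψ x| ≤ ∫ x, |F x| := by
  have hφi : ∀ k, Integrable (φ k) := fun k =>
    (hφ k).continuous.integrable_of_hasCompactSupport (hc k)
  obtain ⟨k, hk⟩ := (hφu.eventually (gt_mem_nhds (show 0 < δ / 3 by positivity))).exists
  obtain ⟨ε, hε, hε'⟩ := integral_abs_conv_sub_le (hφ k).continuous (hc k)
    (show 0 < δ / 3 by positivity)
  obtain ⟨ρ, hρ, hρc, hρs, hρr, hρ0, hρ1⟩ := exists_radial_mollifier n hε
  have hρi : Integrable ρ := hρ.continuous.integrable_of_hasCompactSupport hρc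
  refine ⟨conv U ρ, contDiff_conv hUi (m := 2) hρ hρc, hUc.convolution _ hρc,
    fun x y h => conv_eq_of_norm_eq hn hU hρr h, ?_, ?_⟩
  · have h1 := hε' ρ hρ.continuous hρs hρ0 hρ1
    have h2 := integral_abs_conv_le (hUi.sub (hφi k)) hρ.continuous hρc hρ0 hρ1
    have h3 : ∀ x, conv (U - φ k) ρ x = conv U ρ x - conv (φ k) ρ x := fun x => by
      rw [conv_apply, conv_apply, conv_apply, ← integral_sub
        (integrable_conv_integrand hUi hρ.continuous hρc x)
        (integrable_conv_integrand (hφi k) hρ.continuous hρc x)]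
      simp only [Pi.sub_apply, sub_mul]
    have h4 : ∫ x, |(U - φ k) x| = ∫ x, |φ k x - U x| := by
      simp only [Pi.sub_apply, abs_sub_comm]
    have i1 : Integrable fun x => |conv U ρ x - conv (φ k) ρ x| :=
      ((integrable_conv hUi hρi).sub (integrable_conv (hφi k) hρi)).abs
    have i2 : Integrable fun x => |conv (φ k) ρ x - φ k x| :=
      ((integrable_conv (hφi k) hρi).sub (hφi k)).abs
    have i3 : Integrable fun x => |φ k x - U x| := ((hφi k).sub hUi).abs
    have i4 : Integrable fun x =>
        |conv U ρ x - conv (φ k) ρ x| + |conv (φ k) ρ x - φ k x| := i1.add i2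
    simp only [h3] at h2
    rw [h4] at h2
    have h5 : ∫ x, |conv U ρ x - U x| ≤ ∫ x, (|conv U ρ x - conv (φ k) ρ x| +
        |conv (φ k) ρ x - φ k x| + |φ k x - U x|) := by
      refine integral_mono_of_nonneg (Eventually.of_forall fun x => abs_nonneg _) (i4.add i3)
        (Eventually.of_forall fun x => ?_)
      refine (abs_sub_le _ (φ k x) _).trans (add_le_add_left (abs_sub_le _ _ _) _)
    rw [integral_add i4 i3, integral_add i1 i2] at h5
    linarith
  · simp only [lapl_conv_of_tendsto hφ hc hUi hF hφu hφf hρ hρc]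
    exact integral_abs_conv_le hF hρ.continuous hρc hρ0 hρ1

theorem decRearr_le_of_radial (hn : 2 ≤ n) (hΩo : IsOpen Ω)
    (hΩb : Bornology.IsBounded Ω) {u f : Euc n → ℝ} (hu : MemW21Delta0 n Ω u f) {g : ℝ → ℝ}
    (hg : ∀ x, u x = g ‖x‖) {t : ℝ} (ht : 0 < t) (htV : t ≤ (volume Ω).toReal) :
    decRearr n Ω u t ≤ L1norm n Ω f / 2 * NstarV n (volume Ω).toReal t := by
  have hU := fun (a b : Euc n) ha hb hab θ hθ =>
    ae_indicator_comp_planeRot_eq hΩo hΩb hu hg (a := a) (b := b) ha hb hab (θ := θ) hθ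
  obtain ⟨hui, hfi, φ, hφ, hφu, hφf⟩ := hu
  have hN := NstarV_nonneg hn ht htV
  have hΩfin : volume Ω < ⊤ := hΩb.measure_lt_top
  set V := (volume Ω).toReal with hV
  set U := Ω.indicator u with hUdef
  have hUi : Integrable U := (integrable_indicator_iff hΩo.measurableSet).2 hui
  have hFi : Integrable (Ω.indicator f) := (integrable_indicator_iff hΩo.measurableSet).2 hfi
  have hUc : HasCompactSupport U := by
    obtain ⟨R, hR⟩ := hΩb.subset_closedBall 0
    exact HasCompactSupport.of_support_subset_isCompact (isCompact_closedBall 0 R)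
      (Set.support_indicator_subset.trans hR)
  have hL : ∫ x, |Ω.indicator f x| = L1norm n Ω f := by
    rw [L1norm, ← integral_indicator hΩo.measurableSet]
    congr 1
    ext x
    by_cases hx : x ∈ Ω <;> simp [hx]
  have hψ := fun k : ℕ => exists_radial_approx hn (fun k => (hφ k).contDiff_two)
    (fun k => (hφ k).2.1) hUi hUc hFi
    (by simpa only [hUdef, (hφ _).integral_abs_sub_indicator hΩo] using hφu)
    (by simpa only [(hφ _).integral_abs_lapl_sub_indicator hΩo] using hφf) hU
    (δ := 1 / ((k : ℝ) + 1)) (by positivity)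
  choose ψ hψd hψc hψr hψu hψl using hψ
  rw [hL] at hψl
  have hψi : ∀ k, Integrable (ψ k) := fun k =>
    (hψd k).continuous.integrable_of_hasCompactSupport (hψc k)
  have hψt : Tendsto (fun k => ∫ x, |ψ k x - U x|) atTop (𝓝 0) :=
    squeeze_zero (fun k => integral_nonneg fun x => abs_nonneg _) hψu
      tendsto_one_div_add_atTop_nhds_zero_nat
  have hL0 := L1norm_nonneg n Ω f
  refine decRearr_le_of_forall (mul_nonneg (by positivity) hN) fun s hs hst => ?_
  have hst' : ENNReal.ofReal t < volume {x | s < |U x|} := by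
    refine hst.trans_le (measure_mono fun x hx => ?_)
    change s < |U x|
    rw [hUdef, Set.indicator_of_mem hx.1]
    exact hx.2
  have hmono : ∀ k x, |(|ψ k x| - |U x|)| ≤ |ψ k x - U x| := fun k x => abs_abs_sub_abs_le _ _
  have key : ∀ η > 0, ∀ V' > V, s - 2 * η ≤ L1norm n Ω f / 2 * NstarV n V' t := by
    intro η hη V' hV'
    have hV'0 : 0 ≤ NstarV n V' t := NstarV_nonneg hn ht (htV.trans hV'.le)
    have hm := tendsto_measure_abs_ge_of_tendsto hψi hUi hψt hη
    have hm' : Tendsto (fun k => volume {x | η ≤ |(|ψ k x| - |U x|)|}) atTop (𝓝 0) :=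
      tendsto_of_tendsto_of_tendsto_of_le_of_le tendsto_const_nhds hm (fun _ => zero_le)
        fun k => measure_mono fun x (hx : η ≤ _) => hx.trans (hmono k x)
    have h1 := eventually_lt_measure_superlevel (g := fun k x => |ψ k x|) (f := fun x => |U x|)
      hm' hst'
    have h2 : ∀ᶠ k in atTop, volume Ω + volume {x | η ≤ |ψ k x - U x|} < ENNReal.ofReal V' := by
      have hl : Tendsto (fun k => volume Ω + volume {x | η ≤ |ψ k x - U x|}) atTop
          (𝓝 (volume Ω + 0)) := tendsto_const_nhds.add hm
      refine hl.eventually (gt_mem_nhds ?_)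
      rw [add_zero]
      exact (ENNReal.lt_ofReal_iff_toReal_lt hΩfin.ne).2 hV'
    obtain ⟨k, hk1, hk2⟩ := (h1.and h2).exists
    rcases le_or_gt (s - 2 * η) 0 with h0 | h0
    · exact h0.trans (by positivity)
    have h3 := sub_le_integral_lapl_mul_NstarV_radial hn (hψd k) (hψc k) (hψr k) (p := η)
      (q := s - η) (V := V') hη (by linarith) ht ?_ ?_
    · calc s - 2 * η = s - η - η := by ring
        _ ≤ _ := h3
        _ ≤ _ := by
          gcongr
          exact hψl k
    · rw [measureReal_def, ← ENNReal.ofReal_le_iff_le_toReal]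
      · exact hk1.le
      · exact (volume_superlevel_lt_top (φ := fun x => |ψ k x|) (hψc k).abs (by linarith)).ne
    · refine ENNReal.toReal_le_of_le_ofReal (ht.le.trans (htV.trans hV'.le)) ?_
      refine le_trans (measure_mono fun x hx => ?_) ((measure_union_le Ω _).trans hk2.le)
      by_cases hxΩ : x ∈ Ω
      · exact Or.inl hxΩ
      · right
        change η ≤ |ψ k x - U x|
        rw [hUdef, Set.indicator_of_notMem hxΩ, sub_zero]
        exact le_of_lt hx
  have hV0 : 0 < V := ht.trans_le htV
  have key2 : ∀ η > 0, s - 2 * η ≤ L1norm n Ω f / 2 * NstarV n V t := by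
    intro η hη
    have hl : Tendsto (fun V' => L1norm n Ω f / 2 * NstarV n V' t) (𝓝[>] V)
        (𝓝 (L1norm n Ω f / 2 * NstarV n V t)) :=
      ((continuousAt_NstarV_left hn hV0 ht).tendsto.mono_left nhdsWithin_le_nhds).const_mul _
    exact ge_of_tendsto hl (eventually_nhdsWithin_of_forall fun V' hV' => key η hη V' hV')
  have hl : Tendsto (fun η : ℝ => s - 2 * η) (𝓝[>] 0) (𝓝 (s - 2 * 0)) :=
    Tendsto.mono_left (Continuous.tendsto (by fun_prop) 0) nhdsWithin_le_nhds
  have := le_of_tendsto hl (eventually_nhdsWithin_of_forall fun η hη => key2 η hη)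
  simpa using this

theorem decRearr_div_le {u f : Euc n → ℝ} {t : ℝ} (hn : 2 ≤ n) (hf : L1norm n Ω f ≠ 0)
    (ht : 0 < t) (htV : t ≤ (volume Ω).toReal)
    (h : decRearr n Ω u t ≤ L1norm n Ω f / 2 * NstarV n (volume Ω).toReal t) :
    decRearr n Ω u t / (NstarV n (volume Ω).toReal t * L1norm n Ω f) ≤ 1 / 2 := by
  have hL : 0 < L1norm n Ω f := (L1norm_nonneg n Ω f).lt_of_ne' hf
  rcases (NstarV_nonneg hn ht htV).eq_or_lt with h0 | h0
  · rw [← h0]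
    norm_num
  · rw [div_le_iff₀ (by positivity)]
    linarith

end

/-- For Ω ⊆ ℝⁿ (n ≥ 2) open and bounded with 0 ∈ Ω, the supremum of
u*(t)/(N*_{|Ω|}(t) ‖Δu‖₁) over 0 < t ≤ |Ω| and radial u ∈ W^{2,1}_{Δ,0}(Ω) with Δu ≠ 0
equals 1/2, and the same supremum over nonnegative u ∈ W^{2,1}_{Δ,0}(Ω) with Δu ≠ 0
also equals 1/2. -/
theorem stmt_5 (n : ℕ) (hn : 2 ≤ n) (Ω : Set (Euc n)) (hΩo : IsOpen Ω)
    (hΩb : Bornology.IsBounded Ω) (h0 : (0 : Euc n) ∈ Ω) :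
    sSup {r : ℝ | ∃ u f : Euc n → ℝ, ∃ t : ℝ,
      MemW21Delta0 n Ω u f ∧ (∃ g : ℝ → ℝ, ∀ x, u x = g ‖x‖) ∧
      L1norm n Ω f ≠ 0 ∧ 0 < t ∧ t ≤ (volume Ω).toReal ∧
      r = decRearr n Ω u t / (NstarV n (volume Ω).toReal t * L1norm n Ω f)} = 1 / 2 ∧
    sSup {r : ℝ | ∃ u f : Euc n → ℝ, ∃ t : ℝ,
      MemW21Delta0 n Ω u f ∧ (∀ᵐ x ∂(volume.restrict Ω), 0 ≤ u x) ∧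
      L1norm n Ω f ≠ 0 ∧ 0 < t ∧ t ≤ (volume Ω).toReal ∧
      r = decRearr n Ω u t / (NstarV n (volume Ω).toReal t * L1norm n Ω f)} = 1 / 2 := by
  constructor
  · refine csSup_eq_of_forall_le_of_forall_lt_exists_gt ?_ ?_ ?_
    · obtain ⟨u, f, t, hu, hg, -, hf, ht, htV, -⟩ :=
        exists_lt_ratio hn hΩo hΩb h0 (w := 0) (by norm_num)
      exact ⟨_, u, f, t, hu, hg, hf, ht, htV, rfl⟩
    · rintro r ⟨u, f, t, hu, ⟨g, hg⟩, hf, ht, htV, rfl⟩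
      exact decRearr_div_le hn hf ht htV (decRearr_le_of_radial hn hΩo hΩb hu hg ht htV)
    · intro w hw
      obtain ⟨u, f, t, hu, hg, -, hf, ht, htV, hlt⟩ := exists_lt_ratio hn hΩo hΩb h0 hw
      exact ⟨_, ⟨u, f, t, hu, hg, hf, ht, htV, rfl⟩, hlt⟩
  · refine csSup_eq_of_forall_le_of_forall_lt_exists_gt ?_ ?_ ?_
    · obtain ⟨u, f, t, hu, -, hu0, hf, ht, htV, -⟩ :=
        exists_lt_ratio hn hΩo hΩb h0 (w := 0) (by norm_num)
      exact ⟨_, u, f, t, hu, Eventually.of_forall hu0, hf, ht, htV, rfl⟩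
    · rintro r ⟨u, f, t, hu, hu0, hf, ht, htV, rfl⟩
      exact decRearr_div_le hn hf ht htV (decRearr_le_of_nonneg hn hΩo hΩb hu hu0 ht htV)
    · intro w hw
      obtain ⟨u, f, t, hu, -, hu0, hf, ht, htV, hlt⟩ := exists_lt_ratio hn hΩo hΩb h0 hw
      exact ⟨_, ⟨u, f, t, hu, Eventually.of_forall hu0, hf, ht, htV, rfl⟩, hlt⟩
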